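/- arXiv:2401.04674 — 4 statements merged into one kernel-verified Lean document; each statement's English description precedes it below -/
import Mathlib

section
/- Fix k > 0, a : ℝ → ℂ smooth and 2π-periodic, 0 < δ < π/4, a cutoff φ_δ ∈ C_c^∞(ℝ) supported in (−δ, δ) with φ_δ = 1 on (−δ/2, δ/2), and ψ₊ : ℝ → ℝ smooth with ψ₊(r) = 0 for r ≤ 1 and ψ₊(r) = 1 for r ≥ 2. For σ > 0, ρ ≥ 0, φ ∈ ℝ define v̂_σ(ρ, φ) = ∫_{−δ}^{δ} ∫_0^∞ a(θ) φ_δ(θ) ψ₊(r) √r e^{i r (k − ρ cos(θ − φ))} e^{−σ r} dr dθ. Then for every ρ > 0 and every φ ∈ [−π, π] with |φ| ≥ 2δ, |φ − π| ≥ 2δ and |φ + π| ≥ 2δ, the limit v̂(ρ, φ) := lim_{σ→0⁺} v̂_σ(ρ, φ) exists, and for every integer N ≥ 2 there is a constant C_N (depending only on N, a, φ_δ, ψ₊, δ, k) such that |v̂(ρ, φ)| ≤ C_N ρ^{−N} for all such (ρ, φ). -/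
open MeasureTheory Filter Topology

noncomputable section

/-- The exponentially regularized conic Fourier transform, in polar coordinates
`ξ = ρ(cos φ, sin φ)`, of the conically localized leading outgoing term
`a(θ) e^{ikr}/√r`, localized by `ψ₊(r) φ_δ(θ)`:
`v̂_σ(ρ, φ) = ∫_{−δ}^{δ} ∫_0^∞ a(θ) φ_δ(θ) ψ₊(r) √r e^{ir(k − ρcos(θ−φ))} e^{−σr} dr dθ`. -/
def conicRegFT (k δ : ℝ) (a : ℝ → ℂ) (φδ ψ : ℝ → ℝ) (σ ρ φ : ℝ) : ℂ :=
  ∫ θ in (-δ)..δ, ∫ r in Set.Ioi (0 : ℝ),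
    a θ * (φδ θ : ℂ) * (ψ r : ℂ) * (Real.sqrt r : ℂ) *
      Complex.exp (Complex.I * r * (k - ρ * Real.cos (θ - φ)) - σ * r)

open Set

/-- The angular oscillatory integral with amplitude `b(θ) cos^p(θ - φ) / sin^q(θ - φ)`. -/
def angularIntegral (δ : ℝ) (p q : ℕ) (b : ℝ → ℂ) (φ l : ℝ) : ℂ :=
  ∫ θ in (-δ)..δ, b θ * (Real.cos (θ - φ) : ℂ) ^ p * ((Real.sin (θ - φ) : ℂ)⁻¹) ^ q *
    Complex.exp (-(Complex.I * l * Real.cos (θ - φ)))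

lemma hasDerivAt_ofReal_cos_sub (φ θ : ℝ) :
    HasDerivAt (fun θ : ℝ => (Real.cos (θ - φ) : ℂ)) (-(Real.sin (θ - φ) : ℂ)) θ := by
  have h := ((Real.hasDerivAt_cos (θ - φ)).comp_sub_const θ φ).ofReal_comp
  simpa using h

lemma hasDerivAt_ofReal_sin_sub (φ θ : ℝ) :
    HasDerivAt (fun θ : ℝ => (Real.sin (θ - φ) : ℂ)) (Real.cos (θ - φ) : ℂ) θ :=
  ((Real.hasDerivAt_sin (θ - φ)).comp_sub_const θ φ).ofReal_comp

lemma hasDerivAt_exp_cos_sub (φ l θ : ℝ) :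
    HasDerivAt (fun θ : ℝ => Complex.exp (-(Complex.I * l * Real.cos (θ - φ))))
      (Complex.I * l * Real.sin (θ - φ) *
        Complex.exp (-(Complex.I * l * Real.cos (θ - φ)))) θ := by
  have h := (((hasDerivAt_ofReal_cos_sub φ θ).const_mul (Complex.I * l)).neg).cexp
  refine h.congr_deriv ?_
  simp only [Pi.neg_apply]
  ring

lemma norm_exp_cos_sub (φ l θ : ℝ) :
    ‖Complex.exp (-(Complex.I * l * Real.cos (θ - φ)))‖ = 1 := by
  have : -(Complex.I * l * Real.cos (θ - φ)) = ((-(l * Real.cos (θ - φ)) : ℝ) : ℂ) * Complex.I := by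
    push_cast; ring
  rw [this, Complex.norm_exp_ofReal_mul_I]

lemma continuousOn_angular_amplitude {δ φ : ℝ} (p q : ℕ) {b : ℝ → ℂ} (hb : Continuous b)
    (hs : ∀ θ ∈ Icc (-δ) δ, Real.sin (θ - φ) ≠ 0) :
    ContinuousOn (fun θ : ℝ => b θ * (Real.cos (θ - φ) : ℂ) ^ p *
      ((Real.sin (θ - φ) : ℂ)⁻¹) ^ q) (Icc (-δ) δ) := by
  refine ContinuousOn.mul (by fun_prop) (ContinuousOn.pow (ContinuousOn.inv₀ (by fun_prop) ?_) q)
  intro θ hθ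
  exact_mod_cast hs θ hθ

lemma continuousOn_angular_integrand {δ φ : ℝ} (p q : ℕ) (l : ℝ) {b : ℝ → ℂ} (hb : Continuous b)
    (hs : ∀ θ ∈ Icc (-δ) δ, Real.sin (θ - φ) ≠ 0) :
    ContinuousOn (fun θ : ℝ => b θ * (Real.cos (θ - φ) : ℂ) ^ p *
      ((Real.sin (θ - φ) : ℂ)⁻¹) ^ q * Complex.exp (-(Complex.I * l * Real.cos (θ - φ))))
      (Icc (-δ) δ) :=
  (continuousOn_angular_amplitude p q hb hs).mul (by fun_prop)

lemma eq_zero_of_support_subset_Icc {δ : ℝ} {b : ℝ → ℂ} (hb : Continuous b)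
    (hsupp : Function.support b ⊆ Icc (-δ) δ) {x : ℝ} (hx : x ∉ Ioo (-δ) δ) : b x = 0 := by
  by_contra h
  have hopen : IsOpen (Function.support b) := hb.isOpen_support
  have := interior_maximal hsupp hopen (Function.mem_support.2 h)
  rw [interior_Icc] at this
  exact hx this

lemma hasDerivAt_angular_amplitude {φ θ : ℝ} (p q : ℕ) {b : ℝ → ℂ}
    (hb : DifferentiableAt ℝ b θ) (hs : Real.sin (θ - φ) ≠ 0) :
    HasDerivAt (fun θ : ℝ => b θ * (Real.cos (θ - φ) : ℂ) ^ p *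
        ((Real.sin (θ - φ) : ℂ)⁻¹) ^ (q + 1))
      (deriv b θ * (Real.cos (θ - φ) : ℂ) ^ p * ((Real.sin (θ - φ) : ℂ)⁻¹) ^ (q + 1)
        - p * (b θ * (Real.cos (θ - φ) : ℂ) ^ (p - 1) * ((Real.sin (θ - φ) : ℂ)⁻¹) ^ q)
        - (q + 1) * (b θ * (Real.cos (θ - φ) : ℂ) ^ (p + 1) *
            ((Real.sin (θ - φ) : ℂ)⁻¹) ^ (q + 2))) θ := by
  have hs' : (Real.sin (θ - φ) : ℂ) ≠ 0 := by exact_mod_cast hs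
  have h := (hb.hasDerivAt.mul ((hasDerivAt_ofReal_cos_sub φ θ).pow p)).mul
    (((hasDerivAt_ofReal_sin_sub φ θ).inv hs').pow (q + 1))
  refine h.congr_deriv ?_
  simp only [Pi.mul_apply, Pi.pow_apply, Pi.inv_apply, Nat.add_sub_cancel]
  generalize (Real.sin (θ - φ) : ℂ) = s at hs'
  generalize (Real.cos (θ - φ) : ℂ) = c
  have hi : s * s⁻¹ = 1 := mul_inv_cancel₀ hs'
  rw [div_eq_mul_inv, ← inv_pow]
  push_cast
  generalize s⁻¹ = t at hi
  linear_combination -(b θ * p * c ^ (p - 1) * t ^ q) * hi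

/-- One integration by parts in the angular variable. -/
lemma angularIntegral_by_parts {δ φ l : ℝ} (hδ : 0 < δ) (p q : ℕ) {b : ℝ → ℂ}
    (hb : ContDiff ℝ (⊤ : ℕ∞) b) (hsupp : Function.support b ⊆ Icc (-δ) δ)
    (hs : ∀ θ ∈ Icc (-δ) δ, Real.sin (θ - φ) ≠ 0) :
    Complex.I * l * angularIntegral δ p q b φ l =
      -(angularIntegral δ p (q + 1) (deriv b) φ l
        - p * angularIntegral δ (p - 1) q b φ l
        - (q + 1) * angularIntegral δ (p + 1) (q + 2) b φ l) := by
  have hle : -δ ≤ δ := by linarith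
  have hb' : Continuous (deriv b) := hb.continuous_deriv (by exact_mod_cast le_top)
  have hI : ∀ (p q : ℕ) {c : ℝ → ℂ}, Continuous c → IntervalIntegrable
      (fun θ : ℝ => c θ * (Real.cos (θ - φ) : ℂ) ^ p * ((Real.sin (θ - φ) : ℂ)⁻¹) ^ q *
        Complex.exp (-(Complex.I * l * Real.cos (θ - φ)))) volume (-δ) δ := fun p q c hc =>
    ContinuousOn.intervalIntegrable (by
      rw [uIcc_of_le hle]; exact continuousOn_angular_integrand p q l hc hs)
  have hA : ∀ (p q : ℕ) {c : ℝ → ℂ}, Continuous c → IntervalIntegrable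
      (fun θ : ℝ => c θ * (Real.cos (θ - φ) : ℂ) ^ p * ((Real.sin (θ - φ) : ℂ)⁻¹) ^ q)
        volume (-δ) δ := fun p q c hc =>
    ContinuousOn.intervalIntegrable (by
      rw [uIcc_of_le hle]; exact continuousOn_angular_amplitude p q hc hs)
  have key := intervalIntegral.integral_mul_deriv_eq_deriv_mul (a := -δ) (b := δ)
    (fun θ hθ => hasDerivAt_angular_amplitude p q
      ((hb.differentiable (by simp)) θ) (hs θ (by rwa [uIcc_of_le hle] at hθ)))
    (fun θ _ => hasDerivAt_exp_cos_sub φ l θ)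
    (((hA p (q + 1) hb').sub ((hA (p - 1) q hb.continuous).const_mul _)).sub
      ((hA (p + 1) (q + 2) hb.continuous).const_mul _))
    (Continuous.intervalIntegrable (by fun_prop) _ _)
  rw [eq_zero_of_support_subset_Icc hb.continuous hsupp (x := δ) (by simp),
    eq_zero_of_support_subset_Icc hb.continuous hsupp (x := -δ) (by simp)] at key
  simp only [zero_mul, sub_zero, zero_sub] at key
  unfold angularIntegral
  rw [← intervalIntegral.integral_const_mul, ← intervalIntegral.integral_const_mul,
    ← intervalIntegral.integral_const_mul,
    ← intervalIntegral.integral_sub (hI p (q + 1) hb') ((hI (p - 1) q hb.continuous).const_mul _),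
    ← intervalIntegral.integral_sub
      ((hI p (q + 1) hb').sub ((hI (p - 1) q hb.continuous).const_mul _))
      ((hI (p + 1) (q + 2) hb.continuous).const_mul _)]
  refine Eq.trans ?_ (key.trans ?_)
  · refine intervalIntegral.integral_congr fun θ hθ => ?_
    rw [uIcc_of_le hle] at hθ
    have hs' : (Real.sin (θ - φ) : ℂ) ≠ 0 := by exact_mod_cast hs θ hθ
    rw [pow_succ ((Real.sin (θ - φ) : ℂ)⁻¹)]
    generalize Complex.exp _ = e
    field_simp
  · congr 1
    refine intervalIntegral.integral_congr fun θ _ => ?_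
    ring

lemma exists_norm_le_of_support_subset_Icc {δ : ℝ} {b : ℝ → ℂ} (hb : Continuous b)
    (hsupp : Function.support b ⊆ Icc (-δ) δ) : ∃ M, 0 ≤ M ∧ ∀ θ, ‖b θ‖ ≤ M := by
  obtain ⟨M, hM⟩ := hb.bounded_above_of_compact_support
    (HasCompactSupport.of_support_subset_isCompact isCompact_Icc hsupp)
  exact ⟨M, (norm_nonneg _).trans (hM 0), hM⟩

/-- Non-stationary phase: rapid decay of the angular integrals, uniformly over all angles `φ`
for which `|sin (θ - φ)|` is bounded below by `s` on the support of the amplitude. -/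
lemma exists_norm_angularIntegral_le {δ s : ℝ} (hδ : 0 < δ) (hs : 0 < s) (N : ℕ) :
    ∀ (p q : ℕ) {b : ℝ → ℂ}, ContDiff ℝ (⊤ : ℕ∞) b → Function.support b ⊆ Icc (-δ) δ →
      ∃ C, 0 ≤ C ∧ ∀ φ l : ℝ, (∀ θ ∈ Icc (-δ) δ, s ≤ |Real.sin (θ - φ)|) → 0 < l →
        ‖angularIntegral δ p q b φ l‖ ≤ C / l ^ N := by
  induction N with
  | zero =>
    intro p q b hb hsupp
    obtain ⟨M, hM0, hM⟩ := exists_norm_le_of_support_subset_Icc hb.continuous hsupp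
    refine ⟨M * 1 * (s⁻¹) ^ q * 1 * |δ - -δ|, by positivity, fun φ l hφ _ => ?_⟩
    rw [pow_zero, div_one]
    refine intervalIntegral.norm_integral_le_of_norm_le_const fun θ hθ => ?_
    rw [uIoc_of_le (by linarith)] at hθ
    rw [norm_mul, norm_mul, norm_mul, norm_exp_cos_sub, norm_pow, norm_pow, norm_inv,
      Complex.norm_real, Complex.norm_real, Real.norm_eq_abs, Real.norm_eq_abs]
    have h1 : |Real.cos (θ - φ)| ^ p ≤ 1 := pow_le_one₀ (abs_nonneg _) (Real.abs_cos_le_one _)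
    have h2 := hφ θ (Ioc_subset_Icc_self hθ)
    have h3 := hM θ
    gcongr
  | succ N ih =>
    intro p q b hb hsupp
    have hb' : ContDiff ℝ (⊤ : ℕ∞) (deriv b) := by
      exact ((contDiff_succ_iff_deriv (n := (⊤ : ℕ∞))).1 (by simpa using hb)).2.2
    have hsupp' : Function.support (deriv b) ⊆ Icc (-δ) δ :=
      support_deriv_subset.trans (closure_minimal hsupp isClosed_Icc)
    obtain ⟨C₁, hC₁, h₁⟩ := ih p (q + 1) hb' hsupp'
    obtain ⟨C₂, hC₂, h₂⟩ := ih (p - 1) q hb hsupp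
    obtain ⟨C₃, hC₃, h₃⟩ := ih (p + 1) (q + 2) hb hsupp
    refine ⟨C₁ + p * C₂ + (q + 1) * C₃, by positivity, fun φ l hφ hl => ?_⟩
    have hne : ∀ θ ∈ Icc (-δ) δ, Real.sin (θ - φ) ≠ 0 := fun θ hθ =>
      abs_pos.1 (hs.trans_le (hφ θ hθ))
    have key := congrArg norm (angularIntegral_by_parts (l := l) hδ p q hb hsupp hne)
    rw [norm_mul, norm_mul, Complex.norm_I, one_mul, Complex.norm_real, Real.norm_eq_abs,
      abs_of_pos hl, norm_neg] at key
    have hq : ‖((q : ℂ) + 1)‖ = q + 1 := by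
      rw [← Nat.cast_succ, Complex.norm_natCast]; push_cast; ring
    have hle : l * ‖angularIntegral δ p q b φ l‖ ≤
        C₁ / l ^ N + p * (C₂ / l ^ N) + (q + 1) * (C₃ / l ^ N) := by
      rw [key]
      refine (norm_sub_le _ _).trans (add_le_add ((norm_sub_le _ _).trans (add_le_add
        (h₁ φ l hφ hl) ?_)) ?_)
      · rw [norm_mul, Complex.norm_natCast]
        exact mul_le_mul_of_nonneg_left (h₂ φ l hφ hl) (by positivity)
      · rw [norm_mul, hq]
        exact mul_le_mul_of_nonneg_left (h₃ φ l hφ hl) (by positivity)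
    rw [pow_succ, ← div_div, le_div_iff₀ hl, mul_comm]
    refine hle.trans (le_of_eq ?_)
    ring

lemma sin_le_abs_sin_sub {δ φ θ : ℝ} (hδ0 : 0 < δ) (hδπ : δ < Real.pi / 4)
    (hφ : φ ∈ Icc (-Real.pi) Real.pi) (h0 : 2 * δ ≤ |φ|) (h1 : 2 * δ ≤ |φ - Real.pi|)
    (h2 : 2 * δ ≤ |φ + Real.pi|) (hθ : θ ∈ Icc (-δ) δ) :
    Real.sin δ ≤ |Real.sin (θ - φ)| := by
  have aux : ∀ x, δ ≤ x → x ≤ Real.pi - δ → Real.sin δ ≤ Real.sin x := by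
    intro x hx hx'
    rcases le_total x (Real.pi / 2) with h | h
    · exact Real.sin_le_sin_of_le_of_le_pi_div_two (by linarith) h hx
    · rw [← Real.sin_pi_sub x]
      exact Real.sin_le_sin_of_le_of_le_pi_div_two (by linarith) (by linarith) (by linarith)
  obtain ⟨hφ1, hφ2⟩ := hφ
  obtain ⟨hθ1, hθ2⟩ := hθ
  rw [abs_of_nonpos (by linarith)] at h1
  rw [abs_of_nonneg (by linarith)] at h2
  rcases le_abs'.1 h0 with h | h
  · exact (aux (θ - φ) (by linarith) (by linarith)).trans (le_abs_self _)
  · rw [← abs_neg, ← Real.sin_neg]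
    exact (aux (-(θ - φ)) (by linarith) (by linarith)).trans (le_abs_self _)

lemma exists_abs_le_of_eq_const_outside {ψ : ℝ → ℝ} (hψ : Continuous ψ)
    (hψ0 : ∀ r : ℝ, r ≤ 1 → ψ r = 0) (hψ1 : ∀ r : ℝ, 2 ≤ r → ψ r = 1) :
    ∃ M, 0 ≤ M ∧ ∀ r, |ψ r| ≤ M := by
  obtain ⟨M, hM⟩ := isCompact_Icc.exists_bound_of_continuousOn (s := Icc (1 : ℝ) 2) hψ.continuousOn
  refine ⟨max M 1, by positivity, fun r => ?_⟩
  rcases le_total r 1 with h | h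
  · rw [hψ0 r h]; simp
  rcases le_total r 2 with h' | h'
  · exact (hM r ⟨h, h'⟩).trans (le_max_left _ _)
  · rw [hψ1 r h']; simp

/-- The integrand in the radial variable after the angular integration. -/
def radialIntegrand (k δ : ℝ) (b : ℝ → ℂ) (ψ : ℝ → ℝ) (ρ φ σ r : ℝ) : ℂ :=
  (ψ r : ℂ) * (Real.sqrt r : ℂ) * Complex.exp (Complex.I * r * k - σ * r) *
    angularIntegral δ 0 0 b φ (r * ρ)

lemma integrableOn_sqrt_mul_exp_neg {σ : ℝ} (hσ : 0 < σ) :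
    IntegrableOn (fun r : ℝ => Real.sqrt r * Real.exp (-σ * r)) (Ioi 0) := by
  have h := integrableOn_rpow_mul_exp_neg_mul_rpow (s := 1 / 2) (p := 1) (b := σ)
    (by norm_num) one_pos hσ
  simpa [Real.sqrt_eq_rpow] using h

lemma norm_exp_regularized_phase (k σ r : ℝ) :
    ‖Complex.exp (Complex.I * r * k - σ * r)‖ = Real.exp (-σ * r) := by
  rw [Complex.norm_exp]
  simp

/-- Fubini: for `σ > 0` the angular integration may be carried out first. -/
lemma conicRegFT_eq_integral_radialIntegrand {k δ σ : ℝ} (hδ : 0 < δ) (hσ : 0 < σ) {a : ℝ → ℂ}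
    {φδ ψ : ℝ → ℝ} (ha : Continuous a) (hφδ : Continuous φδ) (hψ : Continuous ψ)
    {M M' : ℝ} (hM : ∀ θ, ‖a θ * (φδ θ : ℂ)‖ ≤ M) (hM' : ∀ r, |ψ r| ≤ M') (ρ φ : ℝ) :
    conicRegFT k δ a φδ ψ σ ρ φ =
      ∫ r in Ioi (0 : ℝ), radialIntegrand k δ (fun θ => a θ * (φδ θ : ℂ)) ψ ρ φ σ r := by
  have hle : -δ ≤ δ := by linarith
  have hM0 : 0 ≤ M := (norm_nonneg _).trans (hM 0)
  unfold conicRegFT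
  rw [intervalIntegral.integral_of_le hle, integral_integral_swap]
  · refine integral_congr_ae (Eventually.of_forall fun r => ?_)
    simp only [radialIntegrand, angularIntegral]
    rw [intervalIntegral.integral_of_le hle, ← integral_const_mul]
    refine integral_congr_ae (Eventually.of_forall fun θ => ?_)
    simp only [pow_zero, mul_one]
    have : Complex.I * r * (k - ρ * Real.cos (θ - φ)) - σ * r =
        (Complex.I * r * k - σ * r) + -(Complex.I * ((r * ρ : ℝ) : ℂ) * Real.cos (θ - φ)) := by
      push_cast; ring
    rw [this, Complex.exp_add]
    ring
  · have hg : Integrable (fun z : ℝ × ℝ => M * (M' * (Real.sqrt z.2 * Real.exp (-σ * z.2))))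
        ((volume.restrict (Ioc (-δ) δ)).prod (volume.restrict (Ioi 0))) :=
      Integrable.mul_prod (f := fun _ : ℝ => M)
        (g := fun r => M' * (Real.sqrt r * Real.exp (-σ * r))) (integrable_const M)
        ((integrableOn_sqrt_mul_exp_neg hσ).const_mul M')
    refine hg.mono' (Continuous.aestronglyMeasurable (by
      unfold Function.uncurry; fun_prop)) (Eventually.of_forall fun z => ?_)
    simp only [Function.uncurry]
    have hE : ‖Complex.exp (Complex.I * z.2 * (k - ρ * Real.cos (z.1 - φ)) - σ * z.2)‖ =
        Real.exp (-σ * z.2) := by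
      rw [← norm_exp_regularized_phase (k - ρ * Real.cos (z.1 - φ)) σ z.2]
      push_cast
      rfl
    rw [norm_mul, norm_mul, norm_mul, hE, Complex.norm_real, Complex.norm_real, Real.norm_eq_abs,
      Real.norm_eq_abs, abs_of_nonneg (Real.sqrt_nonneg _), mul_assoc, mul_assoc]
    have h1 := hM z.1
    have h2 := hM' z.2
    gcongr

lemma continuous_radialIntegrand {k δ : ℝ} {b : ℝ → ℂ} {ψ : ℝ → ℝ} (hb : Continuous b)
    (hψ : Continuous ψ) (ρ φ σ : ℝ) : Continuous (radialIntegrand k δ b ψ ρ φ σ) := by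
  unfold radialIntegrand angularIntegral
  refine Continuous.mul (by fun_prop) ?_
  refine intervalIntegral.continuous_parametric_intervalIntegral_of_continuous' ?_ _ _
  simp only [pow_zero, mul_one]
  unfold Function.uncurry
  fun_prop

lemma norm_radialIntegrand_le {k δ ρ φ σ r C M' : ℝ} {b : ℝ → ℂ} {ψ : ℝ → ℝ} {N : ℕ} (hσ : 0 ≤ σ)
    (hρ : 0 < ρ) (hr : 0 < r) (hψ0 : ∀ r : ℝ, r ≤ 1 → ψ r = 0) (hM' : ∀ r, |ψ r| ≤ M')
    (hC : ∀ l : ℝ, 0 < l → ‖angularIntegral δ 0 0 b φ l‖ ≤ C / l ^ N) :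
    ‖radialIntegrand k δ b ψ ρ φ σ r‖ ≤
      M' * C / ρ ^ N * (Ioi (1 : ℝ)).indicator (fun r => r ^ ((1 : ℝ) / 2 - N)) r := by
  unfold radialIntegrand
  rcases le_or_gt r 1 with h | h
  · rw [hψ0 r h, indicator_of_notMem (by simpa using h)]
    simp
  · rw [indicator_of_mem (show r ∈ Ioi (1 : ℝ) from h), norm_mul, norm_mul, norm_mul,
      norm_exp_regularized_phase, Complex.norm_real, Complex.norm_real, Real.norm_eq_abs,
      Real.norm_eq_abs, abs_of_nonneg (Real.sqrt_nonneg _)]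
    have h1 := hM' r
    have h2 := hC (r * ρ) (by positivity)
    have h3 : Real.exp (-σ * r) ≤ 1 := Real.exp_le_one_iff.2 (by nlinarith)
    have hM0 : 0 ≤ M' := (abs_nonneg _).trans h1
    calc |ψ r| * Real.sqrt r * Real.exp (-σ * r) * ‖angularIntegral δ 0 0 b φ (r * ρ)‖
        ≤ M' * Real.sqrt r * 1 * (C / (r * ρ) ^ N) := by gcongr
      _ = M' * C / ρ ^ N * r ^ ((1 : ℝ) / 2 - N) := by
        rw [Real.rpow_sub hr, Real.rpow_natCast, ← Real.sqrt_eq_rpow, mul_pow]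
        field_simp

lemma integrable_indicator_rpow {N : ℕ} (hN : 2 ≤ N) :
    Integrable ((Ioi (1 : ℝ)).indicator (fun r : ℝ => r ^ ((1 : ℝ) / 2 - N))) := by
  rw [integrable_indicator_iff measurableSet_Ioi]
  refine integrableOn_Ioi_rpow_of_lt ?_ one_pos
  have : (2 : ℝ) ≤ N := by exact_mod_cast hN
  linarith

/-- **Rapid decay of the conic Fourier transform away from the forward and backward
directions.**  For `φ ∈ [−π, π]` with `|φ| ≥ 2δ`, `|φ − π| ≥ 2δ`, `|φ + π| ≥ 2δ` and `ρ > 0`,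
the limit `v̂(ρ,φ) = lim_{σ→0⁺} v̂_σ(ρ,φ)` exists and, for every integer `N ≥ 2`,
`|v̂(ρ,φ)| ≤ C_N ρ^{−N}` with `C_N` independent of `(ρ, φ)`. -/
theorem conic_fourier_transform_angular_decay
    (k : ℝ) (hk : 0 < k)
    (a : ℝ → ℂ) (ha : ContDiff ℝ (⊤ : ℕ∞) a) (haper : ∀ θ : ℝ, a (θ + 2 * Real.pi) = a θ)
    (δ : ℝ) (hδ0 : 0 < δ) (hδπ : δ < Real.pi / 4)
    (φδ : ℝ → ℝ) (hφδ : ContDiff ℝ (⊤ : ℕ∞) φδ) (hφδc : HasCompactSupport φδ)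
    (hφδsupp : Function.support φδ ⊆ Set.Ioo (-δ) δ)
    (hφδ1 : ∀ t ∈ Set.Ioo (-(δ / 2)) (δ / 2), φδ t = 1)
    (ψ : ℝ → ℝ) (hψ : ContDiff ℝ (⊤ : ℕ∞) ψ)
    (hψ0 : ∀ r : ℝ, r ≤ 1 → ψ r = 0) (hψ1 : ∀ r : ℝ, 2 ≤ r → ψ r = 1) :
    ∃ vh : ℝ → ℝ → ℂ,
      (∀ ρ : ℝ, 0 < ρ → ∀ φ ∈ Set.Icc (-Real.pi) Real.pi,
        2 * δ ≤ |φ| → 2 * δ ≤ |φ - Real.pi| → 2 * δ ≤ |φ + Real.pi| →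
        Tendsto (fun σ : ℝ => conicRegFT k δ a φδ ψ σ ρ φ) (𝓝[>] 0) (𝓝 (vh ρ φ))) ∧
      (∀ N : ℕ, 2 ≤ N → ∃ C : ℝ, ∀ ρ : ℝ, 0 < ρ → ∀ φ ∈ Set.Icc (-Real.pi) Real.pi,
        2 * δ ≤ |φ| → 2 * δ ≤ |φ - Real.pi| → 2 * δ ≤ |φ + Real.pi| →
        ‖vh ρ φ‖ ≤ C / ρ ^ N) := by
  have hb : ContDiff ℝ (⊤ : ℕ∞) (fun θ => a θ * (φδ θ : ℂ)) :=
    ha.mul (Complex.ofRealCLM.contDiff.comp hφδ)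
  have hsupp : Function.support (fun θ => a θ * (φδ θ : ℂ)) ⊆ Icc (-δ) δ := fun θ hθ =>
    Ioo_subset_Icc_self (hφδsupp fun h => hθ (by simp [h]))
  obtain ⟨M, -, hM⟩ := exists_norm_le_of_support_subset_Icc hb.continuous hsupp
  obtain ⟨M', -, hM'⟩ := exists_abs_le_of_eq_const_outside hψ.continuous hψ0 hψ1
  have hsin : 0 < Real.sin δ := Real.sin_pos_of_pos_of_lt_pi hδ0 (by linarith [Real.pi_pos])
  refine ⟨fun ρ φ => ∫ r in Ioi (0 : ℝ),
    radialIntegrand k δ (fun θ => a θ * (φδ θ : ℂ)) ψ ρ φ 0 r, ?_, ?_⟩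
  · intro ρ hρ φ hφ h0 h1 h2
    obtain ⟨C, -, hC⟩ := exists_norm_angularIntegral_le hδ0 hsin 2 0 0 hb hsupp
    have hC' := fun l => hC φ l fun θ => sin_le_abs_sin_sub hδ0 hδπ hφ h0 h1 h2
    have hlim : Tendsto (fun σ : ℝ => ∫ r in Ioi (0 : ℝ),
        radialIntegrand k δ (fun θ => a θ * (φδ θ : ℂ)) ψ ρ φ σ r) (𝓝[>] 0)
        (𝓝 (∫ r in Ioi (0 : ℝ),
          radialIntegrand k δ (fun θ => a θ * (φδ θ : ℂ)) ψ ρ φ 0 r)) := by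
      refine tendsto_integral_filter_of_dominated_convergence _
        (Eventually.of_forall fun σ =>
          (continuous_radialIntegrand hb.continuous hψ.continuous ρ φ σ).aestronglyMeasurable)
        ?_ (((integrable_indicator_rpow le_rfl).const_mul (M' * C / ρ ^ 2)).restrict)
        (Eventually.of_forall fun r => ?_)
      · filter_upwards [self_mem_nhdsWithin] with σ hσ
        filter_upwards [ae_restrict_mem measurableSet_Ioi] with r hr
        exact norm_radialIntegrand_le (le_of_lt hσ) hρ hr hψ0 hM' hC'
      · have hcont : Continuous fun σ : ℝ =>
            radialIntegrand k δ (fun θ => a θ * (φδ θ : ℂ)) ψ ρ φ σ r := by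
          unfold radialIntegrand
          fun_prop
        exact (hcont.tendsto 0).mono_left nhdsWithin_le_nhds
    refine hlim.congr' ?_
    filter_upwards [self_mem_nhdsWithin] with σ hσ
    exact (conicRegFT_eq_integral_radialIntegrand hδ0 hσ ha.continuous hφδ.continuous
      hψ.continuous hM hM' ρ φ).symm
  · intro N hN
    obtain ⟨C, -, hC⟩ := exists_norm_angularIntegral_le hδ0 hsin N 0 0 hb hsupp
    refine ⟨M' * C * ∫ r in Ioi (0 : ℝ),
      (Ioi (1 : ℝ)).indicator (fun r : ℝ => r ^ ((1 : ℝ) / 2 - N)) r, ?_⟩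
    intro ρ hρ φ hφ h0 h1 h2
    have hC' := fun l => hC φ l fun θ => sin_le_abs_sin_sub hδ0 hδπ hφ h0 h1 h2
    refine (norm_integral_le_of_norm_le
      (((integrable_indicator_rpow hN).const_mul (M' * C / ρ ^ N)).restrict) ?_).trans_eq ?_
    · filter_upwards [ae_restrict_mem measurableSet_Ioi] with r hr
      exact norm_radialIntegrand_le le_rfl hρ hr hψ0 hM' hC'
    · rw [integral_const_mul]
      ring
end
end

section
/- Fix k > 0 and a : ℝ → ℂ smooth and 2π-periodic. For 0 < δ < π/4 let φ_δ ∈ C_c^∞(ℝ) be supported in (−δ, δ) with φ_δ = 1 on (−δ/2, δ/2), let ψ₊ : ℝ → ℝ be smooth with ψ₊(r) = 0 for r ≤ 1 and ψ₊(r) = 1 for r ≥ 2, and for σ > 0 and ξ = ρ(cos φ, sin φ) ∈ ℝ² define v̂_σ(ξ) = ∫_{−δ}^{δ} ∫_0^∞ a(θ) φ_δ(θ) ψ₊(r) √r e^{i r (k − ρ cos(θ − φ))} e^{−σ r} dr dθ. Then for every ν > 0 there exists δ₀ ∈ (0, π/4) such that for every δ ∈ (0, δ₀]: the limit v̂(ξ)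 := lim_{σ→0⁺} v̂_σ(ξ) exists for every ξ ∈ ℝ² with |ξ − (k, 0)| ≥ ν; v̂ is C^∞ on the open set {ξ ∈ ℝ² : |ξ − (k, 0)| > ν}; and for every multi-index α and every N ∈ ℕ there is a constant C_{α,N} with |∂^α v̂(ξ)| ≤ C_{α,N} (1 + |ξ|)^{−N} for all ξ with |ξ − (k, 0)| ≥ ν. -/
open MeasureTheory Filter Topology

noncomputable section

theorem deriv_eq_zero_of_eqOn_const {E : Type*} [NormedAddCommGroup E] [NormedSpace ℝ E]
    {f : ℝ → E} {s : Set ℝ} {c : E} {x : ℝ} (hs : UniqueDiffOn ℝ s) (hf : Differentiable ℝ f)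
    (h : ∀ y ∈ s, f y = c) (hx : x ∈ s) : deriv f x = 0 := by
  have h1 : HasDerivWithinAt f (deriv f x) s x := (hf x).hasDerivAt.hasDerivWithinAt
  have h2 : HasDerivWithinAt f 0 s x :=
    (hasDerivWithinAt_const x s c).congr h (h x hx)
  exact (hs x hx).eq_deriv _ h1 h2

/-- Smooth functions that vanish for `r ≤ 1` and are constant for `r ≥ 2`. -/
structure IsRadialCutoff (χ : ℝ → ℝ) : Prop where
  contDiff : ContDiff ℝ (⊤ : ℕ∞) χ
  eq_zero : ∀ r ≤ 1, χ r = 0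
  eq_const : ∃ c, ∀ r ≥ 2, χ r = c

namespace IsRadialCutoff

variable {χ : ℝ → ℝ}

theorem differentiable (h : IsRadialCutoff χ) : Differentiable ℝ χ :=
  h.contDiff.differentiable (by simp)

theorem exists_bound (h : IsRadialCutoff χ) : ∃ C, 0 ≤ C ∧ ∀ r, |χ r| ≤ C := by
  obtain ⟨c, hc⟩ := h.eq_const
  obtain ⟨C, hC⟩ := isCompact_Icc.exists_bound_of_continuousOn (s := Set.Icc (1 : ℝ) 2)
    h.contDiff.continuous.continuousOn
  refine ⟨max C |c|, le_max_of_le_right (abs_nonneg c), fun r => ?_⟩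
  rcases le_total r 1 with h1 | h1
  · rw [h.eq_zero r h1, abs_zero]
    exact le_max_of_le_right (abs_nonneg c)
  rcases le_total r 2 with h2 | h2
  · exact le_max_of_le_left (hC r ⟨h1, h2⟩)
  · rw [hc r h2]
    exact le_max_right _ _

/-- The operator on cutoffs induced by differentiating `χ(r) r ^ m`. -/
theorem euler (h : IsRadialCutoff χ) (m : ℝ) :
    IsRadialCutoff fun r => r * deriv χ r + m * χ r := by
  obtain ⟨c, hc⟩ := h.eq_const
  refine ⟨?_, fun r hr => ?_, m * c, fun r hr => ?_⟩
  · have : ContDiff ℝ (⊤ : ℕ∞) (deriv χ) := by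
      have := h.contDiff.iterate_deriv 1
      simpa using this
    exact (contDiff_id.mul this).add (contDiff_const.mul h.contDiff)
  · simp [deriv_eq_zero_of_eqOn_const (uniqueDiffOn_Iic 1) h.differentiable h.eq_zero hr,
      h.eq_zero r hr]
  · simp [deriv_eq_zero_of_eqOn_const (uniqueDiffOn_Ici 2) h.differentiable hc hr, hc r hr]

theorem hasDerivAt_mul_rpow (h : IsRadialCutoff χ) (m : ℝ) {r : ℝ} (hr : 0 < r) :
    HasDerivAt (fun r => χ r * r ^ m) ((r * deriv χ r + m * χ r) * r ^ (m - 1)) r := by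
  have := (h.differentiable r).hasDerivAt.mul (Real.hasDerivAt_rpow_const (p := m) (Or.inl hr.ne'))
  refine this.congr_deriv ?_
  rw [Real.rpow_sub_one hr.ne']
  field_simp

theorem continuous_mul_rpow (h : IsRadialCutoff χ) (m : ℝ) :
    Continuous fun r => χ r * r ^ m := by
  rw [continuous_iff_continuousAt]
  intro r
  rcases lt_or_ge r 1 with hr | hr
  · have : (fun r => χ r * r ^ m) =ᶠ[𝓝 r] fun _ => 0 := by
      filter_upwards [Iio_mem_nhds hr] with y hy
      rw [h.eq_zero y (le_of_lt hy), zero_mul]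
    exact continuousAt_const.congr this.symm
  · exact (h.hasDerivAt_mul_rpow m (by linarith)).continuousAt

theorem integrableOn_mul_rpow_mul_exp (h : IsRadialCutoff χ) (m : ℝ) {c : ℝ} (hc : 0 < c) :
    IntegrableOn (fun r => |χ r * r ^ m| * Real.exp (-c * r)) (Set.Ioi 0) := by
  obtain ⟨C, hC, hχ⟩ := h.exists_bound
  refine integrable_of_isBigO_exp_neg (b := c / 2) (by positivity) ?_ ?_
  · exact ((h.continuous_mul_rpow m).abs.mul (by fun_prop)).continuousOn
  · have h1 : (fun r : ℝ => χ r * r ^ m) =O[atTop] fun r => r ^ m := by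
      refine Asymptotics.IsBigO.of_bound C (Eventually.of_forall fun r => ?_)
      rw [norm_mul]
      exact mul_le_mul_of_nonneg_right (hχ r) (norm_nonneg _)
    have h2 := h1.trans (isLittleO_rpow_exp_pos_mul_atTop m (half_pos hc)).isBigO
    refine (h2.abs_left.mul (Asymptotics.isBigO_refl (fun r => Real.exp (-c * r)) atTop)).congr_right
      fun r => ?_
    rw [← Real.exp_add]
    ring_nf

theorem integrableOn_mul_rpow (h : IsRadialCutoff χ) {m : ℝ} (hm : m < -1) :
    IntegrableOn (fun r => |χ r * r ^ m|) (Set.Ioi 0) := by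
  obtain ⟨C, hC, hχ⟩ := h.exists_bound
  rw [← Set.Ioc_union_Ioi_eq_Ioi zero_le_one]
  refine IntegrableOn.union ?_ ?_
  · exact (h.continuous_mul_rpow m).abs.integrableOn_Ioc
  · refine ((integrableOn_Ioi_rpow_of_lt hm zero_lt_one).const_mul C).mono'
      (h.continuous_mul_rpow m).abs.aestronglyMeasurable ?_
    refine (ae_restrict_mem measurableSet_Ioi).mono fun r hr => ?_
    have hr0 : (0 : ℝ) ≤ r := zero_le_one.trans (le_of_lt hr)
    rw [Real.norm_eq_abs, abs_abs, abs_mul, abs_of_nonneg (Real.rpow_nonneg hr0 m)]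
    exact mul_le_mul_of_nonneg_right (hχ r) (Real.rpow_nonneg hr0 m)

end IsRadialCutoff

/-- The Fourier–Laplace transform of `χ(r) r ^ m` on the half-line. -/
def radialTransform (χ : ℝ → ℝ) (m : ℝ) (z : ℂ) : ℂ :=
  ∫ r in Set.Ioi (0 : ℝ), ((χ r * r ^ m : ℝ) : ℂ) * Complex.exp (Complex.I * r * z)

theorem norm_mul_exp_I_mul (w r : ℝ) (z : ℂ) :
    ‖(w : ℂ) * Complex.exp (Complex.I * r * z)‖ = |w| * Real.exp (-z.im * r) := by
  rw [norm_mul, Complex.norm_exp, Complex.norm_real, Real.norm_eq_abs]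
  congr 2
  simp
  ring

section radialTransform

variable {χ : ℝ → ℝ}

theorem aestronglyMeasurable_radialTransform_integrand (h : IsRadialCutoff χ) (m : ℝ) (z : ℂ)
    (μ : Measure ℝ) :
    AEStronglyMeasurable
      (fun r : ℝ => ((χ r * r ^ m : ℝ) : ℂ) * Complex.exp (Complex.I * r * z)) μ := by
  have := h.continuous_mul_rpow m
  exact ((Complex.continuous_ofReal.comp this).mul (by fun_prop)).aestronglyMeasurable

theorem integrableOn_radialTransform_integrand (h : IsRadialCutoff χ) (m : ℝ) {z : ℂ}
    (hz : 0 < z.im) :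
    IntegrableOn (fun r : ℝ => ((χ r * r ^ m : ℝ) : ℂ) * Complex.exp (Complex.I * r * z))
      (Set.Ioi 0) := by
  refine (h.integrableOn_mul_rpow_mul_exp m hz).mono'
    (aestronglyMeasurable_radialTransform_integrand h m z _) (Eventually.of_forall fun r => ?_)
  rw [norm_mul_exp_I_mul]

theorem exists_norm_radialTransform_le (h : IsRadialCutoff χ) (m : ℝ) {c : ℝ} (hc : 0 < c) :
    ∃ C, ∀ z : ℂ, c ≤ z.im → ‖radialTransform χ m z‖ ≤ C := by
  refine ⟨_, fun z hz => norm_integral_le_of_norm_le (h.integrableOn_mul_rpow_mul_exp m hc) ?_⟩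
  refine (ae_restrict_mem measurableSet_Ioi).mono fun r (hr : 0 < r) => ?_
  rw [norm_mul_exp_I_mul]
  gcongr

theorem exists_norm_radialTransform_le_of_lt (h : IsRadialCutoff χ) {m : ℝ} (hm : m < -1) :
    ∃ C, 0 ≤ C ∧ ∀ z : ℂ, 0 ≤ z.im → ‖radialTransform χ m z‖ ≤ C := by
  refine ⟨∫ r in Set.Ioi (0 : ℝ), |χ r * r ^ m|, integral_nonneg fun r => abs_nonneg _,
    fun z hz => norm_integral_le_of_norm_le (h.integrableOn_mul_rpow hm) ?_⟩
  refine (ae_restrict_mem measurableSet_Ioi).mono fun r (hr : 0 < r) => ?_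
  rw [norm_mul_exp_I_mul]
  refine mul_le_of_le_one_right (abs_nonneg _) (Real.exp_le_one_iff.2 ?_)
  nlinarith

theorem hasDerivAt_radialTransform (h : IsRadialCutoff χ) (m : ℝ) {z : ℂ} (hz : 0 < z.im) :
    HasDerivAt (radialTransform χ m) (Complex.I * radialTransform χ (m + 1) z) z := by
  have hs : {w : ℂ | z.im / 2 < w.im} ∈ 𝓝 z :=
    (isOpen_lt continuous_const Complex.continuous_im).mem_nhds (by simpa using hz)
  have hrw : ∀ (w : ℂ) (r : ℝ), r ∈ Set.Ioi (0 : ℝ) →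
      ((χ r * r ^ m : ℝ) : ℂ) * (Complex.exp (Complex.I * r * w) * (Complex.I * r)) =
        Complex.I * (((χ r * r ^ (m + 1) : ℝ) : ℂ) * Complex.exp (Complex.I * r * w)) := by
    intro w r hr
    rw [Real.rpow_add_one (ne_of_gt hr)]
    push_cast
    ring
  have key := (hasDerivAt_integral_of_dominated_loc_of_deriv_le
    (μ := volume.restrict (Set.Ioi (0 : ℝ)))
    (F := fun (w : ℂ) (r : ℝ) => ((χ r * r ^ m : ℝ) : ℂ) * Complex.exp (Complex.I * r * w))
    (F' := fun (w : ℂ) (r : ℝ) =>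
      ((χ r * r ^ m : ℝ) : ℂ) * (Complex.exp (Complex.I * r * w) * (Complex.I * r)))
    (bound := fun r => |χ r * r ^ (m + 1)| * Real.exp (-(z.im / 2) * r)) hs
    (Eventually.of_forall fun w => aestronglyMeasurable_radialTransform_integrand h m w _)
    (integrableOn_radialTransform_integrand h m hz) ?_ ?_
    (h.integrableOn_mul_rpow_mul_exp (m + 1) (half_pos hz)) ?_).2
  · refine HasDerivAt.congr_deriv (f := radialTransform χ m) key ?_
    rw [radialTransform, ← integral_const_mul]
    exact setIntegral_congr_fun measurableSet_Ioi (hrw z)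
  · have := h.continuous_mul_rpow m
    exact ((Complex.continuous_ofReal.comp this).mul (by fun_prop)).aestronglyMeasurable
  · refine (ae_restrict_mem measurableSet_Ioi).mono fun r (hr : 0 < r) w (hw : z.im / 2 < w.im) => ?_
    rw [hrw w r hr, norm_mul, Complex.norm_I, one_mul, norm_mul_exp_I_mul]
    gcongr
  · refine Eventually.of_forall fun r w _ => ?_
    refine HasDerivAt.const_mul _ (HasDerivAt.cexp ?_)
    simpa using (hasDerivAt_id w).const_mul (Complex.I * r)

/-- Integration by parts in the radial variable. -/
theorem mul_radialTransform (h : IsRadialCutoff χ) (m : ℝ) {z : ℂ} (hz : 0 < z.im) :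
    z * radialTransform χ m z =
      Complex.I * radialTransform (fun r => r * deriv χ r + m * χ r) (m - 1) z := by
  have hint := integrableOn_radialTransform_integrand h m hz
  have hint' := integrableOn_radialTransform_integrand (h.euler m) (m - 1) hz
  have hderiv : ∀ r ∈ Set.Ioi (0 : ℝ), HasDerivAt
      (fun r : ℝ => ((χ r * r ^ m : ℝ) : ℂ) * Complex.exp (Complex.I * r * z))
      ((((r * deriv χ r + m * χ r) * r ^ (m - 1) : ℝ) : ℂ) * Complex.exp (Complex.I * r * z) +
        Complex.I * z * (((χ r * r ^ m : ℝ) : ℂ) * Complex.exp (Complex.I * r * z))) r := by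
    intro r hr
    have h1 := (h.hasDerivAt_mul_rpow m hr).ofReal_comp
    have h2 : HasDerivAt (fun r : ℝ => Complex.I * r * z) (Complex.I * z) r := by
      simpa using ((hasDerivAt_id r).ofReal_comp.const_mul Complex.I).mul_const z
    refine (h1.mul h2.cexp).congr_deriv ?_
    ring
  have hsum := hint'.add (hint.const_mul (Complex.I * z))
  have hlim := tendsto_zero_of_hasDerivAt_of_integrableOn_Ioi hderiv hsum hint
  have hftc := integral_Ioi_of_hasDerivAt_of_tendsto (Continuous.continuousWithinAt (by
    have := h.continuous_mul_rpow m
    exact (Complex.continuous_ofReal.comp this).mul (by fun_prop))) hderiv hsum hlim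
  have hadd := integral_add hint' (hint.const_mul (Complex.I * z))
  rw [integral_const_mul] at hadd
  rw [hadd] at hftc
  simp only [h.eq_zero 0 zero_le_one, zero_mul, Complex.ofReal_zero, sub_zero] at hftc
  change radialTransform _ _ z + Complex.I * z * radialTransform χ m z = 0 at hftc
  linear_combination (-Complex.I) * hftc + z * radialTransform χ m z * Complex.I_sq

end radialTransform

/-- The radial derivative of the phase `r (k - ξ · e_θ)`. -/
def radialPhase (k : ℝ) (ξ : ℝ × ℝ) (θ : ℝ) : ℝ :=
  k - ξ.1 * Real.cos θ - ξ.2 * Real.sin θ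

/-- The normalized angular derivative of the phase `r (k - ξ · e_θ)`. -/
def angularPhase (ξ : ℝ × ℝ) (θ : ℝ) : ℝ :=
  ξ.1 * Real.sin θ - ξ.2 * Real.cos θ

/-- The complex frequency of the regularized radial integral. -/
def complexPhase (k : ℝ) (ξ : ℝ × ℝ) (σ θ : ℝ) : ℂ :=
  radialPhase k ξ θ + σ * Complex.I

/-- The squared size of the gradient of the regularized phase. -/
def phaseGradSq (k : ℝ) (ξ : ℝ × ℝ) (σ θ : ℝ) : ℝ :=
  radialPhase k ξ θ ^ 2 + σ ^ 2 + angularPhase ξ θ ^ 2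

theorem complexPhase_im (k : ℝ) (ξ : ℝ × ℝ) (σ θ : ℝ) : (complexPhase k ξ σ θ).im = σ := by
  simp [complexPhase]

theorem phaseGradSq_pos (k : ℝ) (ξ : ℝ × ℝ) {σ : ℝ} (hσ : 0 < σ) (θ : ℝ) :
    0 < phaseGradSq k ξ σ θ := by
  unfold phaseGradSq
  positivity

theorem hasDerivAt_radialPhase (k : ℝ) (ξ : ℝ × ℝ) (θ : ℝ) :
    HasDerivAt (radialPhase k ξ) (angularPhase ξ θ) θ := by
  refine ((((Real.hasDerivAt_cos θ).const_mul ξ.1).const_sub k).sub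
    ((Real.hasDerivAt_sin θ).const_mul ξ.2)).congr_deriv ?_
  rw [angularPhase]
  ring

theorem hasDerivAt_angularPhase (k : ℝ) (ξ : ℝ × ℝ) (θ : ℝ) :
    HasDerivAt (angularPhase ξ) (k - radialPhase k ξ θ) θ := by
  refine (((Real.hasDerivAt_sin θ).const_mul ξ.1).sub
    ((Real.hasDerivAt_cos θ).const_mul ξ.2)).congr_deriv ?_
  rw [radialPhase]
  ring

theorem hasDerivAt_phaseGradSq (k : ℝ) (ξ : ℝ × ℝ) (σ θ : ℝ) :
    HasDerivAt (phaseGradSq k ξ σ) (2 * k * angularPhase ξ θ) θ := by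
  refine ((((hasDerivAt_radialPhase k ξ θ).pow 2).add_const (σ ^ 2)).add
    ((hasDerivAt_angularPhase k ξ θ).pow 2)).congr_deriv ?_
  push_cast
  ring

/-- The coefficients of the first-order operator that reproduces the oscillating exponential,
together with the further functions needed to close the list under differentiation. -/
def phaseCoeff (k : ℝ) (i : Fin 4) (ξ : ℝ × ℝ) (σ θ : ℝ) : ℝ :=
  ![radialPhase k ξ θ, σ, angularPhase ξ θ, 1] i / phaseGradSq k ξ σ θ

theorem exists_hasDerivAt_phaseCoeff (k : ℝ) (i : Fin 4) :
    ∃ c : Fin 4 → ℝ, ∀ (ξ : ℝ × ℝ) (σ θ : ℝ), 0 < σ → HasDerivAt (phaseCoeff k i ξ σ)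
      ((∑ j, c j * phaseCoeff k j ξ σ θ) -
        2 * k * (phaseCoeff k 2 ξ σ θ * phaseCoeff k i ξ σ θ)) θ := by
  have key : ∃ c : Fin 4 → ℝ, ∀ (ξ : ℝ × ℝ) (σ θ : ℝ),
      HasDerivAt (fun θ => ![radialPhase k ξ θ, σ, angularPhase ξ θ, 1] i)
        (∑ j, c j * ![radialPhase k ξ θ, σ, angularPhase ξ θ, 1] j) θ := by
    fin_cases i
    · refine ⟨![0, 0, 1, 0], fun ξ σ θ => ?_⟩
      simpa [Fin.sum_univ_four] using hasDerivAt_radialPhase k ξ θ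
    · refine ⟨0, fun ξ σ θ => ?_⟩
      simpa using hasDerivAt_const θ σ
    · refine ⟨![-1, 0, 0, k], fun ξ σ θ => ?_⟩
      simpa [Fin.sum_univ_four, sub_eq_neg_add] using hasDerivAt_angularPhase k ξ θ
    · refine ⟨0, fun ξ σ θ => ?_⟩
      simpa using hasDerivAt_const θ (1 : ℝ)
  obtain ⟨c, hc⟩ := key
  refine ⟨c, fun ξ σ θ hσ => ?_⟩
  have hG := (phaseGradSq_pos k ξ hσ θ).ne'
  refine ((hc ξ σ θ).div (hasDerivAt_phaseGradSq k ξ σ θ) hG).congr_deriv ?_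
  simp only [phaseCoeff, Fin.sum_univ_four]
  simp only [Matrix.cons_val]
  field_simp

/-- The iterated pairing `∫ b(θ) ∫ χ(r) r ^ m exp(i r (k - ξ · e_θ) - σ r) dr dθ`. -/
def conicIntegral (k δ : ℝ) (b : ℝ → ℂ) (χ : ℝ → ℝ) (m : ℝ) (ξ : ℝ × ℝ) (σ : ℝ) : ℂ :=
  ∫ θ in (-δ)..δ, b θ * radialTransform χ m (complexPhase k ξ σ θ)

section conicIntegral

variable {χ : ℝ → ℝ}

theorem hasDerivAt_radialTransform_complexPhase (h : IsRadialCutoff χ) (m k : ℝ) (ξ : ℝ × ℝ)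
    {σ : ℝ} (hσ : 0 < σ) (θ : ℝ) :
    HasDerivAt (fun θ => radialTransform χ m (complexPhase k ξ σ θ))
      (Complex.I * angularPhase ξ θ * radialTransform χ (m + 1) (complexPhase k ξ σ θ)) θ := by
  have h1 : HasDerivAt (complexPhase k ξ σ) (angularPhase ξ θ : ℂ) θ :=
    (hasDerivAt_radialPhase k ξ θ).ofReal_comp.add_const _
  have h2 := hasDerivAt_radialTransform h m (z := complexPhase k ξ σ θ)
    (by rwa [complexPhase_im])
  refine (h2.comp θ h1).congr_deriv ?_
  ring

theorem continuous_radialTransform_complexPhase (h : IsRadialCutoff χ) (m k : ℝ) (ξ : ℝ × ℝ)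
    {σ : ℝ} (hσ : 0 < σ) :
    Continuous fun θ => radialTransform χ m (complexPhase k ξ σ θ) :=
  continuous_iff_continuousAt.2 fun θ =>
    (hasDerivAt_radialTransform_complexPhase h m k ξ hσ θ).continuousAt

/-- Integration by parts along the vector field adapted to the regularized phase. -/
theorem conicIntegral_eq (h : IsRadialCutoff χ) (m k δ : ℝ) (ξ : ℝ × ℝ) {σ : ℝ} (hσ : 0 < σ)
    {b c : ℝ → ℂ} (hb : Continuous b) (hc : Continuous c) (hl : b (-δ) = 0) (hr : b δ = 0)
    (hbc : ∀ θ, HasDerivAt (fun θ => (phaseCoeff k 2 ξ σ θ : ℂ) * b θ) (c θ) θ) :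
    conicIntegral k δ b χ m ξ σ =
      Complex.I * conicIntegral k δ
        (fun θ => (phaseCoeff k 0 ξ σ θ : ℂ) * b θ +
          (-Complex.I) * ((phaseCoeff k 1 ξ σ θ : ℂ) * b θ))
        (fun r => r * deriv χ r + m * χ r) (m - 1) ξ σ +
      Complex.I * conicIntegral k δ c χ (m - 1) ξ σ := by
  have hcoeff : ∀ i, Continuous (fun θ => phaseCoeff k i ξ σ θ) := fun i => by
    obtain ⟨c, hc⟩ := exists_hasDerivAt_phaseCoeff k i
    exact continuous_iff_continuousAt.2 fun θ => (hc ξ σ θ hσ).continuousAt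
  have h0 := hcoeff 0
  have h1 := hcoeff 1
  have h2 := hcoeff 2
  have hF := continuous_radialTransform_complexPhase h m k ξ hσ
  have hF' := continuous_radialTransform_complexPhase h (m - 1) k ξ hσ
  have hFe := continuous_radialTransform_complexPhase (h.euler m) (m - 1) k ξ hσ
  have ht : Continuous (angularPhase ξ) :=
    continuous_iff_continuousAt.2 fun θ => (hasDerivAt_angularPhase k ξ θ).continuousAt
  have hparts := intervalIntegral.integral_mul_deriv_eq_deriv_mul (a := -δ) (b := δ)
    (fun θ _ => hbc θ) (fun θ _ => hasDerivAt_radialTransform_complexPhase h (m - 1) k ξ hσ θ)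
    (hc.intervalIntegrable _ _) (Continuous.intervalIntegrable (by
      rw [sub_add_cancel]
      fun_prop) _ _)
  simp only [hl, hr, sub_add_cancel, mul_zero, zero_mul, sub_zero, zero_sub] at hparts
  have hsplit : ∀ θ, b θ * radialTransform χ m (complexPhase k ξ σ θ) =
      Complex.I * ((((phaseCoeff k 0 ξ σ θ : ℂ) * b θ +
          (-Complex.I) * ((phaseCoeff k 1 ξ σ θ : ℂ) * b θ))) *
          radialTransform (fun r => r * deriv χ r + m * χ r) (m - 1) (complexPhase k ξ σ θ)) +
      (-Complex.I) * ((phaseCoeff k 2 ξ σ θ : ℂ) * b θ * (Complex.I * angularPhase ξ θ *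
          radialTransform χ m (complexPhase k ξ σ θ))) := by
    intro θ
    have hrad := mul_radialTransform h m (z := complexPhase k ξ σ θ) (by rwa [complexPhase_im])
    have hG : (phaseGradSq k ξ σ θ : ℂ) ≠ 0 := by
      exact_mod_cast (phaseGradSq_pos k ξ hσ θ).ne'
    have hone : ((phaseCoeff k 0 ξ σ θ : ℂ) - Complex.I * phaseCoeff k 1 ξ σ θ) *
        complexPhase k ξ σ θ + phaseCoeff k 2 ξ σ θ * angularPhase ξ θ = 1 := by
      simp only [phaseCoeff, Matrix.cons_val]
      push_cast
      field_simp
      rw [complexPhase, phaseGradSq]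
      push_cast
      linear_combination (-(σ : ℂ) ^ 2) * Complex.I_sq
    linear_combination (-(b θ * radialTransform χ m (complexPhase k ξ σ θ))) * hone +
      ((phaseCoeff k 0 ξ σ θ : ℂ) - Complex.I * phaseCoeff k 1 ξ σ θ) * b θ * hrad +
      (phaseCoeff k 2 ξ σ θ : ℂ) * b θ * angularPhase ξ θ *
        radialTransform χ m (complexPhase k ξ σ θ) * Complex.I_sq
  unfold conicIntegral
  simp_rw [hsplit]
  rw [intervalIntegral.integral_add (Continuous.intervalIntegrable (by fun_prop) _ _)
    (Continuous.intervalIntegrable (by fun_prop) _ _), intervalIntegral.integral_const_mul,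
    intervalIntegral.integral_const_mul, hparts]
  ring

theorem exists_norm_radialTransform_complexPhase_le (h : IsRadialCutoff χ) (m k : ℝ) {c : ℝ}
    (hc : 0 < c) :
    ∃ C, ∀ (ξ : ℝ × ℝ) (σ θ : ℝ), c ≤ σ → ‖radialTransform χ m (complexPhase k ξ σ θ)‖ ≤ C := by
  obtain ⟨C, hC⟩ := exists_norm_radialTransform_le h m hc
  exact ⟨C, fun ξ σ θ hσ => hC _ (by rwa [complexPhase_im])⟩

theorem hasDerivAt_conicIntegral (h : IsRadialCutoff χ) (m k δ : ℝ) (ξ : ℝ × ℝ) {σ : ℝ}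
    (hσ : 0 < σ) {b : ℝ → ℂ} (hb : Continuous b) :
    HasDerivAt (conicIntegral k δ b χ m ξ) (-conicIntegral k δ b χ (m + 1) ξ σ) σ := by
  obtain ⟨C, hC⟩ := exists_norm_radialTransform_complexPhase_le h (m + 1) k (half_pos hσ)
  have key := (intervalIntegral.hasDerivAt_integral_of_dominated_loc_of_deriv_le
    (μ := volume) (a := -δ) (b := δ)
    (F := fun σ θ => b θ * radialTransform χ m (complexPhase k ξ σ θ))
    (F' := fun σ θ => -(b θ * radialTransform χ (m + 1) (complexPhase k ξ σ θ)))
    (x₀ := σ) (bound := fun θ => ‖b θ‖ * C) (Ioi_mem_nhds (half_lt_self hσ)) ?_ ?_ ?_ ?_ ?_ ?_).2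
  · rw [intervalIntegral.integral_neg] at key
    exact key
  · filter_upwards [Ioi_mem_nhds hσ] with τ hτ
    exact (hb.mul (continuous_radialTransform_complexPhase h m k ξ hτ)).aestronglyMeasurable
  · exact (hb.mul (continuous_radialTransform_complexPhase h m k ξ hσ)).intervalIntegrable _ _
  · exact (hb.mul
      (continuous_radialTransform_complexPhase h (m + 1) k ξ hσ)).neg.aestronglyMeasurable
  · refine Eventually.of_forall fun θ _ τ hτ => ?_
    rw [norm_neg, norm_mul]
    exact mul_le_mul_of_nonneg_left (hC ξ τ θ (le_of_lt hτ)) (norm_nonneg _)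
  · exact (hb.norm.mul continuous_const).intervalIntegrable _ _
  · refine Eventually.of_forall fun θ _ τ hτ => ?_
    have hτ0 : 0 < τ := (half_pos hσ).trans hτ
    have h1 : HasDerivAt (fun τ => complexPhase k ξ τ θ) Complex.I τ := by
      have h3 := ((hasDerivAt_id τ).ofReal_comp.mul_const Complex.I).const_add
        (radialPhase k ξ θ : ℂ)
      exact HasDerivAt.congr_deriv (f := fun τ => complexPhase k ξ τ θ) h3 (by simp)
    have h2 := hasDerivAt_radialTransform h m (z := complexPhase k ξ τ θ)
      (by rwa [complexPhase_im])
    refine ((h2.comp τ h1).const_mul (b θ)).congr_deriv ?_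
    linear_combination b θ * radialTransform χ (m + 1) (complexPhase k ξ τ θ) * Complex.I_sq

theorem hasFDerivAt_conicIntegral (h : IsRadialCutoff χ) (m k δ : ℝ) (ξ : ℝ × ℝ) {σ : ℝ}
    (hσ : 0 < σ) {b : ℝ → ℂ} (hb : Continuous b) :
    HasFDerivAt (fun ξ => conicIntegral k δ b χ m ξ σ)
      ((ContinuousLinearMap.fst ℝ ℝ ℝ).smulRight
          (conicIntegral k δ (fun θ => -Complex.I * Real.cos θ * b θ) χ (m + 1) ξ σ) +
        (ContinuousLinearMap.snd ℝ ℝ ℝ).smulRight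
          (conicIntegral k δ (fun θ => -Complex.I * Real.sin θ * b θ) χ (m + 1) ξ σ)) ξ := by
  obtain ⟨C, hC⟩ := exists_norm_radialTransform_complexPhase_le h (m + 1) k hσ
  set F' : ℝ × ℝ → ℝ → (ℝ × ℝ →L[ℝ] ℂ) := fun ξ θ =>
    (ContinuousLinearMap.fst ℝ ℝ ℝ).smulRight
        (-Complex.I * Real.cos θ * b θ * radialTransform χ (m + 1) (complexPhase k ξ σ θ)) +
      (ContinuousLinearMap.snd ℝ ℝ ℝ).smulRight
        (-Complex.I * Real.sin θ * b θ * radialTransform χ (m + 1) (complexPhase k ξ σ θ)) with hF'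
  have hF := continuous_radialTransform_complexPhase h (m + 1) k ξ hσ
  have hF'c : Continuous (F' ξ) := by
    have hL : ∀ L : ℝ × ℝ →L[ℝ] ℝ, Continuous fun z : ℂ => L.smulRight z := fun L =>
      (ContinuousLinearMap.smulRightL ℝ (ℝ × ℝ) ℂ L).continuous
    exact ((hL _).comp (by fun_prop)).add ((hL _).comp (by fun_prop))
  have key := intervalIntegral.hasFDerivAt_integral_of_dominated_of_fderiv_le
    (μ := volume) (a := -δ) (b := δ) (𝕜 := ℝ)
    (F := fun ξ θ => b θ * radialTransform χ m (complexPhase k ξ σ θ))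
    (F' := F') (x₀ := ξ) (bound := fun θ => ‖b θ‖ * C + ‖b θ‖ * C) univ_mem ?_ ?_ ?_ ?_ ?_ ?_
  · refine key.congr_fderiv ?_
    ext
    all_goals
      rw [ContinuousLinearMap.comp_apply,
        ContinuousLinearMap.intervalIntegral_apply (hF'c.intervalIntegrable _ _)]
      simp [hF', conicIntegral]
  · exact Eventually.of_forall fun η =>
      (hb.mul (continuous_radialTransform_complexPhase h m k η hσ)).aestronglyMeasurable
  · exact (hb.mul (continuous_radialTransform_complexPhase h m k ξ hσ)).intervalIntegrable _ _
  · exact hF'c.aestronglyMeasurable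
  · refine Eventually.of_forall fun θ _ η _ => ?_
    refine (norm_add_le _ _).trans (add_le_add ?_ ?_)
    · rw [ContinuousLinearMap.norm_smulRight_apply]
      refine (mul_le_of_le_one_left (norm_nonneg _) (ContinuousLinearMap.norm_fst_le ..)).trans ?_
      rw [norm_mul, norm_mul, norm_mul, norm_neg, Complex.norm_I, one_mul, Complex.norm_real]
      exact mul_le_mul (mul_le_of_le_one_left (norm_nonneg _) (Real.abs_cos_le_one θ))
        (hC η σ θ le_rfl) (norm_nonneg _) (norm_nonneg _)
    · rw [ContinuousLinearMap.norm_smulRight_apply]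
      refine (mul_le_of_le_one_left (norm_nonneg _) (ContinuousLinearMap.norm_snd_le ..)).trans ?_
      rw [norm_mul, norm_mul, norm_mul, norm_neg, Complex.norm_I, one_mul, Complex.norm_real]
      exact mul_le_mul (mul_le_of_le_one_left (norm_nonneg _) (Real.abs_sin_le_one θ))
        (hC η σ θ le_rfl) (norm_nonneg _) (norm_nonneg _)
  · exact Continuous.intervalIntegrable (by fun_prop) _ _
  · refine Eventually.of_forall fun θ _ η _ => ?_
    have h1 : HasFDerivAt (fun η => complexPhase k η σ θ)
        (Complex.ofRealCLM.comp (-(Real.cos θ • ContinuousLinearMap.fst ℝ ℝ ℝ) -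
          Real.sin θ • ContinuousLinearMap.snd ℝ ℝ ℝ)) η := by
      have h3 : HasFDerivAt (fun η => radialPhase k η θ)
          (-(Real.cos θ • ContinuousLinearMap.fst ℝ ℝ ℝ) -
            Real.sin θ • ContinuousLinearMap.snd ℝ ℝ ℝ) η :=
        ((hasFDerivAt_fst.mul_const _).const_sub k).sub (hasFDerivAt_snd.mul_const _)
      exact (Complex.ofRealCLM.hasFDerivAt.comp η h3).add_const _
    have h2 := (hasDerivAt_radialTransform h m (z := complexPhase k η σ θ)
      (by rwa [complexPhase_im])).hasFDerivAt.restrictScalars ℝ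
    refine ((h2.comp η h1).const_mul (b θ)).congr_fderiv ?_
    ext
    all_goals
      simp [hF']
      ring

end conicIntegral

/-- The Japanese-bracket-type weight `1 + |ξ|`. -/
def freqWeight (ξ : ℝ × ℝ) : ℝ :=
  1 + Real.sqrt (ξ.1 ^ 2 + ξ.2 ^ 2)

theorem one_le_freqWeight (ξ : ℝ × ℝ) : 1 ≤ freqWeight ξ :=
  le_add_of_nonneg_right (Real.sqrt_nonneg _)

theorem freqWeight_pos (ξ : ℝ × ℝ) : 0 < freqWeight ξ :=
  zero_lt_one.trans_le (one_le_freqWeight ξ)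

/-- Smooth angular densities supported in the aperture `[-δ, δ]`. -/
structure IsAngularDensity (δ : ℝ) (b : ℝ → ℂ) : Prop where
  contDiff : ContDiff ℝ (⊤ : ℕ∞) b
  eq_zero_left : ∀ θ ≤ -δ, b θ = 0
  eq_zero_right : ∀ θ ≥ δ, b θ = 0

namespace IsAngularDensity

variable {δ : ℝ} {b : ℝ → ℂ}

theorem differentiable (h : IsAngularDensity δ b) : Differentiable ℝ b :=
  h.contDiff.differentiable (by simp)

theorem deriv (h : IsAngularDensity δ b) : IsAngularDensity δ (deriv b) where
  contDiff := by simpa using h.contDiff.iterate_deriv 1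
  eq_zero_left _ hθ :=
    deriv_eq_zero_of_eqOn_const (uniqueDiffOn_Iic _) h.differentiable h.eq_zero_left hθ
  eq_zero_right _ hθ :=
    deriv_eq_zero_of_eqOn_const (uniqueDiffOn_Ici _) h.differentiable h.eq_zero_right hθ

theorem mul_left (h : IsAngularDensity δ b) {f : ℝ → ℂ} (hf : ContDiff ℝ (⊤ : ℕ∞) f) :
    IsAngularDensity δ fun θ => f θ * b θ where
  contDiff := hf.mul h.contDiff
  eq_zero_left θ hθ := by rw [h.eq_zero_left θ hθ, mul_zero]
  eq_zero_right θ hθ := by rw [h.eq_zero_right θ hθ, mul_zero]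

end IsAngularDensity

/-- The frequency-dependent angular amplitudes of decay order `n` produced by repeated
integration by parts. -/
inductive IsConicAmplitude (k δ : ℝ) : ℕ → (ℝ × ℝ → ℝ → ℝ → ℂ) → Prop
  | ofDensity {b : ℝ → ℂ} : IsAngularDensity δ b → IsConicAmplitude k δ 0 fun _ _ => b
  | coeff {n : ℕ} {b : ℝ × ℝ → ℝ → ℝ → ℂ} (i : Fin 4) : IsConicAmplitude k δ n b →
      IsConicAmplitude k δ (n + 1) fun ξ σ θ => (phaseCoeff k i ξ σ θ : ℂ) * b ξ σ θ
  | add {n : ℕ} {b c : ℝ × ℝ → ℝ → ℝ → ℂ} : IsConicAmplitude k δ n b → IsConicAmplitude k δ n c →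
      IsConicAmplitude k δ n fun ξ σ θ => b ξ σ θ + c ξ σ θ
  | smul {n : ℕ} {b : ℝ × ℝ → ℝ → ℝ → ℂ} (a : ℂ) : IsConicAmplitude k δ n b →
      IsConicAmplitude k δ n fun ξ σ θ => a * b ξ σ θ
  | weaken {n : ℕ} {b : ℝ × ℝ → ℝ → ℝ → ℂ} : IsConicAmplitude k δ (n + 1) b →
      IsConicAmplitude k δ n b

namespace IsConicAmplitude

variable {k δ : ℝ} {n : ℕ} {b : ℝ × ℝ → ℝ → ℝ → ℂ}

theorem exists_hasDerivAt (h : IsConicAmplitude k δ n b) :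
    ∃ b', IsConicAmplitude k δ n b' ∧
      ∀ ξ σ θ, 0 < σ → HasDerivAt (b ξ σ) (b' ξ σ θ) θ := by
  induction h with
  | ofDensity h =>
    exact ⟨_, .ofDensity h.deriv, fun ξ σ θ _ => (h.differentiable θ).hasDerivAt⟩
  | @coeff n b i h ih =>
    obtain ⟨b', hb', hd⟩ := ih
    obtain ⟨c, hc⟩ := exists_hasDerivAt_phaseCoeff k i
    refine ⟨_, ((((((h.coeff 0).smul (c 0)).add ((h.coeff 1).smul (c 1))).add
      ((h.coeff 2).smul (c 2))).add ((h.coeff 3).smul (c 3))).add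
      (((h.coeff i).coeff 2).smul (-2 * k)).weaken).add (hb'.coeff i), fun ξ σ θ hσ => ?_⟩
    refine ((hc ξ σ θ hσ).ofReal_comp.mul (hd ξ σ θ hσ)).congr_deriv ?_
    rw [Fin.sum_univ_four]
    push_cast
    ring
  | add _ _ ih ih' =>
    obtain ⟨b', hb', hd⟩ := ih
    obtain ⟨c', hc', hd'⟩ := ih'
    exact ⟨_, hb'.add hc', fun ξ σ θ hσ => (hd ξ σ θ hσ).add (hd' ξ σ θ hσ)⟩
  | smul a _ ih =>
    obtain ⟨b', hb', hd⟩ := ih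
    exact ⟨_, hb'.smul a, fun ξ σ θ hσ => (hd ξ σ θ hσ).const_mul a⟩
  | weaken _ ih =>
    obtain ⟨b', hb', hd⟩ := ih
    exact ⟨b', hb'.weaken, hd⟩

theorem continuous (h : IsConicAmplitude k δ n b) (ξ : ℝ × ℝ) {σ : ℝ} (hσ : 0 < σ) :
    Continuous (b ξ σ) := by
  obtain ⟨b', -, hd⟩ := h.exists_hasDerivAt
  exact continuous_iff_continuousAt.2 fun θ => (hd ξ σ θ hσ).continuousAt

theorem eq_zero (h : IsConicAmplitude k δ n b) (ξ : ℝ × ℝ) (σ : ℝ) :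
    b ξ σ (-δ) = 0 ∧ b ξ σ δ = 0 := by
  induction h with
  | ofDensity h => exact ⟨h.eq_zero_left _ le_rfl, h.eq_zero_right _ le_rfl⟩
  | coeff i _ ih => simp [ih.1, ih.2]
  | add _ _ ih ih' => simp [ih.1, ih.2, ih'.1, ih'.2]
  | smul a _ ih => simp [ih.1, ih.2]
  | weaken _ ih => exact ih

end IsConicAmplitude

/-- On `Ω` and within the aperture the gradient of the phase is bounded below by `c (1 + |ξ|)`. -/
def IsNonstationary (k δ c : ℝ) (Ω : Set (ℝ × ℝ)) : Prop :=
  ∀ ξ ∈ Ω, ∀ θ, |θ| ≤ δ →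
    (c * freqWeight ξ) ^ 2 ≤ radialPhase k ξ θ ^ 2 + angularPhase ξ θ ^ 2

namespace IsNonstationary

variable {k δ c : ℝ} {Ω : Set (ℝ × ℝ)}

theorem abs_phaseCoeff_le (hΩ : IsNonstationary k δ c Ω) (hc : 0 < c) {ξ : ℝ × ℝ} (hξ : ξ ∈ Ω)
    {θ : ℝ} (hθ : |θ| ≤ δ) {σ : ℝ} (hσ : 0 < σ) (i : Fin 4) :
    |phaseCoeff k i ξ σ θ| ≤ (1 / c + 1 / c ^ 2) / freqWeight ξ := by
  have hw := freqWeight_pos ξ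
  have hw1 := one_le_freqWeight ξ
  have hG0 := phaseGradSq_pos k ξ hσ θ
  set G := phaseGradSq k ξ σ θ with hG
  have hGs : Real.sqrt G ^ 2 = G := Real.sq_sqrt hG0.le
  have hs0 : 0 < Real.sqrt G := Real.sqrt_pos.2 hG0
  have hcw : c * freqWeight ξ ≤ Real.sqrt G := by
    refine Real.le_sqrt_of_sq_le ((hΩ ξ hξ θ hθ).trans ?_)
    rw [hG, phaseGradSq]
    nlinarith [sq_nonneg σ]
  have h1 : 1 / Real.sqrt G ≤ 1 / (c * freqWeight ξ) :=
    one_div_le_one_div_of_le (by positivity) hcw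
  have hsmall : ∀ x : ℝ, x ^ 2 ≤ G → |x| / G ≤ (1 / c + 1 / c ^ 2) / freqWeight ξ := by
    intro x hx
    have hx' : |x| ≤ Real.sqrt G := Real.abs_le_sqrt hx
    calc |x| / G ≤ Real.sqrt G / G := by gcongr
      _ = 1 / Real.sqrt G := by
        rw [div_eq_div_iff hG0.ne' hs0.ne', ← sq, hGs, one_mul]
      _ ≤ 1 / (c * freqWeight ξ) := h1
      _ = (1 / c + 0) / freqWeight ξ := by field_simp; ring
      _ ≤ _ := by gcongr; positivity
  rw [phaseCoeff, abs_div, abs_of_pos hG0]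
  fin_cases i
  · refine hsmall _ ?_
    change radialPhase k ξ θ ^ 2 ≤ _
    rw [hG, phaseGradSq]
    nlinarith [sq_nonneg σ, sq_nonneg (angularPhase ξ θ)]
  · refine hsmall _ ?_
    change σ ^ 2 ≤ _
    rw [hG, phaseGradSq]
    nlinarith [sq_nonneg (radialPhase k ξ θ), sq_nonneg (angularPhase ξ θ)]
  · refine hsmall _ ?_
    change angularPhase ξ θ ^ 2 ≤ _
    rw [hG, phaseGradSq]
    nlinarith [sq_nonneg σ, sq_nonneg (radialPhase k ξ θ)]
  · change |(1 : ℝ)| / G ≤ _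
    rw [abs_one]
    calc 1 / G = (1 / Real.sqrt G) ^ 2 := by rw [div_pow, hGs, one_pow]
      _ ≤ (1 / (c * freqWeight ξ)) ^ 2 := by gcongr
      _ = (0 + 1 / c ^ 2) / freqWeight ξ * (1 / freqWeight ξ) := by field_simp; ring
      _ ≤ (0 + 1 / c ^ 2) / freqWeight ξ :=
        mul_le_of_le_one_right (by positivity) ((div_le_one hw).2 hw1)
      _ ≤ _ := by gcongr; positivity

theorem exists_norm_amplitude_le (hΩ : IsNonstationary k δ c Ω) (hc : 0 < c) {n : ℕ}
    {b : ℝ × ℝ → ℝ → ℝ → ℂ} (h : IsConicAmplitude k δ n b) :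
    ∃ C, 0 ≤ C ∧ ∀ ξ ∈ Ω, ∀ σ > 0, ∀ θ, |θ| ≤ δ → ‖b ξ σ θ‖ ≤ C / freqWeight ξ ^ n := by
  induction h with
  | ofDensity h =>
    obtain ⟨C, hC⟩ := isCompact_Icc.exists_bound_of_continuousOn (s := Set.Icc (-δ) δ)
      h.contDiff.continuous.continuousOn
    refine ⟨max C 0, le_max_right _ _, fun ξ _ σ _ θ hθ => ?_⟩
    rw [pow_zero, div_one]
    exact le_max_of_le_left (hC θ (abs_le.1 hθ))
  | coeff i _ ih =>
    obtain ⟨C, hC0, hC⟩ := ih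
    refine ⟨(1 / c + 1 / c ^ 2) * C, by positivity, fun ξ hξ σ hσ θ hθ => ?_⟩
    rw [norm_mul, Complex.norm_real, pow_succ' (freqWeight ξ), mul_div_mul_comm]
    have hw := freqWeight_pos ξ
    exact mul_le_mul (hΩ.abs_phaseCoeff_le hc hξ hθ hσ i) (hC ξ hξ σ hσ θ hθ) (norm_nonneg _)
      (by positivity)
  | add _ _ ih ih' =>
    obtain ⟨C, hC0, hC⟩ := ih
    obtain ⟨C', hC0', hC'⟩ := ih'
    refine ⟨C + C', by positivity, fun ξ hξ σ hσ θ hθ => ?_⟩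
    rw [add_div]
    exact (norm_add_le _ _).trans (add_le_add (hC ξ hξ σ hσ θ hθ) (hC' ξ hξ σ hσ θ hθ))
  | smul a _ ih =>
    obtain ⟨C, hC0, hC⟩ := ih
    refine ⟨‖a‖ * C, by positivity, fun ξ hξ σ hσ θ hθ => ?_⟩
    rw [norm_mul, mul_div_assoc]
    exact mul_le_mul_of_nonneg_left (hC ξ hξ σ hσ θ hθ) (norm_nonneg _)
  | weaken _ ih =>
    obtain ⟨C, hC0, hC⟩ := ih
    refine ⟨C, hC0, fun ξ hξ σ hσ θ hθ => (hC ξ hξ σ hσ θ hθ).trans ?_⟩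
    have hw := freqWeight_pos ξ
    exact div_le_div_of_nonneg_left hC0 (by positivity)
      (pow_le_pow_right₀ (one_le_freqWeight ξ) (Nat.le_succ _))

theorem exists_norm_conicIntegral_amplitude_le (hΩ : IsNonstationary k δ c Ω) (hc : 0 < c)
    (hδ : 0 < δ) (M : ℕ) : ∀ {n : ℕ} {b : ℝ × ℝ → ℝ → ℝ → ℂ} {χ : ℝ → ℝ} {m : ℝ},
    IsConicAmplitude k δ n b → IsRadialCutoff χ → m + 1 < M →
    ∃ C, ∀ ξ ∈ Ω, ∀ σ > 0, ‖conicIntegral k δ (b ξ σ) χ m ξ σ‖ ≤ C / freqWeight ξ ^ (n + M) := by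
  induction M with
  | zero =>
    intro n b χ m hb hχ hm
    obtain ⟨C, hC0, hC⟩ := hΩ.exists_norm_amplitude_le hc hb
    obtain ⟨K, hK0, hK⟩ := exists_norm_radialTransform_le_of_lt hχ
      (show m < -1 by push_cast at hm; linarith)
    refine ⟨C * K * |δ - -δ|, fun ξ hξ σ hσ => ?_⟩
    have hw := freqWeight_pos ξ
    have := intervalIntegral.norm_integral_le_of_norm_le_const (a := -δ) (b := δ)
      (f := fun θ => b ξ σ θ * radialTransform χ m (complexPhase k ξ σ θ))
      (C := C / freqWeight ξ ^ n * K) (fun θ hθ => ?_)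
    · refine this.trans (le_of_eq ?_)
      rw [add_zero]
      ring
    · rw [Set.uIoc_of_le (by linarith)] at hθ
      rw [norm_mul]
      exact mul_le_mul (hC ξ hξ σ hσ θ (abs_le.2 ⟨hθ.1.le, hθ.2⟩))
        (hK _ (by rw [complexPhase_im]; exact hσ.le)) (norm_nonneg _) (by positivity)
  | succ M ih =>
    intro n b χ m hb hχ hm
    have hm' : m - 1 + 1 < M := by
      push_cast at hm
      linarith
    obtain ⟨b', hb', hd⟩ := (hb.coeff 2).exists_hasDerivAt
    obtain ⟨C, hC⟩ := ih ((hb.coeff 0).add ((hb.coeff 1).smul (-Complex.I))) (hχ.euler m) hm'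
    obtain ⟨C', hC'⟩ := ih hb' hχ hm'
    refine ⟨C + C', fun ξ hξ σ hσ => ?_⟩
    obtain ⟨hl, hr⟩ := hb.eq_zero ξ σ
    rw [conicIntegral_eq hχ m k δ ξ hσ (hb.continuous ξ hσ) (hb'.continuous ξ hσ) hl hr
      fun θ => hd ξ σ θ hσ, add_div, ← add_assoc n, add_right_comm n]
    refine (norm_add_le _ _).trans ?_
    rw [norm_mul, norm_mul, Complex.norm_I, one_mul, one_mul]
    exact add_le_add (hC ξ hξ σ hσ) (hC' ξ hξ σ hσ)

/-- Uniformly in the regularization, conic integrals decay rapidly on nonstationary sets. -/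
theorem exists_norm_conicIntegral_le (hΩ : IsNonstationary k δ c Ω) (hc : 0 < c) (hδ : 0 < δ)
    {b : ℝ → ℂ} {χ : ℝ → ℝ} (hb : IsAngularDensity δ b) (hχ : IsRadialCutoff χ) (m : ℝ) (N : ℕ) :
    ∃ C, 0 ≤ C ∧ ∀ ξ ∈ Ω, ∀ σ > 0, ‖conicIntegral k δ b χ m ξ σ‖ ≤ C / freqWeight ξ ^ N := by
  obtain ⟨M, hM⟩ := exists_nat_gt (m + 1)
  obtain ⟨C, hC⟩ := hΩ.exists_norm_conicIntegral_amplitude_le hc hδ (N + M)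
    (.ofDensity hb) hχ (m := m) (by push_cast; linarith [(Nat.cast_nonneg N : (0 : ℝ) ≤ N)])
  refine ⟨|C|, abs_nonneg C, fun ξ hξ σ hσ => (hC ξ hξ σ hσ).trans ?_⟩
  have hw := freqWeight_pos ξ
  refine (div_le_div_of_nonneg_right (le_abs_self C) (by positivity)).trans ?_
  exact div_le_div_of_nonneg_left (abs_nonneg C) (by positivity)
    (pow_le_pow_right₀ (one_le_freqWeight ξ) (by omega))

/-- Regularized conic integrals converge uniformly on nonstationary sets. -/
theorem exists_limit_conicIntegral (hΩ : IsNonstationary k δ c Ω) (hc : 0 < c) (hδ : 0 < δ)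
    {b : ℝ → ℂ} {χ : ℝ → ℝ} (hb : IsAngularDensity δ b) (hχ : IsRadialCutoff χ) (m : ℝ) :
    ∃ f : ℝ × ℝ → ℂ,
      (∀ ξ ∈ Ω, Tendsto (conicIntegral k δ b χ m ξ) (𝓝[>] 0) (𝓝 (f ξ))) ∧
      TendstoUniformlyOn (fun σ ξ => conicIntegral k δ b χ m ξ σ) f (𝓝[>] 0) Ω := by
  obtain ⟨C, hC0, hC⟩ := hΩ.exists_norm_conicIntegral_le hc hδ hb hχ (m + 1) 0
  have hlip : ∀ ξ ∈ Ω, ∀ σ > 0, ∀ τ > 0,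
      ‖conicIntegral k δ b χ m ξ σ - conicIntegral k δ b χ m ξ τ‖ ≤ C * |σ - τ| := by
    intro ξ hξ σ hσ τ hτ
    refine (convex_Ioi (0 : ℝ)).norm_image_sub_le_of_norm_hasDerivWithin_le
      (f' := fun σ => -conicIntegral k δ b χ (m + 1) ξ σ) (fun s hs => ?_) (fun s hs => ?_) hτ hσ
    · exact (hasDerivAt_conicIntegral hχ m k δ ξ hs hb.contDiff.continuous).hasDerivWithinAt
    · simpa using hC ξ hξ s hs
  have hcauchy : ∀ ξ ∈ Ω, ∃ z, Tendsto (conicIntegral k δ b χ m ξ) (𝓝[>] 0) (𝓝 z) := by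
    intro ξ hξ
    rw [← cauchy_map_iff_exists_tendsto, Metric.cauchy_iff]
    refine ⟨inferInstance, fun ε hε => ?_⟩
    refine ⟨_, image_mem_map (Ioo_mem_nhdsGT (show 0 < ε / (C + 1) by positivity)), ?_⟩
    rintro _ ⟨σ, hσ, rfl⟩ _ ⟨τ, hτ, rfl⟩
    rw [dist_eq_norm]
    have h1 : |σ - τ| < ε / (C + 1) := abs_sub_lt_iff.2 ⟨by linarith [hσ.2, hτ.1],
      by linarith [hσ.1, hτ.2]⟩
    calc _ ≤ C * |σ - τ| := hlip ξ hξ σ hσ.1 τ hτ.1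
      _ ≤ (C + 1) * |σ - τ| := by gcongr; linarith
      _ < (C + 1) * (ε / (C + 1)) := by gcongr
      _ = ε := by field_simp
  choose! f hf using hcauchy
  refine ⟨f, hf, ?_⟩
  have hle : ∀ ξ ∈ Ω, ∀ σ > 0, ‖conicIntegral k δ b χ m ξ σ - f ξ‖ ≤ C * σ := by
    intro ξ hξ σ hσ
    have h1 := ((hf ξ hξ).const_sub (conicIntegral k δ b χ m ξ σ)).norm
    have h2 : Tendsto (fun τ : ℝ => C * |σ - τ|) (𝓝[>] 0) (𝓝 (C * σ)) := by
      have : Tendsto (fun τ : ℝ => C * |σ - τ|) (𝓝 0) (𝓝 (C * |σ - 0|)) :=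
        Continuous.tendsto (by fun_prop) 0
      rw [sub_zero, abs_of_pos hσ] at this
      exact this.mono_left nhdsWithin_le_nhds
    refine le_of_tendsto_of_tendsto h1 h2 ?_
    filter_upwards [self_mem_nhdsWithin] with τ hτ using hlip ξ hξ σ hσ τ hτ
  rw [Metric.tendstoUniformlyOn_iff]
  intro ε hε
  filter_upwards [Ioo_mem_nhdsGT (show 0 < ε / (C + 1) by positivity)] with σ hσ ξ hξ
  rw [dist_comm, dist_eq_norm]
  calc _ ≤ C * σ := hle ξ hξ σ hσ.1
    _ ≤ (C + 1) * σ := mul_le_mul_of_nonneg_right (by linarith) hσ.1.le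
    _ < (C + 1) * (ε / (C + 1)) := by gcongr; exact hσ.2
    _ = ε := by field_simp

end IsNonstationary


/-- The continuous linear map on `ℝ × ℝ` with the given partial derivatives. -/
def planeDifferential (u v : ℂ) : ℝ × ℝ →L[ℝ] ℂ :=
  (ContinuousLinearMap.fst ℝ ℝ ℝ).smulRight u + (ContinuousLinearMap.snd ℝ ℝ ℝ).smulRight v

section DerivativeClosed

variable {P : (ℝ × ℝ → ℂ) → Prop} {Ω : Set (ℝ × ℝ)}

/-- A class of functions closed under partial derivatives consists of smooth functions. -/
theorem contDiffOn_infty_of_derivativeClosed (hΩ : IsOpen Ω)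
    (hP : ∀ f, P f → ∃ f₁ f₂, P f₁ ∧ P f₂ ∧
      ∀ ξ ∈ Ω, HasFDerivAt f (planeDifferential (f₁ ξ) (f₂ ξ)) ξ) {f : ℝ × ℝ → ℂ} (hf : P f) :
    ContDiffOn ℝ (⊤ : ℕ∞) f Ω := by
  refine contDiffOn_infty.2 fun n => ?_
  induction n generalizing f with
  | zero =>
    obtain ⟨f₁, f₂, -, -, h⟩ := hP f hf
    exact contDiffOn_zero.2 fun ξ hξ => (h ξ hξ).continuousAt.continuousWithinAt
  | succ n ih =>
    obtain ⟨f₁, f₂, h₁, h₂, h⟩ := hP f hf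
    push_cast
    rw [contDiffOn_succ_iff_hasFDerivWithinAt_of_uniqueDiffOn hΩ.uniqueDiffOn]
    refine ⟨by simp, _, ?_, fun ξ hξ => (h ξ hξ).hasFDerivWithinAt⟩
    exact (contDiffOn_const.smulRight (ih h₁)).add (contDiffOn_const.smulRight (ih h₂))

/-- A pointwise bound valid on a class of functions closed under partial derivatives passes
to all iterated derivatives. -/
theorem exists_norm_iteratedFDeriv_le_of_derivativeClosed (hΩ : IsOpen Ω)
    (hP : ∀ f, P f → ∃ f₁ f₂, P f₁ ∧ P f₂ ∧
      ∀ ξ ∈ Ω, HasFDerivAt f (planeDifferential (f₁ ξ) (f₂ ξ)) ξ)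
    {w : ℝ × ℝ → ℝ} (hw : ∀ f, P f → ∃ C, ∀ ξ ∈ Ω, ‖f ξ‖ ≤ C / w ξ) (i : ℕ)
    {f : ℝ × ℝ → ℂ} (hf : P f) :
    ∃ C, ∀ ξ ∈ Ω, ‖iteratedFDeriv ℝ i f ξ‖ ≤ C / w ξ := by
  induction i generalizing f with
  | zero => simpa only [norm_iteratedFDeriv_zero] using hw f hf
  | succ i ih =>
    obtain ⟨f₁, f₂, h₁, h₂, h⟩ := hP f hf
    obtain ⟨C₁, hC₁⟩ := ih h₁
    obtain ⟨C₂, hC₂⟩ := ih h₂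
    set L₁ := ContinuousLinearMap.smulRightL ℝ (ℝ × ℝ) ℂ (ContinuousLinearMap.fst ℝ ℝ ℝ)
    set L₂ := ContinuousLinearMap.smulRightL ℝ (ℝ × ℝ) ℂ (ContinuousLinearMap.snd ℝ ℝ ℝ)
    refine ⟨‖L₁‖ * C₁ + ‖L₂‖ * C₂, fun ξ hξ => ?_⟩
    have hsmooth : ∀ {g}, P g → ContDiffAt ℝ i g ξ := fun hg =>
      ((contDiffOn_infty_of_derivativeClosed hΩ hP hg).contDiffAt
        (hΩ.mem_nhds hξ)).of_le (by exact_mod_cast le_top)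
    have heq : fderiv ℝ f =ᶠ[𝓝 ξ] (L₁ ∘ f₁) + (L₂ ∘ f₂) := by
      filter_upwards [hΩ.mem_nhds hξ] with η hη using (h η hη).fderiv
    rw [← norm_iteratedFDeriv_fderiv, heq.iteratedFDeriv ℝ i |>.eq_of_nhds,
      iteratedFDeriv_add_apply (L₁.contDiff.contDiffAt.comp ξ (hsmooth h₁))
        (L₂.contDiff.contDiffAt.comp ξ (hsmooth h₂))]
    refine (norm_add_le _ _).trans ?_
    rw [add_div, mul_div_assoc, mul_div_assoc]
    exact add_le_add
      ((L₁.norm_iteratedFDeriv_comp_left (hsmooth h₁) le_rfl).trans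
        (mul_le_mul_of_nonneg_left (hC₁ ξ hξ) (norm_nonneg _)))
      ((L₂.norm_iteratedFDeriv_comp_left (hsmooth h₂) le_rfl).trans
        (mul_le_mul_of_nonneg_left (hC₂ ξ hξ) (norm_nonneg _)))

end DerivativeClosed

/-- Limits, as the regularization is removed, of conic integrals over `Ω`. -/
def IsConicLimit (k δ : ℝ) (Ω : Set (ℝ × ℝ)) (f : ℝ × ℝ → ℂ) : Prop :=
  ∃ b χ m, IsAngularDensity δ b ∧ IsRadialCutoff χ ∧
    ∀ ξ ∈ Ω, Tendsto (conicIntegral k δ b χ m ξ) (𝓝[>] 0) (𝓝 (f ξ))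

namespace IsConicLimit

variable {k δ c : ℝ} {Ω : Set (ℝ × ℝ)} {f : ℝ × ℝ → ℂ}

theorem exists_norm_le (hΩ : IsNonstationary k δ c Ω) (hc : 0 < c) (hδ : 0 < δ)
    (hf : IsConicLimit k δ Ω f) (N : ℕ) : ∃ C, ∀ ξ ∈ Ω, ‖f ξ‖ ≤ C / freqWeight ξ ^ N := by
  obtain ⟨b, χ, m, hb, hχ, hlim⟩ := hf
  obtain ⟨C, -, hC⟩ := hΩ.exists_norm_conicIntegral_le hc hδ hb hχ m N
  refine ⟨C, fun ξ hξ => le_of_tendsto (hlim ξ hξ).norm ?_⟩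
  filter_upwards [self_mem_nhdsWithin] with σ hσ using hC ξ hξ σ hσ

theorem exists_hasFDerivAt (hopen : IsOpen Ω) (hΩ : IsNonstationary k δ c Ω) (hc : 0 < c)
    (hδ : 0 < δ) (hf : IsConicLimit k δ Ω f) :
    ∃ f₁ f₂, IsConicLimit k δ Ω f₁ ∧ IsConicLimit k δ Ω f₂ ∧
      ∀ ξ ∈ Ω, HasFDerivAt f (planeDifferential (f₁ ξ) (f₂ ξ)) ξ := by
  obtain ⟨b, χ, m, hb, hχ, hlim⟩ := hf
  have hb₁ : IsAngularDensity δ fun θ => -Complex.I * Real.cos θ * b θ :=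
    hb.mul_left (contDiff_const.mul (Complex.ofRealCLM.contDiff.comp Real.contDiff_cos))
  have hb₂ : IsAngularDensity δ fun θ => -Complex.I * Real.sin θ * b θ :=
    hb.mul_left (contDiff_const.mul (Complex.ofRealCLM.contDiff.comp Real.contDiff_sin))
  obtain ⟨f₁, hf₁, hu₁⟩ := hΩ.exists_limit_conicIntegral hc hδ hb₁ hχ (m + 1)
  obtain ⟨f₂, hf₂, hu₂⟩ := hΩ.exists_limit_conicIntegral hc hδ hb₂ hχ (m + 1)
  refine ⟨f₁, f₂, ⟨_, _, _, hb₁, hχ, hf₁⟩, ⟨_, _, _, hb₂, hχ, hf₂⟩, fun ξ hξ => ?_⟩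
  have hu := ((ContinuousLinearMap.smulRightL ℝ (ℝ × ℝ) ℂ
      (ContinuousLinearMap.fst ℝ ℝ ℝ)).uniformContinuous.comp_tendstoUniformlyOn hu₁).add
    ((ContinuousLinearMap.smulRightL ℝ (ℝ × ℝ) ℂ
      (ContinuousLinearMap.snd ℝ ℝ ℝ)).uniformContinuous.comp_tendstoUniformlyOn hu₂)
  rw [tendstoUniformlyOn_iff_tendstoUniformlyOnFilter] at hu
  refine hasFDerivAt_of_tendstoUniformlyOnFilter
    (hu.mono_right (le_principal_iff.2 (hopen.mem_nhds hξ))) ?_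
    ((hopen.mem_nhds hξ |> eventually_of_mem) hlim)
  have : ∀ᶠ σ : ℝ in 𝓝[>] 0, 0 < σ := self_mem_nhdsWithin
  filter_upwards [this.prod_inl (𝓝 ξ)] with p hp
  exact hasFDerivAt_conicIntegral hχ m k δ p.2 hp hb.contDiff.continuous

end IsConicLimit

/-- The modulus of the phase gradient is the distance from `ξ` to the point of angle `θ` on
the circle of radius `k`. -/
theorem radialPhase_sq_add_angularPhase_sq (k : ℝ) (ξ : ℝ × ℝ) (θ : ℝ) :
    radialPhase k ξ θ ^ 2 + angularPhase ξ θ ^ 2 =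
      ‖(ξ.1 + ξ.2 * Complex.I : ℂ) - k * Complex.exp (Complex.I * θ)‖ ^ 2 := by
  rw [mul_comm Complex.I, Complex.exp_mul_I, ← Complex.normSq_eq_norm_sq, Complex.normSq_apply]
  simp only [radialPhase, angularPhase, ← Complex.ofReal_cos, ← Complex.ofReal_sin,
    Complex.sub_re, Complex.sub_im, Complex.add_re, Complex.add_im, Complex.mul_re,
    Complex.mul_im, Complex.ofReal_re, Complex.ofReal_im, Complex.I_re, Complex.I_im]
  have := Real.sin_sq_add_cos_sq θ
  linear_combination (ξ.1 ^ 2 + ξ.2 ^ 2 - k ^ 2) * this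

/-- For small apertures the conic phase is nonstationary away from the frequency `(k, 0)`. -/
theorem isNonstationary_of_aperture_le {k δ ν : ℝ} (hk : 0 < k) (hν : 0 < ν)
    (hδ : δ ≤ ν / (4 * k)) :
    IsNonstationary k δ (1 / ((1 + k) * (4 / ν) + 1))
      {ξ | ν / 2 < Real.sqrt ((ξ.1 - k) ^ 2 + ξ.2 ^ 2)} := by
  intro ξ hξ θ hθ
  rw [Set.mem_ofPred_eq] at hξ
  rw [radialPhase_sq_add_angularPhase_sq]
  set ζ : ℂ := ξ.1 + ξ.2 * Complex.I with hζ
  set q : ℂ := k * Complex.exp (Complex.I * θ) with hq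
  have hq_norm : ‖q‖ = k := by
    rw [hq, norm_mul, mul_comm Complex.I, Complex.norm_exp_ofReal_mul_I, Complex.norm_real,
      Real.norm_of_nonneg hk.le, mul_one]
  have hζ_norm : ‖ζ‖ = Real.sqrt (ξ.1 ^ 2 + ξ.2 ^ 2) := Complex.norm_add_mul_I _ _
  have hζk : ‖ζ - k‖ = Real.sqrt ((ξ.1 - k) ^ 2 + ξ.2 ^ 2) := by
    rw [← Complex.norm_add_mul_I]
    congr 1
    rw [hζ]; push_cast; ring
  have hqk : ‖q - k‖ ≤ ν / 4 := by
    have h1 : q - k = k * (Complex.exp (Complex.I * θ) - 1) := by rw [hq]; ring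
    rw [h1, norm_mul, Complex.norm_real, Real.norm_of_nonneg hk.le]
    calc _ ≤ k * |θ| := mul_le_mul_of_nonneg_left Real.norm_exp_I_mul_ofReal_sub_one_le hk.le
      _ ≤ k * (ν / (4 * k)) := mul_le_mul_of_nonneg_left (hθ.trans hδ) hk.le
      _ = ν / 4 := by field_simp
  have h2 : ν / 4 ≤ ‖ζ - q‖ := by
    have := norm_sub_le_norm_sub_add_norm_sub ζ q (k : ℂ)
    linarith [hζk ▸ hξ]
  have h3 : ‖ζ‖ ≤ ‖ζ - q‖ + k := by
    have := norm_add_le (ζ - q) q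
    rwa [sub_add_cancel, hq_norm] at this
  have hw := freqWeight_pos ξ
  refine pow_le_pow_left₀ (by positivity) ?_ 2
  rw [one_div, inv_mul_le_iff₀ (by positivity), freqWeight, ← hζ_norm]
  have h4 : 1 + k ≤ (1 + k) * (4 / ν) * ‖ζ - q‖ := by
    calc 1 + k = (1 + k) * (4 / ν) * (ν / 4) := by field_simp
      _ ≤ _ := by gcongr
  linarith

/-- The closed exterior of a disc in the plane is a set of unique differentiability. -/
theorem uniqueDiffOn_disc_exterior {k ν : ℝ} (hν : 0 < ν) :
    UniqueDiffOn ℝ {ξ : ℝ × ℝ | ν ≤ Real.sqrt ((ξ.1 - k) ^ 2 + ξ.2 ^ 2)} := by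
  intro x hx
  rw [Set.mem_ofPred_eq, Real.le_sqrt' hν] at hx
  set ℓ : ℝ × ℝ →L[ℝ] ℝ := (x.1 - k) • ContinuousLinearMap.fst ℝ ℝ ℝ +
    x.2 • ContinuousLinearMap.snd ℝ ℝ ℝ with hℓ
  have hℓ_apply : ∀ η, ℓ η = (x.1 - k) * η.1 + x.2 * η.2 := fun η => by simp [hℓ]
  have hhalf : UniqueDiffWithinAt ℝ {η | ℓ x ≤ ℓ η} x := by
    refine uniqueDiffWithinAt_convex (convex_halfSpace_ge ℓ.toLinearMap.isLinear _) ?_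
      (subset_closure (le_refl (ℓ x)))
    refine ⟨x + (x.1 - k, x.2), interior_maximal (s := {η | ℓ x ≤ ℓ η})
      (t := {η | ℓ x < ℓ η}) (fun η hη => by
        rw [Set.mem_ofPred_eq] at hη ⊢
        exact hη.le)
      (isOpen_lt continuous_const ℓ.continuous) ?_⟩
    have : ℓ (x.1 - k, x.2) = (x.1 - k) ^ 2 + x.2 ^ 2 := by rw [hℓ_apply]; ring
    rw [Set.mem_ofPred_eq, map_add, this]
    nlinarith
  refine hhalf.mono fun η hη => ?_
  rw [Set.mem_ofPred_eq, Real.le_sqrt' hν]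
  rw [Set.mem_ofPred_eq, hℓ_apply, hℓ_apply] at hη
  nlinarith [sq_nonneg (η.1 - x.1), sq_nonneg (η.2 - x.2)]

/-- The regularized conic Fourier transform as a conic integral in Cartesian coordinates. -/
theorem conicRegFT_eq_conicIntegral (k δ : ℝ) (a : ℝ → ℂ) (φδ ψ : ℝ → ℝ) (σ ρ φ : ℝ) :
    conicRegFT k δ a φδ ψ σ ρ φ =
      conicIntegral k δ (fun θ => a θ * φδ θ) ψ (1 / 2)
        (ρ * Real.cos φ, ρ * Real.sin φ) σ := by
  unfold conicRegFT conicIntegral radialTransform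
  congr 1
  ext θ
  rw [← integral_const_mul]
  congr 1
  ext r
  have hphase : Complex.I * r * complexPhase k (ρ * Real.cos φ, ρ * Real.sin φ) σ θ =
      Complex.I * r * (k - ρ * Real.cos (θ - φ)) - σ * r := by
    rw [complexPhase, radialPhase, Real.cos_sub]
    push_cast
    linear_combination r * σ * Complex.I_sq
  rw [hphase, Real.sqrt_eq_rpow]
  push_cast
  ring

/-- **The conic Fourier transform of the leading outgoing term is smooth and rapidly
decreasing away from the single frequency point `(k, 0)`.**
For every `ν > 0` there is `δ₀ ∈ (0, π/4)` such that for every aperture `δ ∈ (0, δ₀]` and any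
admissible cutoffs `φ_δ`, `ψ₊`: the limit `v̂(ξ) = lim_{σ→0⁺} v̂_σ(ρ, φ)` exists for every
`ξ = ρ(cos φ, sin φ)` with `|ξ − (k,0)| ≥ ν`; `v̂` is `C^∞` on `{|ξ − (k,0)| > ν}`; and each
derivative of `v̂` is `O((1 + |ξ|)^{−N})` for every `N` on `{|ξ − (k,0)| ≥ ν}`. -/
theorem conic_fourier_transform_smooth_rapidly_decreasing
    (k : ℝ) (hk : 0 < k)
    (a : ℝ → ℂ) (ha : ContDiff ℝ (⊤ : ℕ∞) a) (haper : ∀ θ : ℝ, a (θ + 2 * Real.pi) = a θ) :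
    ∀ ν : ℝ, 0 < ν → ∃ δ₀ : ℝ, 0 < δ₀ ∧ δ₀ < Real.pi / 4 ∧
      ∀ δ : ℝ, 0 < δ → δ ≤ δ₀ →
      ∀ φδ : ℝ → ℝ, ContDiff ℝ (⊤ : ℕ∞) φδ → HasCompactSupport φδ →
        Function.support φδ ⊆ Set.Ioo (-δ) δ →
        (∀ t ∈ Set.Ioo (-(δ / 2)) (δ / 2), φδ t = 1) →
      ∀ ψ : ℝ → ℝ, ContDiff ℝ (⊤ : ℕ∞) ψ →
        (∀ r : ℝ, r ≤ 1 → ψ r = 0) → (∀ r : ℝ, 2 ≤ r → ψ r = 1) →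
      ∃ vh : ℝ × ℝ → ℂ,
        (∀ ρ φ : ℝ, 0 ≤ ρ →
          ν ≤ Real.sqrt ((ρ * Real.cos φ - k) ^ 2 + (ρ * Real.sin φ) ^ 2) →
          Tendsto (fun σ : ℝ => conicRegFT k δ a φδ ψ σ ρ φ) (𝓝[>] 0)
            (𝓝 (vh (ρ * Real.cos φ, ρ * Real.sin φ)))) ∧
        ContDiffOn ℝ (⊤ : ℕ∞) vh {ξ : ℝ × ℝ | ν < Real.sqrt ((ξ.1 - k) ^ 2 + ξ.2 ^ 2)} ∧
        (∀ i N : ℕ, ∃ C : ℝ, ∀ ξ : ℝ × ℝ,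
          ν ≤ Real.sqrt ((ξ.1 - k) ^ 2 + ξ.2 ^ 2) →
          ‖iteratedFDerivWithin ℝ i vh
              {η : ℝ × ℝ | ν ≤ Real.sqrt ((η.1 - k) ^ 2 + η.2 ^ 2)} ξ‖ ≤
            C / (1 + Real.sqrt (ξ.1 ^ 2 + ξ.2 ^ 2)) ^ N) := by
  intro ν hν
  refine ⟨min (Real.pi / 8) (ν / (4 * k)), lt_min (by positivity) (by positivity),
    (min_le_left _ _).trans_lt (by linarith [Real.pi_pos]), ?_⟩
  intro δ hδ hδ₀ φδ hφ _ hφsupp _ ψ hψ hψ0 hψ1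
  set Ω : Set (ℝ × ℝ) := {ξ | ν / 2 < Real.sqrt ((ξ.1 - k) ^ 2 + ξ.2 ^ 2)} with hΩdef
  have hopen : IsOpen Ω := isOpen_lt continuous_const (by fun_prop)
  have hΩ := isNonstationary_of_aperture_le hk hν (hδ₀.trans (min_le_right _ _))
  have hc : 0 < 1 / ((1 + k) * (4 / ν) + 1) := by positivity
  have hφ0 : ∀ θ ∉ Set.Ioo (-δ) δ, φδ θ = 0 := fun θ hθ =>
    Function.notMem_support.1 fun h => hθ (hφsupp h)
  have hb : IsAngularDensity δ fun θ => a θ * φδ θ :=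
    { contDiff := ha.mul (Complex.ofRealCLM.contDiff.comp hφ)
      eq_zero_left := fun θ hθ => by simp [hφ0 θ fun h => absurd h.1 hθ.not_gt]
      eq_zero_right := fun θ hθ => by simp [hφ0 θ fun h => absurd h.2 hθ.not_gt] }
  have hχ : IsRadialCutoff ψ := ⟨hψ, hψ0, 1, hψ1⟩
  obtain ⟨vh, hlim, -⟩ := hΩ.exists_limit_conicIntegral hc hδ hb hχ (1 / 2)
  have hvh : IsConicLimit k δ Ω vh := ⟨_, _, _, hb, hχ, hlim⟩
  have hclosed := fun f => IsConicLimit.exists_hasFDerivAt (f := f) hopen hΩ hc hδ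
  have hsmooth : ContDiffOn ℝ (⊤ : ℕ∞) vh Ω :=
    contDiffOn_infty_of_derivativeClosed hopen hclosed hvh
  have hsub : {ξ : ℝ × ℝ | ν ≤ Real.sqrt ((ξ.1 - k) ^ 2 + ξ.2 ^ 2)} ⊆ Ω := fun ξ hξ =>
    (half_lt_self hν).trans_le hξ
  refine ⟨vh, fun ρ φ _ hρφ => ?_, hsmooth.mono fun ξ hξ => hsub (Set.mem_ofPred.2 (le_of_lt hξ)),
    fun i N => ?_⟩
  · simp only [conicRegFT_eq_conicIntegral]
    exact hlim _ (hsub hρφ)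
  · obtain ⟨C, hC⟩ := exists_norm_iteratedFDeriv_le_of_derivativeClosed hopen hclosed
      (fun f hf => IsConicLimit.exists_norm_le hΩ hc hδ hf N) i hvh
    refine ⟨C, fun ξ hξ => ?_⟩
    rw [iteratedFDerivWithin_eq_iteratedFDeriv (uniqueDiffOn_disc_exterior hν)
      ((hsmooth.contDiffAt (hopen.mem_nhds (hsub hξ))).of_le (by exact_mod_cast le_top)) hξ]
    exact hC ξ (hsub hξ)
end
end

section
/- Fix k > 0 and a : ℝ → ℂ smooth and 2π-periodic, and let 0 < ν ≤ k/4 and 0 < ε ≤ k/8. Let χ₋ : ℝ → ℝ be smooth with χ₋(t) = 1 for t ≤ ε and χ₋(t) = 0 for t ≥ 2ε. Then there exist δ ∈ (0, π/4) and δ′ > 0 such that, with φ_δ ∈ C_c^∞(ℝ) supported in (−δ, δ) with φ_δ = 1 on (−δ/2, δ/2), ψ₊ : ℝ → ℝ smooth with ψ₊(r) = 0 for r ≤ 1 and ψ₊(r) = 1 for r ≥ 2, and v̂(ξ) := lim_{σ→0⁺} ∫_{−δ}^{δ} ∫_0^∞ a(θ) φ_δ(θ) ψ₊(r) √r e^{i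 r (k − ρ cos(θ − φ))} e^{−σ r} dr dθ for ξ = ρ(cos φ, sin φ) with |ξ − (k, 0)| ≥ ν (this limit exists and defines a smooth, rapidly decreasing function there), the following holds: for every x = r(cos θ₀, sin θ₀) with r ≥ 1 and |θ₀| ≤ δ′, the function ξ ↦ χ₋(⟨x, ξ⟩/|x|) vanishes on the ball {|ξ − (k, 0)| < ν}, the integral A v(x) := ∫_{ℝ²} χ₋(⟨x, ξ⟩/|x|) v̂(ξ) e^{i⟨x,ξ⟩} dξ (with integrand set to 0 on that ball) converges absolutely, and for every N ∈ ℕ there is a constant C_N with |A v(x)| ≤ C_N r^{−N} for all such x. -/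
open MeasureTheory Filter Topology

noncomputable section

/-- Smooth radial cutoffs: zero on `(-∞, 1]` and constant on `[2, ∞)`. -/
structure RadialCutoff (η : ℝ → ℂ) : Prop where
  contDiff : ContDiff ℝ (⊤ : ℕ∞) η
  eq_zero : ∀ r ≤ 1, η r = 0
  eq_const : ∃ c, ∀ r, 2 ≤ r → η r = c

/-- The cutoff `T η` for which `(T η) r ^ (s - 1)` is the derivative of `η r ^ s`. -/
def radialShift (s : ℝ) (η : ℝ → ℂ) (r : ℝ) : ℂ := r * deriv η r + s * η r

/-- The one-dimensional Fourier–Laplace transform `∫₀^∞ η(r) r^s e^{irz} dr`. -/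
def radialFT (η : ℝ → ℂ) (s : ℝ) (z : ℂ) : ℂ :=
  ∫ r in Set.Ioi (0 : ℝ), η r * (r ^ s : ℝ) * Complex.exp (Complex.I * r * z)

namespace RadialCutoff

variable {η : ℝ → ℂ}

lemma deriv_eq_zero_of_lt (hη : RadialCutoff η) {r : ℝ} (hr : r < 1) : deriv η r = 0 := by
  have : η =ᶠ[𝓝 r] fun _ => 0 := by
    filter_upwards [Iio_mem_nhds hr] with x hx using hη.eq_zero x (le_of_lt hx)
  rw [this.deriv_eq]; simp

lemma continuous_deriv (hη : RadialCutoff η) : Continuous (deriv η) :=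
  hη.contDiff.continuous_deriv (by simp)

lemma deriv_eq_zero_of_le_one (hη : RadialCutoff η) {r : ℝ} (hr : r ≤ 1) : deriv η r = 0 := by
  have hcl : IsClosed {x : ℝ | deriv η x = 0} := isClosed_eq hη.continuous_deriv continuous_const
  have hsub : closure (Set.Iio (1 : ℝ)) ⊆ {x : ℝ | deriv η x = 0} :=
    hcl.closure_subset_iff.2 fun x hx => hη.deriv_eq_zero_of_lt hx
  rw [closure_Iio] at hsub
  exact hsub hr

lemma deriv_eq_zero_of_two_le (hη : RadialCutoff η) {r : ℝ} (hr : 2 ≤ r) : deriv η r = 0 := by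
  obtain ⟨c, hc⟩ := hη.eq_const
  have hcl : IsClosed {x : ℝ | deriv η x = 0} := isClosed_eq hη.continuous_deriv continuous_const
  have hsub : closure (Set.Ioi (2 : ℝ)) ⊆ {x : ℝ | deriv η x = 0} := by
    refine hcl.closure_subset_iff.2 fun x hx => ?_
    have : η =ᶠ[𝓝 x] fun _ => c := by
      filter_upwards [Ioi_mem_nhds hx] with y hy using hc y (le_of_lt hy)
    simp [this.deriv_eq]
  rw [closure_Ioi] at hsub
  exact hsub hr

lemma shift (hη : RadialCutoff η) (s : ℝ) : RadialCutoff (radialShift s η) where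
  contDiff := by
    have h1 : ContDiff ℝ (⊤ : ℕ∞) (deriv η) :=
      ((contDiff_infty_iff_deriv).1 hη.contDiff).2
    exact (Complex.ofRealCLM.contDiff.mul h1).add (contDiff_const.mul hη.contDiff)
  eq_zero r hr := by simp [radialShift, hη.deriv_eq_zero_of_le_one hr, hη.eq_zero r hr]
  eq_const := by
    obtain ⟨c, hc⟩ := hη.eq_const
    exact ⟨s * c, fun r hr => by simp [radialShift, hη.deriv_eq_zero_of_two_le hr, hc r hr]⟩

lemma exists_bound (hη : RadialCutoff η) : ∃ C, 0 ≤ C ∧ ∀ r, ‖η r‖ ≤ C := by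
  obtain ⟨c, hc⟩ := hη.eq_const
  obtain ⟨C, hC⟩ := (isCompact_Icc (a := (1 : ℝ)) (b := 2)).exists_bound_of_continuousOn
    hη.contDiff.continuous.continuousOn
  refine ⟨max C ‖c‖, le_max_of_le_right (norm_nonneg _), fun r => ?_⟩
  rcases le_or_gt r 1 with h | h
  · simp [hη.eq_zero r h]
  rcases le_or_gt 2 r with h2 | h2
  · simp [hc r h2]
  · exact le_max_of_le_left (hC r ⟨h.le, h2.le⟩)

lemma norm_integrand (r s : ℝ) (hr : 0 < r) (z : ℂ) :
    ‖η r * (r ^ s : ℝ) * Complex.exp (Complex.I * r * z)‖ =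
      ‖η r‖ * r ^ s * Real.exp (-(z.im * r)) := by
  rw [norm_mul, norm_mul, Complex.norm_exp, Complex.norm_real, Real.norm_eq_abs,
    abs_of_pos (Real.rpow_pos_of_pos hr s)]
  congr 2
  simp [mul_comm]

lemma norm_integrand_le (hη : RadialCutoff η) {C : ℝ} (hC : ∀ r, ‖η r‖ ≤ C) (hC0 : 0 ≤ C)
    {r s t c : ℝ} (hr : 0 < r) {z : ℂ} (hst : s ≤ t) (hz : c ≤ z.im) :
    ‖η r * (r ^ s : ℝ) * Complex.exp (Complex.I * r * z)‖ ≤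
      C * (r ^ t * Real.exp (-(c * r))) := by
  rw [norm_integrand r s hr]
  rcases le_or_gt r 1 with h | h
  · rw [hη.eq_zero r h]
    have := Real.rpow_nonneg hr.le t
    simp; positivity
  · have h1 := Real.rpow_nonneg hr.le s
    rw [mul_assoc]
    gcongr
    · exact hC r
    · exact h.le

lemma continuousOn_integrand (hη : RadialCutoff η) (s : ℝ) (z : ℂ) :
    ContinuousOn (fun r : ℝ => η r * (r ^ s : ℝ) * Complex.exp (Complex.I * r * z))
      (Set.Ioi 0) := by
  have h1 : ContinuousOn (fun r : ℝ => r ^ s) (Set.Ioi 0) := fun r hr =>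
    (Real.continuousAt_rpow_const r s (Or.inl (ne_of_gt hr))).continuousWithinAt
  have h2 := hη.contDiff.continuous
  exact (h2.continuousOn.mul (Complex.continuous_ofReal.comp_continuousOn h1)).mul
    (by fun_prop)

lemma aestronglyMeasurable_integrand (hη : RadialCutoff η) (s : ℝ) (z : ℂ) :
    AEStronglyMeasurable (fun r : ℝ => η r * (r ^ s : ℝ) * Complex.exp (Complex.I * r * z))
      (volume.restrict (Set.Ioi 0)) :=
  (hη.continuousOn_integrand s z).aestronglyMeasurable measurableSet_Ioi

lemma integrableOn_rpow_mul_exp {t c : ℝ} (ht : -1 < t) (hc : 0 < c) (C : ℝ) :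
    IntegrableOn (fun r : ℝ => C * (r ^ t * Real.exp (-(c * r)))) (Set.Ioi 0) := by
  have := integrableOn_rpow_mul_exp_neg_mul_rpow ht zero_lt_one hc
  simpa [IntegrableOn] using this.const_mul C

lemma integrableOn_integrand (hη : RadialCutoff η) (s : ℝ) {z : ℂ} (hz : 0 < z.im) :
    IntegrableOn (fun r : ℝ => η r * (r ^ s : ℝ) * Complex.exp (Complex.I * r * z))
      (Set.Ioi 0) := by
  obtain ⟨C, hC0, hC⟩ := hη.exists_bound
  refine (integrableOn_rpow_mul_exp (t := max s 0) (by simp) hz C).mono'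
    (hη.aestronglyMeasurable_integrand s z) ?_
  filter_upwards [ae_restrict_mem measurableSet_Ioi] with r hr
  exact hη.norm_integrand_le hC hC0 hr (le_max_left _ _) le_rfl

lemma exists_bound_radialFT (hη : RadialCutoff η) {s : ℝ} (hs : s ≤ -2) :
    ∃ C, 0 ≤ C ∧ ∀ z : ℂ, 0 < z.im → ‖radialFT η s z‖ ≤ C := by
  obtain ⟨C, hC0, hC⟩ := hη.exists_bound
  have hint : IntegrableOn (fun r : ℝ => r ^ (-2 : ℝ)) (Set.Ioi 1) :=
    integrableOn_Ioi_rpow_of_lt (by norm_num) one_pos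
  set g : ℝ → ℝ := (Set.Ioi (1 : ℝ)).indicator fun r => C * r ^ (-2 : ℝ) with hg
  have hgi : Integrable g := (integrable_indicator_iff measurableSet_Ioi).2 (hint.const_mul C)
  have hg0 : ∀ r, 0 ≤ g r := fun r => Set.indicator_nonneg
    (fun x hx => mul_nonneg hC0 (Real.rpow_nonneg (zero_le_one.trans (le_of_lt hx)) _)) r
  refine ⟨∫ r in Set.Ioi 0, g r, integral_nonneg hg0, fun z hz => ?_⟩
  refine norm_integral_le_of_norm_le hgi.integrableOn ?_
  filter_upwards [ae_restrict_mem measurableSet_Ioi] with r hr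
  rcases le_or_gt r 1 with h | h
  · rw [hη.eq_zero r h]; simpa using hg0 r
  · have := hη.norm_integrand_le hC hC0 hr hs hz.le
    simpa [hg, h] using this

lemma hasDerivAt_radialFT (hη : RadialCutoff η) (s : ℝ) {z : ℂ} (hz : 0 < z.im) :
    HasDerivAt (radialFT η s) (Complex.I * radialFT η (s + 1) z) z := by
  obtain ⟨C, hC0, hC⟩ := hη.exists_bound
  have hs : {w : ℂ | z.im / 2 < w.im} ∈ 𝓝 z :=
    (isOpen_lt continuous_const Complex.continuous_im).mem_nhds (by simp [hz])
  have key := hasDerivAt_integral_of_dominated_loc_of_deriv_le (𝕜 := ℂ)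
    (μ := volume.restrict (Set.Ioi (0 : ℝ)))
    (F := fun w r => η r * (r ^ s : ℝ) * Complex.exp (Complex.I * r * w))
    (F' := fun w r => Complex.I * (η r * (r ^ (s + 1) : ℝ) * Complex.exp (Complex.I * r * w)))
    (bound := fun r => C * (r ^ (max (s + 1) 0) * Real.exp (-(z.im / 2 * r)))) hs
    (Eventually.of_forall fun w => hη.aestronglyMeasurable_integrand s w)
    (hη.integrableOn_integrand s hz)
    ((hη.aestronglyMeasurable_integrand (s + 1) z).const_mul _) ?_
    (integrableOn_rpow_mul_exp (by simp) (by linarith) C) ?_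
  · have := key.2
    rw [integral_const_mul] at this
    exact this
  · filter_upwards [ae_restrict_mem measurableSet_Ioi] with r hr w hw
    rw [norm_mul, Complex.norm_I, one_mul]
    exact hη.norm_integrand_le hC hC0 hr (le_max_left _ _) (le_of_lt hw)
  · filter_upwards [ae_restrict_mem measurableSet_Ioi] with r hr w hw
    have h1 : HasDerivAt (fun w : ℂ => Complex.I * r * w) (Complex.I * r) w := by
      simpa using (hasDerivAt_id w).const_mul (Complex.I * r)
    have h2 := h1.cexp.const_mul (η r * (r ^ s : ℝ))
    refine h2.congr_deriv ?_
    rw [Real.rpow_add_one (ne_of_gt hr)]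
    push_cast; ring

lemma continuousOn_radialFT (hη : RadialCutoff η) (s : ℝ) :
    ContinuousOn (radialFT η s) {z | 0 < z.im} := fun _ hz =>
  (hη.hasDerivAt_radialFT s hz).continuousAt.continuousWithinAt

lemma mul_radialFT (hη : RadialCutoff η) (s : ℝ) {z : ℂ} (hz : 0 < z.im) :
    z * radialFT η s z = Complex.I * radialFT (radialShift s η) (s - 1) z := by
  set f : ℝ → ℂ := fun r => η r * (r ^ s : ℝ) * Complex.exp (Complex.I * r * z) with hf
  set g : ℝ → ℂ := fun r =>
    radialShift s η r * (r ^ (s - 1) : ℝ) * Complex.exp (Complex.I * r * z) with hg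
  have hfi := hη.integrableOn_integrand s hz
  have hgi := (hη.shift s).integrableOn_integrand (s - 1) hz
  have hd : ∀ r ∈ Set.Ioi (0 : ℝ), HasDerivAt f (g r + Complex.I * z * f r) r := by
    intro r hr
    have h1 : HasDerivAt η (deriv η r) r :=
      (hη.contDiff.differentiable (by simp)).differentiableAt.hasDerivAt
    have h2 : HasDerivAt (fun r : ℝ => ((r ^ s : ℝ) : ℂ)) ((s * r ^ (s - 1) : ℝ) : ℂ) r :=
      (Real.hasDerivAt_rpow_const (Or.inl (ne_of_gt hr))).ofReal_comp
    have h3 : HasDerivAt (fun r : ℝ => Complex.I * r * z) (Complex.I * z) r := by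
      simpa using (((hasDerivAt_id r).ofReal_comp).const_mul Complex.I).mul_const z
    refine ((h1.mul h2).mul h3.cexp).congr_deriv ?_
    simp only [hf, hg, radialShift, Pi.mul_apply]
    have : r ^ s = r ^ (s - 1) * r := by
      rw [← Real.rpow_add_one (ne_of_gt hr)]; simp
    rw [this]; push_cast; ring
  have hint : IntegrableOn (fun r => g r + Complex.I * z * f r) (Set.Ioi 0) :=
    hgi.add (hfi.const_mul _)
  have hc : ContinuousWithinAt f (Set.Ici 0) 0 := by
    refine ContinuousAt.continuousWithinAt ?_
    have : f =ᶠ[𝓝 0] fun _ => 0 := by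
      filter_upwards [Iio_mem_nhds (zero_lt_one (α := ℝ))] with r hr
      simp [hf, hη.eq_zero r (le_of_lt hr)]
    exact continuousAt_const.congr this.symm
  have h0 := integral_Ioi_of_hasDerivAt_of_tendsto hc hd hint
    (tendsto_zero_of_hasDerivAt_of_integrableOn_Ioi hd hint hfi)
  rw [integral_add hgi (hfi.const_mul _), integral_const_mul] at h0
  have hf0 : f 0 = 0 := by simp [hf, hη.eq_zero 0 zero_le_one]
  rw [hf0, sub_zero] at h0
  change radialFT (radialShift s η) (s - 1) z + Complex.I * z * radialFT η s z = 0 at h0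
  linear_combination -Complex.I * h0 + z * radialFT η s z * Complex.I_sq

end RadialCutoff

/-- The real part `k - ⟨ξ, ω(θ)⟩` of the conic phase. -/
def conicPhaseRe (k : ℝ) (ξ : ℝ × ℝ) (θ : ℝ) : ℝ := k - (ξ.1 * Real.cos θ + ξ.2 * Real.sin θ)

/-- The angular derivative of the conic phase. -/
def conicPhaseDeriv (ξ : ℝ × ℝ) (θ : ℝ) : ℝ := ξ.1 * Real.sin θ - ξ.2 * Real.cos θ

/-- The complex conic phase `k - ⟨ξ, ω(θ)⟩ + iσ` at the point `x = (ξ, σ)`. -/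
def conicPhase (k : ℝ) (x : (ℝ × ℝ) × ℝ) (θ : ℝ) : ℂ := conicPhaseRe k x.1 θ + x.2 * Complex.I

/-- The squared length of the phase gradient. -/
def conicGradSq (k : ℝ) (x : (ℝ × ℝ) × ℝ) (θ : ℝ) : ℝ :=
  conicPhaseRe k x.1 θ ^ 2 + conicPhaseDeriv x.1 θ ^ 2 + x.2 ^ 2

lemma conicPhase_im (k : ℝ) (x : (ℝ × ℝ) × ℝ) (θ : ℝ) : (conicPhase k x θ).im = x.2 := by
  simp [conicPhase]

lemma hasDerivAt_conicPhaseRe (k : ℝ) (ξ : ℝ × ℝ) (θ : ℝ) :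
    HasDerivAt (conicPhaseRe k ξ) (conicPhaseDeriv ξ θ) θ := by
  have := (((Real.hasDerivAt_cos θ).const_mul ξ.1).add
    ((Real.hasDerivAt_sin θ).const_mul ξ.2)).const_sub k
  refine this.congr_deriv ?_
  simp [conicPhaseDeriv]; ring

lemma hasDerivAt_conicPhaseDeriv (k : ℝ) (ξ : ℝ × ℝ) (θ : ℝ) :
    HasDerivAt (conicPhaseDeriv ξ) (k - conicPhaseRe k ξ θ) θ := by
  have := ((Real.hasDerivAt_sin θ).const_mul ξ.1).sub ((Real.hasDerivAt_cos θ).const_mul ξ.2)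
  refine this.congr_deriv ?_
  simp [conicPhaseRe]

lemma hasDerivAt_conicPhase (k : ℝ) (x : (ℝ × ℝ) × ℝ) (θ : ℝ) :
    HasDerivAt (conicPhase k x) (conicPhaseDeriv x.1 θ) θ :=
  ((hasDerivAt_conicPhaseRe k x.1 θ).ofReal_comp).add_const _

lemma hasDerivAt_conicGradSq (k : ℝ) (x : (ℝ × ℝ) × ℝ) (θ : ℝ) :
    HasDerivAt (conicGradSq k x) (2 * k * conicPhaseDeriv x.1 θ) θ := by
  have := (((hasDerivAt_conicPhaseRe k x.1 θ).pow 2).add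
    ((hasDerivAt_conicPhaseDeriv k x.1 θ).pow 2)).add_const (x.2 ^ 2)
  refine this.congr_deriv ?_
  simp; ring

/-- The graded algebra of amplitudes generated by repeated integration by parts; an amplitude of
degree `n` decays like `(1 + |ξ|)⁻ⁿ`. -/
inductive ConicAmplitude (k : ℝ) : ℕ → ((ℝ × ℝ) × ℝ → ℝ → ℂ) → Prop
  | const (c : ℂ) : ConicAmplitude k 0 fun _ _ => c
  | radial : ConicAmplitude k 1 fun x θ => (conicPhaseRe k x.1 θ / conicGradSq k x θ : ℝ)
  | angular : ConicAmplitude k 1 fun x θ => (conicPhaseDeriv x.1 θ / conicGradSq k x θ : ℝ)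
  | inv : ConicAmplitude k 1 fun x θ => (1 / conicGradSq k x θ : ℝ)
  | damping : ConicAmplitude k 1 fun x θ => (x.2 / conicGradSq k x θ : ℝ)
  | add {n F G} : ConicAmplitude k n F → ConicAmplitude k n G →
      ConicAmplitude k n fun x θ => F x θ + G x θ
  | mul {m n F G} : ConicAmplitude k m F → ConicAmplitude k n G →
      ConicAmplitude k (m + n) fun x θ => F x θ * G x θ
  | weaken {n F} : ConicAmplitude k (n + 1) F → ConicAmplitude k n F

namespace ConicAmplitude

variable {k : ℝ} {n : ℕ} {F : (ℝ × ℝ) × ℝ → ℝ → ℂ}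

lemma const_mul (hF : ConicAmplitude k n F) (c : ℂ) :
    ConicAmplitude k n fun x θ => c * F x θ := by
  have := (const (k := k) c).mul hF
  rwa [zero_add] at this

lemma hasDerivAt_div {f : ℝ → ℝ} {f' : ℝ} (x : (ℝ × ℝ) × ℝ) {θ : ℝ}
    (hq : conicGradSq k x θ ≠ 0) (hf : HasDerivAt f f' θ) :
    HasDerivAt (fun t => ((f t / conicGradSq k x t : ℝ) : ℂ))
      ((f' / conicGradSq k x θ : ℝ) + (-2 * k : ℂ) * (((f θ / conicGradSq k x θ : ℝ) : ℂ) *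
        (conicPhaseDeriv x.1 θ / conicGradSq k x θ : ℝ))) θ := by
  refine ((hf.div (hasDerivAt_conicGradSq k x θ) hq).ofReal_comp).congr_deriv ?_
  have : (conicGradSq k x θ : ℂ) ≠ 0 := by exact_mod_cast hq
  push_cast
  field_simp
  ring

lemma exists_hasDerivAt (hF : ConicAmplitude k n F) :
    ∃ F', ConicAmplitude k n F' ∧ ∀ x θ, conicGradSq k x θ ≠ 0 →
      HasDerivAt (F x) (F' x θ) θ := by
  induction hF with
  | const c => exact ⟨_, const 0, fun x θ _ => hasDerivAt_const θ c⟩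
  | radial =>
    exact ⟨_, angular.add ((radial.mul angular).weaken.const_mul (-2 * k)), fun x θ hq =>
      hasDerivAt_div x hq (hasDerivAt_conicPhaseRe k x.1 θ)⟩
  | angular =>
    refine ⟨_, ((inv.const_mul k).add (radial.const_mul (-1))).add
      ((angular.mul angular).weaken.const_mul (-2 * k)), fun x θ hq =>
      (hasDerivAt_div x hq (hasDerivAt_conicPhaseDeriv k x.1 θ)).congr_deriv ?_⟩
    push_cast; ring
  | inv =>
    refine ⟨_, (inv.mul angular).weaken.const_mul (-2 * k), fun x θ hq =>
      (hasDerivAt_div x hq (hasDerivAt_const θ (1 : ℝ))).congr_deriv ?_⟩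
    simp
  | damping =>
    refine ⟨_, (damping.mul angular).weaken.const_mul (-2 * k), fun x θ hq =>
      (hasDerivAt_div x hq (hasDerivAt_const θ x.2)).congr_deriv ?_⟩
    simp
  | add _ _ ihF ihG =>
    obtain ⟨F', hF', hFd⟩ := ihF
    obtain ⟨G', hG', hGd⟩ := ihG
    exact ⟨_, hF'.add hG', fun x θ hq => (hFd x θ hq).add (hGd x θ hq)⟩
  | mul hF hG ihF ihG =>
    obtain ⟨F', hF', hFd⟩ := ihF
    obtain ⟨G', hG', hGd⟩ := ihG
    exact ⟨_, (hF'.mul hG).add (hF.mul hG'), fun x θ hq => (hFd x θ hq).mul (hGd x θ hq)⟩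
  | weaken _ ih =>
    obtain ⟨F', hF', hFd⟩ := ih
    exact ⟨F', hF'.weaken, hFd⟩

end ConicAmplitude

/-- The admissible points `(ξ, σ)`: `|ξ - (k, 0)| ≥ ν` and `0 < σ ≤ 1`. -/
def conicRegion (k ν : ℝ) : Set ((ℝ × ℝ) × ℝ) :=
  {x | ν ≤ Real.sqrt ((x.1.1 - k) ^ 2 + x.1.2 ^ 2) ∧ 0 < x.2 ∧ x.2 ≤ 1}

/-- The Japanese bracket `1 + |ξ|`. -/
def bracket (ξ : ℝ × ℝ) : ℝ := 1 + Real.sqrt (ξ.1 ^ 2 + ξ.2 ^ 2)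

lemma one_le_bracket (ξ : ℝ × ℝ) : 1 ≤ bracket ξ := by
  have := Real.sqrt_nonneg (ξ.1 ^ 2 + ξ.2 ^ 2)
  unfold bracket; linarith

lemma sqrt_add_sq_le (a b c d : ℝ) :
    Real.sqrt ((a + c) ^ 2 + (b + d) ^ 2) ≤ Real.sqrt (a ^ 2 + b ^ 2) + Real.sqrt (c ^ 2 + d ^ 2) := by
  have h := norm_add_le (⟨a, b⟩ : ℂ) ⟨c, d⟩
  simpa [Complex.norm_eq_sqrt_sq_add_sq] using h

lemma sqrt_shift_le_gradSq {k : ℝ} (x : (ℝ × ℝ) × ℝ) (θ : ℝ) :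
    Real.sqrt ((x.1.1 - k * Real.cos θ) ^ 2 + (x.1.2 - k * Real.sin θ) ^ 2) ≤
      Real.sqrt (conicGradSq k x θ) := by
  apply Real.sqrt_le_sqrt
  have h := Real.sin_sq_add_cos_sq θ
  have : conicGradSq k x θ = (x.1.1 - k * Real.cos θ) ^ 2 + (x.1.2 - k * Real.sin θ) ^ 2 +
      x.2 ^ 2 := by
    unfold conicGradSq conicPhaseRe conicPhaseDeriv
    linear_combination (x.1.1 ^ 2 + x.1.2 ^ 2 - k ^ 2) * h
  rw [this]
  linarith [sq_nonneg x.2]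

lemma half_le_sqrt_gradSq {k ν D : ℝ} (hk : 0 < k) (hD : k * D ≤ ν / 2) {x : (ℝ × ℝ) × ℝ}
    (hx : x ∈ conicRegion k ν) {θ : ℝ} (hθ : |θ| ≤ D) :
    ν / 2 ≤ Real.sqrt (conicGradSq k x θ) := by
  have h1 := sqrt_shift_le_gradSq (k := k) x θ
  have h2 := sqrt_add_sq_le (x.1.1 - k * Real.cos θ) (x.1.2 - k * Real.sin θ)
    (k * Real.cos θ - k) (k * Real.sin θ)
  have h3 : Real.sqrt ((k * Real.cos θ - k) ^ 2 + (k * Real.sin θ) ^ 2) ≤ k * |θ| := by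
    rw [Real.sqrt_le_iff]
    refine ⟨by positivity, ?_⟩
    have hc := Real.one_sub_sq_div_two_le_cos (x := θ)
    have h := Real.sin_sq_add_cos_sq θ
    have h4 : (k * Real.cos θ - k) ^ 2 + (k * Real.sin θ) ^ 2 = k ^ 2 * (2 * (1 - Real.cos θ)) := by
      linear_combination k ^ 2 * h
    rw [h4, mul_pow, sq_abs]
    gcongr; linarith
  have h4 := hx.1
  have h5 : k * |θ| ≤ k * D := by gcongr
  rw [show x.1.1 - k * Real.cos θ + (k * Real.cos θ - k) = x.1.1 - k by ring,
    show x.1.2 - k * Real.sin θ + k * Real.sin θ = x.1.2 by ring] at h2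
  linarith

lemma gradSq_pos {k ν D : ℝ} (hk : 0 < k) (hν : 0 < ν) (hD : k * D ≤ ν / 2) {x : (ℝ × ℝ) × ℝ}
    (hx : x ∈ conicRegion k ν) {θ : ℝ} (hθ : |θ| ≤ D) : 0 < conicGradSq k x θ :=
  Real.sqrt_pos.1 (lt_of_lt_of_le (by linarith) (half_le_sqrt_gradSq hk hD hx hθ))

lemma bracket_le_mul_sqrt_gradSq {k ν D : ℝ} (hk : 0 < k) (hν : 0 < ν) (hD : k * D ≤ ν / 2)
    {x : (ℝ × ℝ) × ℝ} (hx : x ∈ conicRegion k ν) {θ : ℝ} (hθ : |θ| ≤ D) :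
    bracket x.1 ≤ (1 + (1 + k) * (2 / ν)) * Real.sqrt (conicGradSq k x θ) := by
  have h0 := half_le_sqrt_gradSq hk hD hx hθ
  have h1 := sqrt_shift_le_gradSq (k := k) x θ
  have h2 := sqrt_add_sq_le (x.1.1 - k * Real.cos θ) (x.1.2 - k * Real.sin θ)
    (k * Real.cos θ) (k * Real.sin θ)
  have h3 : Real.sqrt ((k * Real.cos θ) ^ 2 + (k * Real.sin θ) ^ 2) = k := by
    rw [show (k * Real.cos θ) ^ 2 + (k * Real.sin θ) ^ 2 = k ^ 2 by
      linear_combination k ^ 2 * Real.sin_sq_add_cos_sq θ]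
    exact Real.sqrt_sq hk.le
  simp only [sub_add_cancel, h3] at h2
  have h4 : (1 + k) * (2 / ν) * (ν / 2) ≤ (1 + k) * (2 / ν) * Real.sqrt (conicGradSq k x θ) := by
    gcongr
  have h5 : (1 + k) * (2 / ν) * (ν / 2) = 1 + k := by field_simp
  unfold bracket
  linarith

lemma ConicAmplitude.exists_bound {k ν D : ℝ} (hk : 0 < k) (hν : 0 < ν) (hD : k * D ≤ ν / 2)
    {n : ℕ} {F : (ℝ × ℝ) × ℝ → ℝ → ℂ} (hF : ConicAmplitude k n F) :
    ∃ C, 0 ≤ C ∧ ∀ x ∈ conicRegion k ν, ∀ θ, |θ| ≤ D → ‖F x θ‖ ≤ C / bracket x.1 ^ n := by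
  set K := 1 + (1 + k) * (2 / ν) with hK
  have hK0 : 0 ≤ K := by positivity
  have base : ∀ f : (ℝ × ℝ) × ℝ → ℝ → ℝ, ∀ A, 0 ≤ A →
      (∀ x ∈ conicRegion k ν, ∀ θ, |θ| ≤ D → |f x θ| ≤ A * Real.sqrt (conicGradSq k x θ)) →
      ∃ C, 0 ≤ C ∧ ∀ x ∈ conicRegion k ν, ∀ θ, |θ| ≤ D →
        ‖((f x θ / conicGradSq k x θ : ℝ) : ℂ)‖ ≤ C / bracket x.1 ^ 1 := by
    intro f A hA h
    refine ⟨A * K, by positivity, fun x hx θ hθ => ?_⟩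
    have hq := gradSq_pos hk hν hD hx hθ
    have hs := Real.sqrt_pos.2 hq
    have hb := bracket_le_mul_sqrt_gradSq hk hν hD hx hθ
    have hb1 := one_le_bracket x.1
    rw [Complex.norm_real, Real.norm_eq_abs, abs_div, abs_of_pos hq, pow_one,
      div_le_div_iff₀ hq (by linarith)]
    calc |f x θ| * bracket x.1
        ≤ (A * Real.sqrt (conicGradSq k x θ)) * (K * Real.sqrt (conicGradSq k x θ)) := by
          gcongr
          exact h x hx θ hθ
      _ = A * K * conicGradSq k x θ := by
          rw [mul_mul_mul_comm, Real.mul_self_sqrt hq.le]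
  induction hF with
  | const c => exact ⟨‖c‖, norm_nonneg _, fun x _ θ _ => by simp⟩
  | radial =>
    refine base (fun x θ => conicPhaseRe k x.1 θ) 1 zero_le_one fun x _ θ _ => ?_
    rw [one_mul]
    apply Real.abs_le_sqrt
    unfold conicGradSq
    nlinarith [sq_nonneg (conicPhaseDeriv x.1 θ), sq_nonneg x.2]
  | angular =>
    refine base (fun x θ => conicPhaseDeriv x.1 θ) 1 zero_le_one fun x _ θ _ => ?_
    rw [one_mul]
    apply Real.abs_le_sqrt
    unfold conicGradSq
    nlinarith [sq_nonneg (conicPhaseRe k x.1 θ), sq_nonneg x.2]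
  | inv =>
    refine base (fun x θ => 1) (2 / ν) (by positivity) fun x hx θ hθ => ?_
    have h := half_le_sqrt_gradSq hk hD hx hθ
    rw [abs_one, ← div_le_iff₀' (by positivity)]
    simpa using h
  | damping =>
    refine base (fun x θ => x.2) 1 zero_le_one fun x _ θ _ => ?_
    rw [one_mul]
    apply Real.abs_le_sqrt
    unfold conicGradSq
    nlinarith [sq_nonneg (conicPhaseDeriv x.1 θ), sq_nonneg (conicPhaseRe k x.1 θ)]
  | add _ _ ihF ihG =>
    obtain ⟨C, hC, h⟩ := ihF
    obtain ⟨C', hC', h'⟩ := ihG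
    refine ⟨C + C', by positivity, fun x hx θ hθ => ?_⟩
    rw [add_div]
    exact (norm_add_le _ _).trans (add_le_add (h x hx θ hθ) (h' x hx θ hθ))
  | mul _ _ ihF ihG =>
    obtain ⟨C, hC, h⟩ := ihF
    obtain ⟨C', hC', h'⟩ := ihG
    refine ⟨C * C', by positivity, fun x hx θ hθ => ?_⟩
    have hb := one_le_bracket x.1
    rw [pow_add, mul_div_mul_comm, norm_mul]
    exact mul_le_mul (h x hx θ hθ) (h' x hx θ hθ) (norm_nonneg _) (by positivity)
  | weaken _ ih =>
    obtain ⟨C, hC, h⟩ := ih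
    refine ⟨C, hC, fun x hx θ hθ => (h x hx θ hθ).trans ?_⟩
    have hb := one_le_bracket x.1
    gcongr
    · simp

/-- Smooth angular amplitudes supported in `(-D, D)`. -/
structure AngularBump (D : ℝ) (b : ℝ → ℂ) : Prop where
  contDiff : ContDiff ℝ (⊤ : ℕ∞) b
  tsupport_subset : tsupport b ⊆ Set.Ioo (-D) D

namespace AngularBump

variable {D : ℝ} {b : ℝ → ℂ}

lemma continuous (hb : AngularBump D b) : Continuous b := hb.contDiff.continuous

lemma eq_zero (hb : AngularBump D b) {θ : ℝ} (hθ : θ ∉ Set.Ioo (-D) D) : b θ = 0 :=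
  image_eq_zero_of_notMem_tsupport fun h => hθ (hb.tsupport_subset h)

lemma hasDerivAt (hb : AngularBump D b) (θ : ℝ) : HasDerivAt b (deriv b θ) θ :=
  (hb.contDiff.differentiable (by simp)).differentiableAt.hasDerivAt

lemma deriv (hb : AngularBump D b) : AngularBump D (deriv b) where
  contDiff := ((contDiff_infty_iff_deriv).1 hb.contDiff).2
  tsupport_subset := tsupport_deriv_subset.trans hb.tsupport_subset

lemma mul (hb : AngularBump D b) {g : ℝ → ℂ} (hg : ContDiff ℝ (⊤ : ℕ∞) g) :
    AngularBump D fun θ => b θ * g θ where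
  contDiff := hb.contDiff.mul hg
  tsupport_subset := (tsupport_mul_subset_left (f := b) (g := g)).trans hb.tsupport_subset

end AngularBump

/-- The conic Fourier transform of the amplitude `b(θ) η(r) r^s`, at the point `x = (ξ, σ)`. -/
def conicFT (k D : ℝ) (b η : ℝ → ℂ) (s : ℝ) (x : (ℝ × ℝ) × ℝ) : ℂ :=
  ∫ θ in (-D)..D, b θ * radialFT η s (conicPhase k x θ)

section

variable {k ν D : ℝ} {b η : ℝ → ℂ}

lemma continuous_conicPhase (k : ℝ) (x : (ℝ × ℝ) × ℝ) : Continuous (conicPhase k x) :=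
  continuous_iff_continuousAt.2 fun θ => (hasDerivAt_conicPhase k x θ).continuousAt

lemma RadialCutoff.continuous_radialFT_conicPhase (hη : RadialCutoff η) (s : ℝ)
    {x : (ℝ × ℝ) × ℝ} (hx : 0 < x.2) :
    Continuous fun θ => radialFT η s (conicPhase k x θ) :=
  (hη.continuousOn_radialFT s).comp_continuous (continuous_conicPhase k x) fun θ => by
    simpa [conicPhase_im] using hx

lemma ConicAmplitude.continuousOn {n : ℕ} {F : (ℝ × ℝ) × ℝ → ℝ → ℂ} (hF : ConicAmplitude k n F)
    {x : (ℝ × ℝ) × ℝ} {S : Set ℝ} (hq : ∀ θ ∈ S, conicGradSq k x θ ≠ 0) :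
    ContinuousOn (F x) S := by
  obtain ⟨F', -, h⟩ := hF.exists_hasDerivAt
  exact fun θ hθ => (h x θ (hq θ hθ)).continuousAt.continuousWithinAt

lemma RadialCutoff.radialFT_conicPhase_eq (hη : RadialCutoff η) (s : ℝ)
    {x : (ℝ × ℝ) × ℝ} (hx : 0 < x.2) {θ : ℝ} (hq : conicGradSq k x θ ≠ 0) :
    radialFT η s (conicPhase k x θ) =
      Complex.I * (((conicPhaseRe k x.1 θ / conicGradSq k x θ : ℝ) +
        (-Complex.I) * (x.2 / conicGradSq k x θ : ℝ)) *
          radialFT (radialShift s η) (s - 1) (conicPhase k x θ)) +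
      -Complex.I * ((conicPhaseDeriv x.1 θ / conicGradSq k x θ : ℝ) *
        (Complex.I * radialFT η s (conicPhase k x θ) * conicPhaseDeriv x.1 θ)) := by
  have h := hη.mul_radialFT s (z := conicPhase k x θ) (by simpa [conicPhase_im] using hx)
  set H := radialFT η s (conicPhase k x θ)
  set T := radialFT (radialShift s η) (s - 1) (conicPhase k x θ)
  have hq' : (conicGradSq k x θ : ℂ) ≠ 0 := by exact_mod_cast hq
  have hg : (conicGradSq k x θ : ℂ) =
      (conicPhaseRe k x.1 θ : ℂ) ^ 2 + (conicPhaseDeriv x.1 θ : ℂ) ^ 2 + (x.2 : ℂ) ^ 2 := by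
    simp [conicGradSq]
  have hz : conicPhase k x θ = conicPhaseRe k x.1 θ + x.2 * Complex.I := rfl
  rw [hz] at h
  push_cast
  field_simp
  linear_combination H * hg + (conicPhaseRe k x.1 θ - Complex.I * x.2) * h +
    (H * conicPhaseDeriv x.1 θ ^ 2 + H * x.2 ^ 2) * Complex.I_sq

lemma integral_by_parts (hD0 : 0 < D) (hb : AngularBump D b) (hη : RadialCutoff η) (s : ℝ)
    {n m : ℕ} {F G' : (ℝ × ℝ) × ℝ → ℝ → ℂ} (hF : ConicAmplitude k n F) (hG' : ConicAmplitude k m G')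
    (hd : ∀ x θ, conicGradSq k x θ ≠ 0 → HasDerivAt
      (fun θ => F x θ * (conicPhaseDeriv x.1 θ / conicGradSq k x θ : ℝ)) (G' x θ) θ)
    {x : (ℝ × ℝ) × ℝ} (hx : 0 < x.2) (hq : ∀ θ, |θ| ≤ D → conicGradSq k x θ ≠ 0) :
    (∫ θ in (-D)..D, b θ * F x θ * radialFT η s (conicPhase k x θ)) =
      Complex.I * (∫ θ in (-D)..D, b θ * (F x θ *
        ((conicPhaseRe k x.1 θ / conicGradSq k x θ : ℝ) +
          (-Complex.I) * (x.2 / conicGradSq k x θ : ℝ))) *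
            radialFT (radialShift s η) (s - 1) (conicPhase k x θ)) +
      Complex.I * ((∫ θ in (-D)..D, deriv b θ * (F x θ *
          (conicPhaseDeriv x.1 θ / conicGradSq k x θ : ℝ)) *
            radialFT η (s - 1) (conicPhase k x θ)) +
        ∫ θ in (-D)..D, b θ * G' x θ * radialFT η (s - 1) (conicPhase k x θ)) := by
  have hu : Set.uIcc (-D) D = Set.Icc (-D) D := Set.uIcc_of_le (by linarith)
  have hqI : ∀ θ ∈ Set.uIcc (-D) D, conicGradSq k x θ ≠ 0 := fun θ hθ =>
    hq θ (abs_le.2 (by rwa [hu] at hθ))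
  have hbc := hb.continuous.continuousOn (s := Set.uIcc (-D) D)
  have hbc' := hb.deriv.continuous.continuousOn (s := Set.uIcc (-D) D)
  have hFc := hF.continuousOn hqI
  have hG'c := hG'.continuousOn hqI
  have huc := (ConicAmplitude.radial (k := k)).continuousOn hqI
  have hwc := (ConicAmplitude.angular (k := k)).continuousOn hqI
  have htc := (ConicAmplitude.damping (k := k)).continuousOn hqI
  have hH := (hη.continuous_radialFT_conicPhase (k := k) s hx).continuousOn (s := Set.uIcc (-D) D)
  have hH1 := (hη.continuous_radialFT_conicPhase (k := k) (s - 1) hx).continuousOn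
    (s := Set.uIcc (-D) D)
  have hT := ((hη.shift s).continuous_radialFT_conicPhase (k := k) (s - 1) hx).continuousOn
    (s := Set.uIcc (-D) D)
  have hpc : ContinuousOn (fun θ => (conicPhaseDeriv x.1 θ : ℂ)) (Set.uIcc (-D) D) := by
    unfold conicPhaseDeriv; fun_prop
  have hHd : ∀ θ ∈ Set.uIcc (-D) D, HasDerivAt (fun θ => radialFT η (s - 1) (conicPhase k x θ))
      (Complex.I * radialFT η s (conicPhase k x θ) * conicPhaseDeriv x.1 θ) θ := by
    intro θ _
    have h1 := hη.hasDerivAt_radialFT (s - 1) (z := conicPhase k x θ)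
      (by simpa [conicPhase_im] using hx)
    rw [sub_add_cancel] at h1
    exact h1.comp θ (hasDerivAt_conicPhase k x θ)
  have hUd : ∀ θ ∈ Set.uIcc (-D) D, HasDerivAt
      (fun θ => b θ * (F x θ * (conicPhaseDeriv x.1 θ / conicGradSq k x θ : ℝ)))
      (deriv b θ * (F x θ * (conicPhaseDeriv x.1 θ / conicGradSq k x θ : ℝ)) + b θ * G' x θ) θ :=
    fun θ hθ => (hb.hasDerivAt θ).mul (hd x θ (hqI θ hθ))
  have ibp := intervalIntegral.integral_mul_deriv_eq_deriv_mul hUd hHd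
    (((hbc'.mul (hFc.mul hwc)).add (hbc.mul hG'c)).intervalIntegrable)
    (((continuousOn_const.mul hH).mul hpc).intervalIntegrable)
  rw [hb.eq_zero (θ := D) (by simp), hb.eq_zero (θ := -D) (by simp)] at ibp
  simp only [zero_mul, sub_zero, zero_sub, add_mul] at ibp
  have hadd := intervalIntegral.integral_add (μ := volume)
    ((hbc'.mul (hFc.mul hwc)).mul hH1).intervalIntegrable
    ((hbc.mul hG'c).mul hH1).intervalIntegrable
  simp only [Pi.mul_apply] at hadd
  rw [hadd] at ibp
  have hA := ((hbc.mul (hFc.mul (huc.add ((continuousOn_const (c := -Complex.I)).mul htc)))).mul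
    hT).intervalIntegrable (μ := volume)
  have hB := ((hbc.mul (hFc.mul hwc)).mul
    (((continuousOn_const (c := Complex.I)).mul hH).mul hpc)).intervalIntegrable (μ := volume)
  have split : (∫ θ in (-D)..D, b θ * F x θ * radialFT η s (conicPhase k x θ)) =
      ∫ θ in (-D)..D, (Complex.I * (b θ * (F x θ *
        ((conicPhaseRe k x.1 θ / conicGradSq k x θ : ℝ) +
          (-Complex.I) * (x.2 / conicGradSq k x θ : ℝ))) *
            radialFT (radialShift s η) (s - 1) (conicPhase k x θ)) +
        -Complex.I * (b θ * (F x θ * (conicPhaseDeriv x.1 θ / conicGradSq k x θ : ℝ)) *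
          (Complex.I * radialFT η s (conicPhase k x θ) * conicPhaseDeriv x.1 θ))) := by
    refine intervalIntegral.integral_congr fun θ hθ => ?_
    linear_combination b θ * F x θ * hη.radialFT_conicPhase_eq s hx (hqI θ hθ)
  have hadd' := intervalIntegral.integral_add (hA.const_mul Complex.I) (hB.const_mul (-Complex.I))
  simp only [Pi.mul_apply, Pi.add_apply] at hadd'
  rw [split, hadd', intervalIntegral.integral_const_mul, intervalIntegral.integral_const_mul]
  linear_combination -Complex.I * ibp

lemma exists_amplitude_bound (hk : 0 < k) (hν : 0 < ν) (hD0 : 0 < D) (hD : k * D ≤ ν / 2) (M : ℕ) :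
    ∀ {b η : ℝ → ℂ} {s : ℝ} {n : ℕ} {F : (ℝ × ℝ) × ℝ → ℝ → ℂ}, AngularBump D b → RadialCutoff η →
      s ≤ M - 2 → ConicAmplitude k n F → ∃ C, 0 ≤ C ∧ ∀ x ∈ conicRegion k ν,
        ‖∫ θ in (-D)..D, b θ * F x θ * radialFT η s (conicPhase k x θ)‖ ≤
          C / bracket x.1 ^ (n + M) := by
  induction M with
  | zero =>
    intro b η s n F hb hη hs hF
    obtain ⟨C₁, hC₁, h₁⟩ := hF.exists_bound hk hν hD
    obtain ⟨C₂, hC₂, h₂⟩ := hη.exists_bound_radialFT (s := s) (by simpa using hs)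
    obtain ⟨C₃, h₃⟩ := (isCompact_Icc (a := -D) (b := D)).exists_bound_of_continuousOn
      hb.continuous.continuousOn
    refine ⟨|C₃| * C₁ * C₂ * (2 * D), by positivity, fun x hx => ?_⟩
    have hbr := one_le_bracket x.1
    have := intervalIntegral.norm_integral_le_of_norm_le_const (a := -D) (b := D)
      (C := |C₃| * (C₁ / bracket x.1 ^ n) * C₂)
      (f := fun θ => b θ * F x θ * radialFT η s (conicPhase k x θ)) ?_
    · refine this.trans (le_of_eq ?_)
      rw [show D - -D = 2 * D by ring, abs_of_pos (show 0 < 2 * D by linarith), add_zero]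
      ring
    · intro θ hθ
      rw [Set.uIoc_of_le (by linarith)] at hθ
      have hθ' : |θ| ≤ D := abs_le.2 ⟨hθ.1.le, hθ.2⟩
      rw [norm_mul, norm_mul]
      gcongr
      · exact (h₃ θ ⟨hθ.1.le, hθ.2⟩).trans (le_abs_self _)
      · exact h₁ x hx θ hθ'
      · exact h₂ _ (by rw [conicPhase_im]; exact hx.2.1)
  | succ M ih =>
    intro b η s n F hb hη hs hF
    have hs' : s - 1 ≤ M - 2 := by push_cast at hs; linarith
    have hG := hF.mul (ConicAmplitude.angular (k := k))
    obtain ⟨G', hG', hd⟩ := hG.exists_hasDerivAt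
    have hu := hF.mul ((ConicAmplitude.radial (k := k)).add
      (ConicAmplitude.damping.const_mul (-Complex.I)))
    obtain ⟨C₁, hC₁, h₁⟩ := ih hb (hη.shift s) hs' hu
    obtain ⟨C₂, hC₂, h₂⟩ := ih hb.deriv hη hs' hG
    obtain ⟨C₃, hC₃, h₃⟩ := ih hb hη hs' hG'
    refine ⟨C₁ + (C₂ + C₃), by positivity, fun x hx => ?_⟩
    rw [integral_by_parts hD0 hb hη s hF hG' hd hx.2.1
      fun θ hθ => (gradSq_pos hk hν hD hx hθ).ne']
    refine (norm_add_le _ _).trans ?_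
    rw [norm_mul, norm_mul, Complex.norm_I, one_mul, one_mul, show n + (M + 1) = n + 1 + M by ring,
      add_div, add_div]
    exact add_le_add (h₁ x hx) ((norm_add_le _ _).trans (add_le_add (h₂ x hx) (h₃ x hx)))

/-- Non-stationary phase: rapid decay in `ξ`, uniformly in the regularization. -/
lemma exists_conicFT_bound (hk : 0 < k) (hν : 0 < ν) (hD0 : 0 < D) (hD : k * D ≤ ν / 2)
    (hb : AngularBump D b) (hη : RadialCutoff η) (s : ℝ) (N : ℕ) :
    ∃ C, 0 ≤ C ∧ ∀ x ∈ conicRegion k ν, ‖conicFT k D b η s x‖ ≤ C / bracket x.1 ^ N := by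
  obtain ⟨M, hM⟩ := exists_nat_ge (s + 2)
  obtain ⟨C, hC, h⟩ := exists_amplitude_bound hk hν hD0 hD (N + M) hb hη (s := s)
    (by push_cast; have : (0 : ℝ) ≤ N := N.cast_nonneg; linarith) (ConicAmplitude.const (k := k) 1)
  refine ⟨C, hC, fun x hx => ?_⟩
  have h1 := h x hx
  simp only [mul_one] at h1
  refine h1.trans ?_
  have hbr := one_le_bracket x.1
  gcongr
  omega

end

lemma RadialCutoff.exists_bound_radialFT_of_le {η : ℝ → ℂ} (hη : RadialCutoff η) (s : ℝ) {c : ℝ}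
    (hc : 0 < c) : ∃ C, ∀ z : ℂ, c ≤ z.im → ‖radialFT η s z‖ ≤ C := by
  obtain ⟨C, hC0, hC⟩ := hη.exists_bound
  refine ⟨∫ r in Set.Ioi (0 : ℝ), C * (r ^ (max s 0) * Real.exp (-(c * r))), fun z hz => ?_⟩
  refine norm_integral_le_of_norm_le (integrableOn_rpow_mul_exp (by simp) hc C) ?_
  filter_upwards [ae_restrict_mem measurableSet_Ioi] with r hr
  exact hη.norm_integrand_le hC hC0 hr (le_max_left _ _) hz

/-- The differential of the conic phase in `(ξ, σ)`. -/
def conicPhaseDifferential (θ : ℝ) : (ℝ × ℝ) × ℝ →L[ℝ] ℂ :=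
  (-(Real.cos θ : ℂ)) • Complex.ofRealCLM.comp
      ((ContinuousLinearMap.fst ℝ ℝ ℝ).comp (ContinuousLinearMap.fst ℝ (ℝ × ℝ) ℝ)) +
    (-(Real.sin θ : ℂ)) • Complex.ofRealCLM.comp
      ((ContinuousLinearMap.snd ℝ ℝ ℝ).comp (ContinuousLinearMap.fst ℝ (ℝ × ℝ) ℝ)) +
    Complex.I • Complex.ofRealCLM.comp (ContinuousLinearMap.snd ℝ (ℝ × ℝ) ℝ)

lemma continuous_conicPhaseDifferential : Continuous conicPhaseDifferential := by
  unfold conicPhaseDifferential; fun_prop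

lemma hasFDerivAt_conicPhase (k θ : ℝ) (x : (ℝ × ℝ) × ℝ) :
    HasFDerivAt (fun y => conicPhase k y θ) (conicPhaseDifferential θ) x := by
  have h : (fun y => conicPhase k y θ) = fun y => (k : ℂ) + conicPhaseDifferential θ y := by
    ext y
    simp [conicPhase, conicPhaseRe, conicPhaseDifferential]
    ring
  rw [h]
  exact (conicPhaseDifferential θ).hasFDerivAt.const_add _

section

variable {k ν D : ℝ} {b η : ℝ → ℂ}

lemma hasFDerivAt_conicFT (hb : AngularBump D b) (hη : RadialCutoff η) (s : ℝ)
    {x : (ℝ × ℝ) × ℝ} (hx : 0 < x.2) :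
    HasFDerivAt (conicFT k D b η s)
      (∫ θ in (-D)..D, (b θ * (Complex.I * radialFT η (s + 1) (conicPhase k x θ))) •
        conicPhaseDifferential θ) x := by
  obtain ⟨C₁, h₁⟩ := hη.exists_bound_radialFT_of_le (s + 1) (half_pos hx)
  obtain ⟨C₂, h₂⟩ := (isCompact_uIcc (a := -D) (b := D)).exists_bound_of_continuousOn
    hb.continuous.continuousOn
  obtain ⟨C₃, h₃⟩ := (isCompact_uIcc (a := -D) (b := D)).exists_bound_of_continuousOn
    continuous_conicPhaseDifferential.continuousOn
  have hs : {y : (ℝ × ℝ) × ℝ | x.2 / 2 < y.2} ∈ 𝓝 x :=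
    (isOpen_lt continuous_const continuous_snd).mem_nhds (by simpa using hx)
  have hcont : ∀ y : (ℝ × ℝ) × ℝ, 0 < y.2 →
      Continuous fun θ => b θ * radialFT η s (conicPhase k y θ) := fun y hy =>
    hb.continuous.mul (hη.continuous_radialFT_conicPhase s hy)
  have hcont' : Continuous fun θ =>
      (b θ * (Complex.I * radialFT η (s + 1) (conicPhase k x θ))) • conicPhaseDifferential θ :=
    (hb.continuous.mul (continuous_const.mul (hη.continuous_radialFT_conicPhase (s + 1) hx))).smul
      continuous_conicPhaseDifferential
  refine intervalIntegral.hasFDerivAt_integral_of_dominated_of_fderiv_le (𝕜 := ℝ)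
    (F := fun y θ => b θ * radialFT η s (conicPhase k y θ))
    (F' := fun y θ => (b θ * (Complex.I * radialFT η (s + 1) (conicPhase k y θ))) •
      conicPhaseDifferential θ) (bound := fun _ => |C₂| * C₁ * C₃) hs ?_
    ((hcont x hx).intervalIntegrable _ _) hcont'.aestronglyMeasurable ?_
    intervalIntegrable_const ?_
  · filter_upwards [hs] with y hy
    exact (hcont y ((half_pos hx).trans hy)).aestronglyMeasurable
  · refine Eventually.of_forall fun θ hθ y hy => ?_
    have hθ' := Set.uIoc_subset_uIcc hθ
    have hH := h₁ (conicPhase k y θ) (by rw [conicPhase_im]; exact le_of_lt hy)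
    rw [norm_smul, norm_mul, norm_mul, Complex.norm_I, one_mul]
    have := (norm_nonneg _).trans hH
    gcongr
    · exact (h₂ θ hθ').trans (le_abs_self _)
    · exact h₃ θ hθ'
  · refine Eventually.of_forall fun θ _ y hy => ?_
    have h1 := (hη.hasDerivAt_radialFT s (z := conicPhase k y θ)
      (by rw [conicPhase_im]; exact (half_pos hx).trans hy)).complexToReal_fderiv
    have h2 := (h1.comp y (hasFDerivAt_conicPhase k θ y)).const_mul (b θ)
    refine h2.congr_fderiv ?_
    ext <;> simp [mul_assoc]

lemma AngularBump.cos (hb : AngularBump D b) :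
    AngularBump D fun θ => b θ * (-Complex.I * (Real.cos θ : ℂ)) :=
  hb.mul (contDiff_const.mul (Complex.ofRealCLM.contDiff.comp Real.contDiff_cos))

lemma AngularBump.sin (hb : AngularBump D b) :
    AngularBump D fun θ => b θ * (-Complex.I * (Real.sin θ : ℂ)) :=
  hb.mul (contDiff_const.mul (Complex.ofRealCLM.contDiff.comp Real.contDiff_sin))

lemma AngularBump.neg (hb : AngularBump D b) : AngularBump D fun θ => b θ * (-1) :=
  hb.mul contDiff_const

lemma integral_conicFT_fderiv (hb : AngularBump D b) (hη : RadialCutoff η) (s : ℝ)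
    {x : (ℝ × ℝ) × ℝ} (hx : 0 < x.2) :
    (∫ θ in (-D)..D, (b θ * (Complex.I * radialFT η (s + 1) (conicPhase k x θ))) •
        conicPhaseDifferential θ) =
      conicFT k D (fun θ => b θ * (-Complex.I * (Real.cos θ : ℂ))) η (s + 1) x •
        Complex.ofRealCLM.comp
          ((ContinuousLinearMap.fst ℝ ℝ ℝ).comp (ContinuousLinearMap.fst ℝ (ℝ × ℝ) ℝ)) +
      conicFT k D (fun θ => b θ * (-Complex.I * (Real.sin θ : ℂ))) η (s + 1) x •
        Complex.ofRealCLM.comp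
          ((ContinuousLinearMap.snd ℝ ℝ ℝ).comp (ContinuousLinearMap.fst ℝ (ℝ × ℝ) ℝ)) +
      conicFT k D (fun θ => b θ * (-1)) η (s + 1) x •
        Complex.ofRealCLM.comp (ContinuousLinearMap.snd ℝ (ℝ × ℝ) ℝ) := by
  have hH := hη.continuous_radialFT_conicPhase (k := k) (s + 1) hx
  have hi : ∀ {c : ℝ → ℂ}, AngularBump D c → ∀ L : (ℝ × ℝ) × ℝ →L[ℝ] ℂ, IntervalIntegrable
      (fun θ => (c θ * radialFT η (s + 1) (conicPhase k x θ)) • L) volume (-D) D := fun hc L =>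
    ((hc.continuous.mul hH).smul continuous_const).intervalIntegrable _ _
  have he : ∀ (c : ℝ → ℂ) (L : (ℝ × ℝ) × ℝ →L[ℝ] ℂ), conicFT k D c η (s + 1) x • L =
      ∫ θ in (-D)..D, (c θ * radialFT η (s + 1) (conicPhase k x θ)) • L := fun c L =>
    (intervalIntegral.integral_smul_const (𝕜 := ℂ) _ L).symm
  rw [he, he, he, ← intervalIntegral.integral_add (hi hb.cos _) (hi hb.sin _),
    ← intervalIntegral.integral_add ((hi hb.cos _).add (hi hb.sin _)) (hi hb.neg _)]
  refine intervalIntegral.integral_congr fun θ _ => ?_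
  simp only [conicPhaseDifferential, smul_add, smul_smul]
  congr 2
  · congr 1; ring
  · congr 1; ring
  · linear_combination b θ * radialFT η (s + 1) (conicPhase k x θ) * Complex.I_sq

lemma hasDerivAt_conicFT_damping (hb : AngularBump D b) (hη : RadialCutoff η) (s : ℝ)
    (ξ : ℝ × ℝ) {σ : ℝ} (hσ : 0 < σ) :
    HasDerivAt (fun σ => conicFT k D b η s (ξ, σ))
      (conicFT k D (fun θ => b θ * (-1)) η (s + 1) (ξ, σ)) σ := by
  have h := hasFDerivAt_conicFT (k := k) hb hη s (x := (ξ, σ)) hσ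
  rw [integral_conicFT_fderiv hb hη s (x := (ξ, σ)) hσ] at h
  have h2 := h.comp_hasDerivAt σ ((hasDerivAt_const σ ξ).prodMk (hasDerivAt_id σ))
  exact h2.congr_deriv (by simp)

/-- The differential in `ξ` assembled from two partial derivatives. -/
def pairCLM (u v : ℂ) : ℝ × ℝ →L[ℝ] ℂ :=
  u • Complex.ofRealCLM.comp (ContinuousLinearMap.fst ℝ ℝ ℝ) +
    v • Complex.ofRealCLM.comp (ContinuousLinearMap.snd ℝ ℝ ℝ)

lemma pairCLM_apply (u v : ℂ) (y : ℝ × ℝ) : pairCLM u v y = u * y.1 + v * y.2 := by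
  simp [pairCLM]

lemma hasFDerivAt_conicFT_frequency (hb : AngularBump D b) (hη : RadialCutoff η) (s : ℝ)
    (ξ : ℝ × ℝ) {σ : ℝ} (hσ : 0 < σ) :
    HasFDerivAt (fun ξ => conicFT k D b η s (ξ, σ))
      (pairCLM (conicFT k D (fun θ => b θ * (-Complex.I * (Real.cos θ : ℂ))) η (s + 1) (ξ, σ))
        (conicFT k D (fun θ => b θ * (-Complex.I * (Real.sin θ : ℂ))) η (s + 1) (ξ, σ))) ξ := by
  have h := hasFDerivAt_conicFT (k := k) hb hη s (x := (ξ, σ)) hσ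
  rw [integral_conicFT_fderiv hb hη s (x := (ξ, σ)) hσ] at h
  have h2 := HasFDerivAt.comp (g := conicFT k D b η s) (f := fun ξ => (ξ, σ)) ξ h
    (hasFDerivAt_prodMk_left (𝕜 := ℝ) ξ σ)
  refine h2.congr_fderiv ?_
  ext <;> simp [pairCLM]

/-- The conic Fourier transform, as the limit of its regularizations. -/
def conicFTLim (k D : ℝ) (b η : ℝ → ℂ) (s : ℝ) (ξ : ℝ × ℝ) : ℂ :=
  limUnder (𝓝[>] (0 : ℝ)) fun σ => conicFT k D b η s (ξ, σ)

lemma exists_lipschitz_conicFT (hk : 0 < k) (hν : 0 < ν) (hD0 : 0 < D) (hD : k * D ≤ ν / 2)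
    (hb : AngularBump D b) (hη : RadialCutoff η) (s : ℝ) :
    ∃ C, 0 ≤ C ∧ ∀ ξ : ℝ × ℝ, ν ≤ Real.sqrt ((ξ.1 - k) ^ 2 + ξ.2 ^ 2) →
      ∀ σ ∈ Set.Ioc (0 : ℝ) 1, ∀ τ ∈ Set.Ioc (0 : ℝ) 1,
        ‖conicFT k D b η s (ξ, σ) - conicFT k D b η s (ξ, τ)‖ ≤ C * |σ - τ| := by
  obtain ⟨C, hC, h⟩ := exists_conicFT_bound hk hν hD0 hD hb.neg hη (s + 1) 0
  refine ⟨C, hC, fun ξ hξ σ hσ τ hτ => ?_⟩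
  have := (convex_Ioc (0 : ℝ) 1).norm_image_sub_le_of_norm_hasDerivWithin_le (C := C)
    (fun t ht => (hasDerivAt_conicFT_damping (k := k) hb hη s ξ ht.1).hasDerivWithinAt)
    (fun t ht => by simpa using h (ξ, t) ⟨hξ, ht.1, ht.2⟩) hτ hσ
  simpa using this

lemma tendsto_conicFTLim (hk : 0 < k) (hν : 0 < ν) (hD0 : 0 < D) (hD : k * D ≤ ν / 2)
    (hb : AngularBump D b) (hη : RadialCutoff η) (s : ℝ) {ξ : ℝ × ℝ}
    (hξ : ν ≤ Real.sqrt ((ξ.1 - k) ^ 2 + ξ.2 ^ 2)) :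
    Tendsto (fun σ => conicFT k D b η s (ξ, σ)) (𝓝[>] 0) (𝓝 (conicFTLim k D b η s ξ)) := by
  obtain ⟨C, hC, h⟩ := exists_lipschitz_conicFT hk hν hD0 hD hb hη s
  have hL : LipschitzOnWith ⟨C, hC⟩ (fun σ => conicFT k D b η s (ξ, σ)) (Set.Ioc (0 : ℝ) 1) :=
    LipschitzOnWith.of_dist_le_mul fun σ hσ τ hτ => by
      rw [dist_eq_norm, Real.dist_eq]; exact h ξ hξ σ hσ τ hτ
  have hle : 𝓝[>] (0 : ℝ) ≤ 𝓟 (Set.Ioc 0 1) :=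
    le_principal_iff.2 (Ioc_mem_nhdsGT zero_lt_one)
  have hcauchy := (cauchy_nhds (a := (0 : ℝ)).mono nhdsWithin_le_nhds).map_of_le
    hL.uniformContinuousOn hle
  exact tendsto_nhds_limUnder (CompleteSpace.complete hcauchy)

lemma exists_conicFTLim_approx (hk : 0 < k) (hν : 0 < ν) (hD0 : 0 < D) (hD : k * D ≤ ν / 2)
    (hb : AngularBump D b) (hη : RadialCutoff η) (s : ℝ) :
    ∃ C, 0 ≤ C ∧ ∀ ξ : ℝ × ℝ, ν ≤ Real.sqrt ((ξ.1 - k) ^ 2 + ξ.2 ^ 2) →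
      ∀ σ ∈ Set.Ioc (0 : ℝ) 1,
        ‖conicFT k D b η s (ξ, σ) - conicFTLim k D b η s ξ‖ ≤ C * σ := by
  obtain ⟨C, hC, h⟩ := exists_lipschitz_conicFT hk hν hD0 hD hb hη s
  refine ⟨C, hC, fun ξ hξ σ hσ => ?_⟩
  have ht := ((tendsto_conicFTLim hk hν hD0 hD hb hη s hξ).const_sub
    (conicFT k D b η s (ξ, σ))).norm
  refine le_of_tendsto ht ?_
  filter_upwards [Ioc_mem_nhdsGT hσ.1] with τ hτ
  refine (h ξ hξ σ hσ τ ⟨hτ.1, hτ.2.trans hσ.2⟩).trans ?_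
  gcongr
  rw [abs_of_nonneg (by linarith [hτ.2])]
  linarith [hτ.1]

lemma exists_conicFTLim_bound (hk : 0 < k) (hν : 0 < ν) (hD0 : 0 < D) (hD : k * D ≤ ν / 2)
    (hb : AngularBump D b) (hη : RadialCutoff η) (s : ℝ) (N : ℕ) :
    ∃ C, 0 ≤ C ∧ ∀ ξ : ℝ × ℝ, ν ≤ Real.sqrt ((ξ.1 - k) ^ 2 + ξ.2 ^ 2) →
      ‖conicFTLim k D b η s ξ‖ ≤ C / bracket ξ ^ N := by
  obtain ⟨C, hC, h⟩ := exists_conicFT_bound hk hν hD0 hD hb hη s N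
  refine ⟨C, hC, fun ξ hξ => ?_⟩
  refine le_of_tendsto (tendsto_conicFTLim hk hν hD0 hD hb hη s hξ).norm ?_
  filter_upwards [Ioc_mem_nhdsGT zero_lt_one] with σ hσ
  exact h (ξ, σ) ⟨hξ, hσ.1, hσ.2⟩

/-- The exterior of the ball of radius `ν` around `(k, 0)`. -/
def conicExterior (k ν : ℝ) : Set (ℝ × ℝ) := {ξ | ν < Real.sqrt ((ξ.1 - k) ^ 2 + ξ.2 ^ 2)}

lemma isOpen_conicExterior (k ν : ℝ) : IsOpen (conicExterior k ν) :=
  isOpen_lt continuous_const (by fun_prop)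

lemma hasFDerivAt_conicFTLim (hk : 0 < k) (hν : 0 < ν) (hD0 : 0 < D) (hD : k * D ≤ ν / 2)
    (hb : AngularBump D b) (hη : RadialCutoff η) (s : ℝ) {ξ : ℝ × ℝ}
    (hξ : ξ ∈ conicExterior k ν) :
    HasFDerivAt (conicFTLim k D b η s)
      (pairCLM (conicFTLim k D (fun θ => b θ * (-Complex.I * (Real.cos θ : ℂ))) η (s + 1) ξ)
        (conicFTLim k D (fun θ => b θ * (-Complex.I * (Real.sin θ : ℂ))) η (s + 1) ξ)) ξ := by
  set σ : ℕ → ℝ := fun n => 1 / ((n : ℝ) + 1) with hσ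
  have hσ0 : Tendsto σ atTop (𝓝 0) := tendsto_one_div_add_atTop_nhds_zero_nat
  have hσm : ∀ n, σ n ∈ Set.Ioc (0 : ℝ) 1 := fun n =>
    ⟨Nat.one_div_pos_of_nat, by
      rw [hσ]; dsimp only; rw [div_le_one (by positivity)]
      linarith [(n.cast_nonneg : (0 : ℝ) ≤ n)]⟩
  have hσ0' : Tendsto σ atTop (𝓝[>] 0) :=
    tendsto_nhdsWithin_iff.2 ⟨hσ0, Eventually.of_forall fun n => (hσm n).1⟩
  have unif : ∀ {c : ℝ → ℂ}, AngularBump D c → TendstoUniformlyOn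
      (fun n ξ => conicFT k D c η (s + 1) (ξ, σ n)) (conicFTLim k D c η (s + 1)) atTop
      (conicExterior k ν) := by
    intro c hc
    obtain ⟨C, hC, h⟩ := exists_conicFTLim_approx hk hν hD0 hD hc hη (s + 1)
    rw [Metric.tendstoUniformlyOn_iff]
    intro ε hε
    have : Tendsto (fun n => C * σ n) atTop (𝓝 0) := by simpa using hσ0.const_mul C
    filter_upwards [this.eventually_lt_const hε] with n hn ξ hξ
    rw [dist_comm, dist_eq_norm]
    exact (h ξ (le_of_lt hξ) (σ n) (hσm n)).trans_lt hn
  have uc : ∀ L : ℝ × ℝ →L[ℝ] ℂ, UniformContinuous fun c : ℂ => c • L := fun L =>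
    ((ContinuousLinearMap.toSpanSingleton ℂ L).uniformContinuous)
  have hU := ((uc (Complex.ofRealCLM.comp (ContinuousLinearMap.fst ℝ ℝ ℝ))).comp_tendstoUniformlyOn
    (unif hb.cos)).add
    ((uc (Complex.ofRealCLM.comp (ContinuousLinearMap.snd ℝ ℝ ℝ))).comp_tendstoUniformlyOn
    (unif hb.sin))
  exact hasFDerivAt_of_tendstoUniformlyOn (isOpen_conicExterior k ν) hU
    (fun n ξ _ => hasFDerivAt_conicFT_frequency hb hη s ξ (hσm n).1)
    (fun ξ hξ => (tendsto_conicFTLim hk hν hD0 hD hb hη s (le_of_lt hξ)).comp hσ0') hξ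

lemma contDiffOn_conicFTLim (hk : 0 < k) (hν : 0 < ν) (hD0 : 0 < D) (hD : k * D ≤ ν / 2)
    (hb : AngularBump D b) (hη : RadialCutoff η) (s : ℝ) :
    ContDiffOn ℝ (⊤ : ℕ∞) (conicFTLim k D b η s) (conicExterior k ν) := by
  refine contDiffOn_infty.2 fun n => ?_
  induction n generalizing b s with
  | zero =>
    refine contDiffOn_zero.2 fun ξ hξ => ?_
    exact (hasFDerivAt_conicFTLim hk hν hD0 hD hb hη s hξ).continuousAt.continuousWithinAt
  | succ n ih =>
    rw [Nat.cast_add, Nat.cast_one, contDiffOn_succ_iff_fderiv_of_isOpen (isOpen_conicExterior k ν)]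
    refine ⟨fun ξ hξ => (hasFDerivAt_conicFTLim hk hν hD0 hD hb hη s
      hξ).differentiableAt.differentiableWithinAt, by simp, ?_⟩
    refine ContDiffOn.congr ?_ fun ξ hξ => (hasFDerivAt_conicFTLim hk hν hD0 hD hb hη s hξ).fderiv
    exact ((ih hb.cos (s + 1)).smul contDiffOn_const).add
      ((ih hb.sin (s + 1)).smul contDiffOn_const)

end

/-- Smooth cutoffs that are constant on `(-∞, ε]` and vanish on `[2ε, ∞)`. -/
structure FrequencyCutoff (ε : ℝ) (χ : ℝ → ℂ) : Prop where
  contDiff : ContDiff ℝ (⊤ : ℕ∞) χ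
  eq_const : ∃ c, ∀ t ≤ ε, χ t = c
  eq_zero : ∀ t, 2 * ε ≤ t → χ t = 0

namespace FrequencyCutoff

variable {ε : ℝ} {χ : ℝ → ℂ}

lemma hasDerivAt (hχ : FrequencyCutoff ε χ) (t : ℝ) : HasDerivAt χ (_root_.deriv χ t) t :=
  (hχ.contDiff.differentiable (by simp) t).hasDerivAt

lemma deriv (hχ : FrequencyCutoff ε χ) : FrequencyCutoff ε (_root_.deriv χ) where
  contDiff := (contDiff_infty_iff_deriv.1 hχ.contDiff).2
  eq_const := by
    obtain ⟨c, hc⟩ := hχ.eq_const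
    refine ⟨0, fun t ht => (uniqueDiffWithinAt_Iic t).eq_deriv _
      (hχ.hasDerivAt t).hasDerivWithinAt ?_⟩
    exact (hasDerivWithinAt_const t _ c).congr (fun u hu => hc u (le_trans hu ht)) (hc t ht)
  eq_zero t ht := (uniqueDiffWithinAt_Ici t).eq_deriv _ (hχ.hasDerivAt t).hasDerivWithinAt
    ((hasDerivWithinAt_const t _ 0).congr (fun u hu => hχ.eq_zero u (le_trans ht hu))
      (hχ.eq_zero t ht))

lemma exists_bound (hχ : FrequencyCutoff ε χ) : ∃ C, 0 ≤ C ∧ ∀ t, ‖χ t‖ ≤ C := by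
  obtain ⟨c, hc⟩ := hχ.eq_const
  obtain ⟨C, hC⟩ := (isCompact_Icc (a := ε) (b := 2 * ε)).exists_bound_of_continuousOn
    hχ.contDiff.continuous.continuousOn
  refine ⟨max ‖c‖ C, le_max_of_le_left (norm_nonneg c), fun t => ?_⟩
  rcases le_total t ε with h | h
  · rw [hc t h]; exact le_max_left _ _
  · rcases le_total t (2 * ε) with h' | h'
    · exact (hC t ⟨h, h'⟩).trans (le_max_right _ _)
    · rw [hχ.eq_zero t h', norm_zero]; exact le_max_of_le_left (norm_nonneg c)

end FrequencyCutoff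

/-- The component `⟨ω(t), ξ⟩` of `ξ` along the unit vector `ω(t) = (cos t, sin t)`. -/
def directionCLM (t : ℝ) : ℝ × ℝ →L[ℝ] ℝ :=
  Real.cos t • ContinuousLinearMap.fst ℝ ℝ ℝ + Real.sin t • ContinuousLinearMap.snd ℝ ℝ ℝ

lemma directionCLM_apply (t : ℝ) (ξ : ℝ × ℝ) :
    directionCLM t ξ = Real.cos t * ξ.1 + Real.sin t * ξ.2 := by
  simp [directionCLM]

lemma directionCLM_self (t : ℝ) : directionCLM t (Real.cos t, Real.sin t) = 1 := by
  rw [directionCLM_apply, ← Real.cos_sq_add_sin_sq t]; ring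

/-- The phase factor `e^{i⟨x, ξ⟩}` with `x = r ω(t)`. -/
def planeWave (r t : ℝ) (ξ : ℝ × ℝ) : ℂ := Complex.exp (Complex.I * (r * directionCLM t ξ))

lemma norm_planeWave (r t : ℝ) (ξ : ℝ × ℝ) : ‖planeWave r t ξ‖ = 1 := by
  rw [planeWave, ← Complex.ofReal_mul, mul_comm, Complex.norm_exp_ofReal_mul_I]

lemma continuous_planeWave (r t : ℝ) : Continuous (planeWave r t) := by
  unfold planeWave; fun_prop

lemma hasLineDerivAt_planeWave (r t : ℝ) (ξ : ℝ × ℝ) :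
    HasLineDerivAt ℝ (planeWave r t) (Complex.I * r * planeWave r t ξ) ξ
      (Real.cos t, Real.sin t) := by
  have h1 : HasFDerivAt (fun ξ => (directionCLM t ξ : ℂ))
      (Complex.ofRealCLM.comp (directionCLM t)) ξ :=
    (Complex.ofRealCLM.comp (directionCLM t)).hasFDerivAt
  have h2 := ((h1.const_mul (r : ℂ)).const_mul Complex.I).cexp.hasLineDerivAt
    (Real.cos t, Real.sin t)
  refine HasDerivAt.congr_deriv h2 ?_
  simp [directionCLM_self, planeWave]
  ring

section

variable {k ν ε D t s : ℝ} {χ b η : ℝ → ℂ} {ξ : ℝ × ℝ}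

lemma lt_directionCLM_of_sqrt_le (hk : 0 < k) (hνk : ν ≤ k / 4) (ht : 7 / 8 ≤ Real.cos t)
    (hξ : Real.sqrt ((ξ.1 - k) ^ 2 + ξ.2 ^ 2) ≤ ν) : k / 4 < directionCLM t ξ := by
  have h := Real.abs_le_sqrt (x := Real.cos t * (ξ.1 - k) + Real.sin t * ξ.2)
    (y := (ξ.1 - k) ^ 2 + ξ.2 ^ 2) (by
      have := Real.cos_sq_add_sin_sq t
      have e : (ξ.1 - k) ^ 2 + ξ.2 ^ 2 - (Real.cos t * (ξ.1 - k) + Real.sin t * ξ.2) ^ 2 =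
          (Real.sin t * (ξ.1 - k) - Real.cos t * ξ.2) ^ 2 := by
        linear_combination (-((ξ.1 - k) ^ 2 + ξ.2 ^ 2)) * this
      nlinarith [sq_nonneg (Real.sin t * (ξ.1 - k) - Real.cos t * ξ.2)])
  have h1 := (abs_le.1 (h.trans hξ)).1
  rw [directionCLM_apply]
  nlinarith [mul_le_mul_of_nonneg_left ht hk.le]

lemma mem_conicExterior_of_directionCLM_le (hk : 0 < k) (hνk : ν ≤ k / 4)
    (ht : 7 / 8 ≤ Real.cos t) (hξ : directionCLM t ξ ≤ k / 4) : ξ ∈ conicExterior k ν := by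
  by_contra h
  exact (lt_directionCLM_of_sqrt_le hk hνk ht (not_lt.1 h)).not_ge hξ

lemma hasFDerivAt_cutoff_mul_conicFTLim (hk : 0 < k) (hν : 0 < ν) (hνk : ν ≤ k / 4)
    (hεk : ε ≤ k / 8) (hD0 : 0 < D) (hD : k * D ≤ ν / 2) (hχ : FrequencyCutoff ε χ)
    (hb : AngularBump D b) (hη : RadialCutoff η) (s : ℝ) (ht : 7 / 8 ≤ Real.cos t)
    (ξ : ℝ × ℝ) :
    HasFDerivAt (fun ξ => χ (directionCLM t ξ) * conicFTLim k D b η s ξ)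
      (χ (directionCLM t ξ) •
          pairCLM (conicFTLim k D (fun θ => b θ * (-Complex.I * (Real.cos θ : ℂ))) η (s + 1) ξ)
            (conicFTLim k D (fun θ => b θ * (-Complex.I * (Real.sin θ : ℂ))) η (s + 1) ξ) +
        conicFTLim k D b η s ξ • deriv χ (directionCLM t ξ) •
          Complex.ofRealCLM.comp (directionCLM t)) ξ := by
  rcases le_or_gt (directionCLM t ξ) (k / 4) with h | h
  · have h1 := ((hχ.hasDerivAt (directionCLM t ξ)).hasFDerivAt.comp ξ
      (directionCLM t).hasFDerivAt).mul (hasFDerivAt_conicFTLim hk hν hD0 hD hb hη s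
        (mem_conicExterior_of_directionCLM_le hk hνk ht h))
    refine h1.congr_fderiv ?_
    ext <;> simp [mul_comm]
  · have h2 : 2 * ε ≤ directionCLM t ξ := by linarith
    refine ((hasFDerivAt_const (0 : ℂ) ξ).congr_of_eventuallyEq ?_).congr_fderiv
      (by ext <;> simp [hχ.eq_zero _ h2, hχ.deriv.eq_zero _ h2])
    filter_upwards [(directionCLM t).continuous.continuousAt.eventually (lt_mem_nhds h)] with y hy
    rw [hχ.eq_zero _ (by linarith), zero_mul]

lemma exists_bound_cutoff_mul_conicFTLim (hk : 0 < k) (hν : 0 < ν) (hνk : ν ≤ k / 4)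
    (hεk : ε ≤ k / 8) (hD0 : 0 < D) (hD : k * D ≤ ν / 2) (hχ : FrequencyCutoff ε χ)
    (hb : AngularBump D b) (hη : RadialCutoff η) (s : ℝ) :
    ∃ C, 0 ≤ C ∧ ∀ t, 7 / 8 ≤ Real.cos t → ∀ ξ,
      ‖χ (directionCLM t ξ) * conicFTLim k D b η s ξ‖ ≤ C * (1 + ‖ξ‖) ^ (-3 : ℝ) := by
  obtain ⟨C₁, hC₁, h₁⟩ := hχ.exists_bound
  obtain ⟨C₂, hC₂, h₂⟩ := exists_conicFTLim_bound hk hν hD0 hD hb hη s 3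
  refine ⟨C₁ * C₂, by positivity, fun t ht ξ => ?_⟩
  rcases le_or_gt (directionCLM t ξ) (k / 4) with h | h
  · have hle : 1 + ‖ξ‖ ≤ bracket ξ := by
      refine add_le_add_right (max_le ?_ ?_) 1
      · exact Real.abs_le_sqrt (by nlinarith [sq_nonneg ξ.2])
      · exact Real.abs_le_sqrt (by nlinarith [sq_nonneg ξ.1])
    have h0 : 0 < 1 + ‖ξ‖ := by positivity
    calc ‖χ (directionCLM t ξ) * conicFTLim k D b η s ξ‖
        ≤ C₁ * (C₂ / bracket ξ ^ 3) := by
          rw [norm_mul]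
          exact mul_le_mul (h₁ _) (h₂ ξ
            (le_of_lt (mem_conicExterior_of_directionCLM_le hk hνk ht h))) (norm_nonneg _) hC₁
      _ ≤ C₁ * (C₂ / (1 + ‖ξ‖) ^ 3) := by gcongr
      _ = C₁ * C₂ * (1 + ‖ξ‖) ^ (-3 : ℝ) := by
          rw [Real.rpow_neg h0.le, show (3 : ℝ) = ((3 : ℕ) : ℝ) by norm_num, Real.rpow_natCast]
          ring
  · rw [hχ.eq_zero _ (by linarith), zero_mul, norm_zero]
    positivity

lemma integrable_one_add_norm_rpow :
    Integrable (fun ξ : ℝ × ℝ => (1 + ‖ξ‖) ^ (-3 : ℝ)) :=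
  integrable_one_add_norm (by simp; norm_num)

lemma integrable_cutoff_mul_conicFTLim (hk : 0 < k) (hν : 0 < ν) (hνk : ν ≤ k / 4)
    (hεk : ε ≤ k / 8) (hD0 : 0 < D) (hD : k * D ≤ ν / 2) (hχ : FrequencyCutoff ε χ)
    (hb : AngularBump D b) (hη : RadialCutoff η) (s : ℝ) (ht : 7 / 8 ≤ Real.cos t) (r : ℝ) :
    Integrable fun ξ => χ (directionCLM t ξ) * conicFTLim k D b η s ξ * planeWave r t ξ := by
  obtain ⟨C, -, hC⟩ := exists_bound_cutoff_mul_conicFTLim hk hν hνk hεk hD0 hD hχ hb hη s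
  have hc : Continuous fun ξ => χ (directionCLM t ξ) * conicFTLim k D b η s ξ :=
    continuous_iff_continuousAt.2 fun ξ =>
      (hasFDerivAt_cutoff_mul_conicFTLim hk hν hνk hεk hD0 hD hχ hb hη s ht ξ).continuousAt
  refine (integrable_one_add_norm_rpow.const_mul C).mono'
    (hc.mul (continuous_planeWave r t)).aestronglyMeasurable (Eventually.of_forall fun ξ => ?_)
  rw [norm_mul, norm_planeWave, mul_one]
  exact hC t ht ξ

/-- The cut-off inverse Fourier integral of the conic Fourier transform at `x = r ω(t)`. -/
def cutoffInverseFT (k D : ℝ) (χ b η : ℝ → ℂ) (s r t : ℝ) : ℂ :=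
  ∫ ξ, χ (directionCLM t ξ) * conicFTLim k D b η s ξ * planeWave r t ξ

lemma mul_cutoffInverseFT (hk : 0 < k) (hν : 0 < ν) (hνk : ν ≤ k / 4)
    (hεk : ε ≤ k / 8) (hD0 : 0 < D) (hD : k * D ≤ ν / 2) (hχ : FrequencyCutoff ε χ)
    (hb : AngularBump D b) (hη : RadialCutoff η) (s : ℝ) (ht : 7 / 8 ≤ Real.cos t) (r : ℝ) :
    Complex.I * r * cutoffInverseFT k D χ b η s r t =
      -(cutoffInverseFT k D (deriv χ) b η s r t +
        Real.cos t * cutoffInverseFT k D χ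
          (fun θ => b θ * (-Complex.I * (Real.cos θ : ℂ))) η (s + 1) r t +
        Real.sin t * cutoffInverseFT k D χ
          (fun θ => b θ * (-Complex.I * (Real.sin θ : ℂ))) η (s + 1) r t) := by
  have hi : ∀ {χ b : ℝ → ℂ}, FrequencyCutoff ε χ → AngularBump D b → ∀ s, Integrable
      fun ξ => χ (directionCLM t ξ) * conicFTLim k D b η s ξ * planeWave r t ξ :=
    fun hχ hb s => integrable_cutoff_mul_conicFTLim hk hν hνk hεk hD0 hD hχ hb hη s ht r
  have h1 := hi hχ.deriv hb s
  have h2 := (hi hχ hb.cos (s + 1)).const_mul (Real.cos t : ℂ)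
  have h3 := (hi hχ hb.sin (s + 1)).const_mul (Real.sin t : ℂ)
  have h0 := (hi hχ hb s).const_mul (Complex.I * r)
  have hsum := integral_add (h1.add h2) h3
  rw [integral_add' h1 h2, integral_const_mul, integral_const_mul] at hsum
  unfold cutoffInverseFT
  rw [← hsum, ← integral_const_mul]
  have hf : ∀ ξ, HasLineDerivAt ℝ (fun ξ => χ (directionCLM t ξ) * conicFTLim k D b η s ξ)
      (deriv χ (directionCLM t ξ) * conicFTLim k D b η s ξ +
        Real.cos t * (χ (directionCLM t ξ) *
          conicFTLim k D (fun θ => b θ * (-Complex.I * (Real.cos θ : ℂ))) η (s + 1) ξ) +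
        Real.sin t * (χ (directionCLM t ξ) *
          conicFTLim k D (fun θ => b θ * (-Complex.I * (Real.sin θ : ℂ))) η (s + 1) ξ)) ξ
      (Real.cos t, Real.sin t) := fun ξ => by
    refine HasDerivAt.congr_deriv ((hasFDerivAt_cutoff_mul_conicFTLim hk hν hνk hεk hD0 hD hχ hb
      hη s ht ξ).hasLineDerivAt (Real.cos t, Real.sin t)) ?_
    simp only [add_apply, smul_apply, pairCLM_apply,
      ContinuousLinearMap.comp_apply, directionCLM_self, smul_eq_mul, Complex.ofRealCLM_apply,
      Complex.ofReal_one]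
    ring
  have key := integral_bilinear_hasLineDerivAt_right_eq_neg_left_of_integrable (μ := volume)
    (B := ContinuousLinearMap.mul ℝ ℂ) (g := planeWave r t)
    (((h1.add h2).add h3).congr (Eventually.of_forall fun ξ => ?_))
    (h0.congr (Eventually.of_forall fun ξ => ?_)) (hi hχ hb s) (fun ξ _ => hf ξ)
    (fun ξ _ => hasLineDerivAt_planeWave r t ξ)
  · refine Eq.trans ?_ (key.trans (congrArg Neg.neg ?_))
    · refine integral_congr_ae (Eventually.of_forall fun ξ => ?_)
      simp only [ContinuousLinearMap.mul_apply']
      ring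
    · refine integral_congr_ae (Eventually.of_forall fun ξ => ?_)
      simp only [ContinuousLinearMap.mul_apply', Pi.add_apply]
      ring
  · simp only [ContinuousLinearMap.mul_apply', Pi.add_apply]
    ring
  · simp only [ContinuousLinearMap.mul_apply']
    ring

lemma exists_cutoffInverseFT_bound (hk : 0 < k) (hν : 0 < ν) (hνk : ν ≤ k / 4)
    (hεk : ε ≤ k / 8) (hD0 : 0 < D) (hD : k * D ≤ ν / 2) (hχ : FrequencyCutoff ε χ)
    (hb : AngularBump D b) (hη : RadialCutoff η) (s : ℝ) (N : ℕ) :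
    ∃ C, ∀ r t, 0 < r → 7 / 8 ≤ Real.cos t →
      ‖cutoffInverseFT k D χ b η s r t‖ ≤ C / r ^ N := by
  induction N generalizing χ b s with
  | zero =>
    obtain ⟨C, -, hC⟩ := exists_bound_cutoff_mul_conicFTLim hk hν hνk hεk hD0 hD hχ hb hη s
    refine ⟨∫ ξ : ℝ × ℝ, C * (1 + ‖ξ‖) ^ (-3 : ℝ), fun r t _ ht => ?_⟩
    rw [pow_zero, div_one]
    refine norm_integral_le_of_norm_le (integrable_one_add_norm_rpow.const_mul C)
      (Eventually.of_forall fun ξ => ?_)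
    rw [norm_mul, norm_planeWave, mul_one]
    exact hC t ht ξ
  | succ N ih =>
    obtain ⟨C₁, h₁⟩ := ih hχ.deriv hb s
    obtain ⟨C₂, h₂⟩ := ih hχ hb.cos (s + 1)
    obtain ⟨C₃, h₃⟩ := ih hχ hb.sin (s + 1)
    refine ⟨C₁ + C₂ + C₃, fun r t hr ht => ?_⟩
    have h := congrArg norm (mul_cutoffInverseFT hk hν hνk hεk hD0 hD hχ hb hη s ht r)
    rw [norm_mul, norm_mul, Complex.norm_I, one_mul, Complex.norm_real, Real.norm_of_nonneg hr.le,
      norm_neg] at h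
    have hc : ‖(Real.cos t : ℂ)‖ ≤ 1 := by
      rw [Complex.norm_real]; exact Real.abs_cos_le_one t
    have hs : ‖(Real.sin t : ℂ)‖ ≤ 1 := by
      rw [Complex.norm_real]; exact Real.abs_sin_le_one t
    rw [pow_succ, ← div_div, le_div_iff₀ hr, mul_comm, h, add_div, add_div]
    refine (norm_add₃_le).trans (add_le_add_three (h₁ r t hr ht) ?_ ?_)
    · rw [norm_mul]
      exact (mul_le_of_le_one_left (norm_nonneg _) hc).trans (h₂ r t hr ht)
    · rw [norm_mul]
      exact (mul_le_of_le_one_left (norm_nonneg _) hs).trans (h₃ r t hr ht)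

end

lemma sqrt_polar_sq {r : ℝ} (hr : 0 ≤ r) (t : ℝ) :
    Real.sqrt ((r * Real.cos t) ^ 2 + (r * Real.sin t) ^ 2) = r := by
  rw [show (r * Real.cos t) ^ 2 + (r * Real.sin t) ^ 2 = r ^ 2 by
    linear_combination r ^ 2 * Real.cos_sq_add_sin_sq t, Real.sqrt_sq hr]

lemma div_sqrt_polar_eq_directionCLM {r : ℝ} (hr : 0 < r) (t : ℝ) (ξ : ℝ × ℝ) :
    (r * Real.cos t * ξ.1 + r * Real.sin t * ξ.2) /
      Real.sqrt ((r * Real.cos t) ^ 2 + (r * Real.sin t) ^ 2) = directionCLM t ξ := by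
  rw [sqrt_polar_sq hr.le, directionCLM_apply]
  field_simp

lemma exp_eq_planeWave (r t : ℝ) (ξ : ℝ × ℝ) :
    Complex.exp (Complex.I * (r * Real.cos t * ξ.1 + r * Real.sin t * ξ.2)) =
      planeWave r t ξ := by
  rw [planeWave, directionCLM_apply]
  push_cast
  ring_nf

lemma conicRegFT_eq_conicFT {δ D : ℝ} (hδD : δ ≤ D) (k : ℝ) (a : ℝ → ℂ)
    {φδ : ℝ → ℝ} (hφ : Function.support φδ ⊆ Set.Ioo (-δ) δ) (ψ : ℝ → ℝ) (σ ρ φ : ℝ) :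
    conicRegFT k δ a φδ ψ σ ρ φ =
      conicFT k D (fun θ => a θ * φδ θ) (fun r => ψ r) (1 / 2)
        ((ρ * Real.cos φ, ρ * Real.sin φ), σ) := by
  have h : ∀ θ, (∫ r in Set.Ioi (0 : ℝ), a θ * (φδ θ : ℂ) * (ψ r : ℂ) * (Real.sqrt r : ℂ) *
      Complex.exp (Complex.I * r * (k - ρ * Real.cos (θ - φ)) - σ * r)) =
      a θ * φδ θ * radialFT (fun r => ψ r) (1 / 2)
        (conicPhase k ((ρ * Real.cos φ, ρ * Real.sin φ), σ) θ) := by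
    intro θ
    rw [radialFT, ← integral_const_mul]
    refine integral_congr_ae (Eventually.of_forall fun r => ?_)
    simp only [Real.sqrt_eq_rpow, mul_assoc]
    congr 6
    simp only [conicPhase, conicPhaseRe, Real.cos_sub]
    push_cast
    linear_combination (-(r * σ : ℂ)) * Complex.I_sq
  have hs : Function.support (fun θ => a θ * φδ θ * radialFT (fun r => ψ r) (1 / 2)
      (conicPhase k ((ρ * Real.cos φ, ρ * Real.sin φ), σ) θ)) ⊆ Set.Ioo (-δ) δ := fun θ hθ =>
    hφ fun h0 => hθ (by simp [h0])
  unfold conicRegFT conicFT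
  simp only [h]
  rw [intervalIntegral.integral_eq_integral_of_support_subset
      (hs.trans Set.Ioo_subset_Ioc_self),
    intervalIntegral.integral_eq_integral_of_support_subset
      (hs.trans ((Set.Ioo_subset_Ioo (neg_le_neg hδD) hδD).trans Set.Ioo_subset_Ioc_self))]

/-- **The leading outgoing term `a(θ)e^{ikr}/√r` satisfies Isozaki's outgoing radiation
condition.**  Fix `k > 0`, `a` smooth and `2π`-periodic, `0 < ν ≤ k/4`, `0 < ε ≤ k/8` and a
smooth cutoff `χ₋` with `χ₋ = 1` on `(−∞, ε]` and `χ₋ = 0` on `[2ε, ∞)`.  Then there are an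
aperture `δ ∈ (0, π/4)` and `δ′ > 0` such that for all admissible cutoffs `φ_δ`, `ψ₊`, with
`v̂` the conic Fourier transform (smooth and rapidly decreasing on `{|ξ − (k,0)| ≥ ν}`), for
every `x = r(cos θ₀, sin θ₀)` with `r ≥ 1`, `|θ₀| ≤ δ′`: the function `ξ ↦ χ₋(⟨x,ξ⟩/|x|)`
vanishes on the ball `{|ξ − (k,0)| < ν}`, the integral
`A v(x) = ∫ χ₋(⟨x,ξ⟩/|x|) v̂(ξ) e^{i⟨x,ξ⟩} dξ` converges absolutely, and for every `N`,
`|A v(x)| ≤ C_N r^{−N}`. -/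
theorem leading_outgoing_term_satisfies_isozaki
    (k : ℝ) (hk : 0 < k)
    (a : ℝ → ℂ) (ha : ContDiff ℝ (⊤ : ℕ∞) a) (haper : ∀ θ : ℝ, a (θ + 2 * Real.pi) = a θ)
    (ν ε : ℝ) (hν : 0 < ν) (hνk : ν ≤ k / 4) (hε : 0 < ε) (hεk : ε ≤ k / 8)
    (χ : ℝ → ℝ) (hχ : ContDiff ℝ (⊤ : ℕ∞) χ)
    (hχ1 : ∀ t : ℝ, t ≤ ε → χ t = 1) (hχ0 : ∀ t : ℝ, 2 * ε ≤ t → χ t = 0) :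
    ∃ δ δ' : ℝ, 0 < δ ∧ δ < Real.pi / 4 ∧ 0 < δ' ∧
      ∀ φδ : ℝ → ℝ, ContDiff ℝ (⊤ : ℕ∞) φδ → HasCompactSupport φδ →
        Function.support φδ ⊆ Set.Ioo (-δ) δ →
        (∀ t ∈ Set.Ioo (-(δ / 2)) (δ / 2), φδ t = 1) →
      ∀ ψ : ℝ → ℝ, ContDiff ℝ (⊤ : ℕ∞) ψ →
        (∀ r : ℝ, r ≤ 1 → ψ r = 0) → (∀ r : ℝ, 2 ≤ r → ψ r = 1) →
      ∃ vh : ℝ × ℝ → ℂ,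
        (∀ ρ φ : ℝ, 0 ≤ ρ →
          ν ≤ Real.sqrt ((ρ * Real.cos φ - k) ^ 2 + (ρ * Real.sin φ) ^ 2) →
          Tendsto (fun σ : ℝ => conicRegFT k δ a φδ ψ σ ρ φ) (𝓝[>] 0)
            (𝓝 (vh (ρ * Real.cos φ, ρ * Real.sin φ)))) ∧
        ContDiffOn ℝ (⊤ : ℕ∞) vh {ξ : ℝ × ℝ | ν < Real.sqrt ((ξ.1 - k) ^ 2 + ξ.2 ^ 2)} ∧
        (∀ N : ℕ, ∃ C : ℝ, ∀ ξ : ℝ × ℝ, ν ≤ Real.sqrt ((ξ.1 - k) ^ 2 + ξ.2 ^ 2) →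
          ‖vh ξ‖ ≤ C / (1 + Real.sqrt (ξ.1 ^ 2 + ξ.2 ^ 2)) ^ N) ∧
        (∀ r θ₀ : ℝ, 1 ≤ r → |θ₀| ≤ δ' →
          (∀ ξ : ℝ × ℝ, Real.sqrt ((ξ.1 - k) ^ 2 + ξ.2 ^ 2) < ν →
            χ ((r * Real.cos θ₀ * ξ.1 + r * Real.sin θ₀ * ξ.2) /
                Real.sqrt ((r * Real.cos θ₀) ^ 2 + (r * Real.sin θ₀) ^ 2)) = 0) ∧
          Integrable (fun ξ : ℝ × ℝ =>
            (χ ((r * Real.cos θ₀ * ξ.1 + r * Real.sin θ₀ * ξ.2) /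
                Real.sqrt ((r * Real.cos θ₀) ^ 2 + (r * Real.sin θ₀) ^ 2)) : ℂ) *
              vh ξ *
              Complex.exp (Complex.I * (r * Real.cos θ₀ * ξ.1 + r * Real.sin θ₀ * ξ.2)))) ∧
        (∀ N : ℕ, ∃ C : ℝ, ∀ r θ₀ : ℝ, 1 ≤ r → |θ₀| ≤ δ' →
          ‖∫ ξ : ℝ × ℝ,
              (χ ((r * Real.cos θ₀ * ξ.1 + r * Real.sin θ₀ * ξ.2) /
                  Real.sqrt ((r * Real.cos θ₀) ^ 2 + (r * Real.sin θ₀) ^ 2)) : ℂ) *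
                vh ξ *
                Complex.exp (Complex.I * (r * Real.cos θ₀ * ξ.1 + r * Real.sin θ₀ * ξ.2))‖ ≤
            C / r ^ N) := by
  have hD0 : 0 < ν / (2 * k) := by positivity
  have hD : k * (ν / (2 * k)) ≤ ν / 2 := le_of_eq (by field_simp)
  have hδ0 : 0 < ν / (4 * k) := by positivity
  have hδD : ν / (4 * k) < ν / (2 * k) := div_lt_div_of_pos_left hν (by positivity) (by linarith)
  have hδ1 : ν / (4 * k) ≤ 1 / 16 := by
    rw [div_le_iff₀ (by positivity)]; linarith
  refine ⟨ν / (4 * k), 1 / 2, hδ0, by linarith [Real.pi_gt_three], by norm_num, ?_⟩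
  intro φδ hφ _ hφs _ ψ hψ hψ0 hψ1
  have hcos : ∀ θ₀ : ℝ, |θ₀| ≤ 1 / 2 → 7 / 8 ≤ Real.cos θ₀ := fun θ₀ h => by
    have h1 := Real.one_sub_sq_div_two_le_cos (x := θ₀)
    have h2 := sq_le_sq₀ (abs_nonneg θ₀) (by norm_num) |>.2 h
    rw [sq_abs] at h2
    linarith
  have hb : AngularBump (ν / (2 * k)) fun θ => a θ * φδ θ :=
    { contDiff := ha.mul (Complex.ofRealCLM.contDiff.comp hφ)
      tsupport_subset := by
        have hs : Function.support (fun θ => a θ * (φδ θ : ℂ)) ⊆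
            Set.Icc (-(ν / (4 * k))) (ν / (4 * k)) := fun θ hθ =>
          Set.Ioo_subset_Icc_self (hφs fun h0 => hθ (by simp [h0]))
        exact (closure_minimal hs isClosed_Icc).trans
          (Set.Icc_subset_Ioo (neg_lt_neg hδD) hδD) }
  have hη : RadialCutoff fun r => (ψ r : ℂ) :=
    { contDiff := Complex.ofRealCLM.contDiff.comp hψ
      eq_zero := fun r hr => by simp [hψ0 r hr]
      eq_const := ⟨1, fun r hr => by simp [hψ1 r hr]⟩ }
  have hχc : FrequencyCutoff ε fun t => (χ t : ℂ) :=
    { contDiff := Complex.ofRealCLM.contDiff.comp hχ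
      eq_const := ⟨1, fun t ht => by simp [hχ1 t ht]⟩
      eq_zero := fun t ht => by simp [hχ0 t ht] }
  refine ⟨conicFTLim k (ν / (2 * k)) (fun θ => a θ * φδ θ) (fun r => ψ r) (1 / 2),
    fun ρ φ _ h => ?_, contDiffOn_conicFTLim hk hν hD0 hD hb hη _, fun N => ?_,
    fun r θ₀ hr hθ => ⟨fun ξ hξ => ?_, ?_⟩, fun N => ?_⟩
  · simp only [conicRegFT_eq_conicFT hδD.le k a hφs]
    exact tendsto_conicFTLim hk hν hD0 hD hb hη _ h
  · obtain ⟨C, -, hC⟩ := exists_conicFTLim_bound hk hν hD0 hD hb hη (1 / 2) N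
    exact ⟨C, hC⟩
  · rw [div_sqrt_polar_eq_directionCLM (zero_lt_one.trans_le hr)]
    exact hχ0 _ (by linarith [lt_directionCLM_of_sqrt_le hk hνk (hcos θ₀ hθ) hξ.le])
  · simp only [div_sqrt_polar_eq_directionCLM (zero_lt_one.trans_le hr), exp_eq_planeWave]
    exact integrable_cutoff_mul_conicFTLim hk hν hνk hεk hD0 hD hχc hb hη _ (hcos θ₀ hθ) r
  · obtain ⟨C, hC⟩ := exists_cutoffInverseFT_bound hk hν hνk hεk hD0 hD hχc hb hη (1 / 2) N
    refine ⟨C, fun r θ₀ hr hθ => ?_⟩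
    have hr0 := zero_lt_one.trans_le hr
    simp only [div_sqrt_polar_eq_directionCLM hr0, exp_eq_planeWave]
    exact hC r θ₀ hr0 (hcos θ₀ hθ)
end
end

section
/- Let λ > 0, R ∈ ℝ, and let g : ℝ → ℂ be a Schwartz function. Suppose u : ℝ → ℂ is twice continuously differentiable, u″(x) + λ² u(x) = g(x) for all x ∈ ℝ, and u(x) = 0 for all x ≤ R. Then there exist constants a, b ∈ ℂ such that for every N ∈ ℕ there is a constant C_N with | u(x) − a e^{iλx} − b e^{−iλx} | ≤ C_N x^{−N} for all x ≥ max(R, 1). -/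
open Filter Topology

noncomputable section

open MeasureTheory Set

/-- A function whose derivative is dominated by a Schwartz function has a limit at `+∞`, which it
approaches faster than any power. -/
theorem exists_limit_rapidly_of_hasDerivAt_of_norm_le_schwartz (g : SchwartzMap ℝ ℂ)
    {w f : ℝ → ℂ} (hw : ∀ x, HasDerivAt w (f x) x) (hf : Continuous f)
    (hfg : ∀ x, ‖f x‖ ≤ ‖g x‖) :
    ∃ A : ℂ, ∀ N : ℕ, ∃ C : ℝ, ∀ x : ℝ, 0 < x → ‖w x - A‖ ≤ C / x ^ N := by
  have hfi : Integrable f :=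
    g.integrable.norm.mono' hf.aestronglyMeasurable (Eventually.of_forall hfg)
  have hlim : Tendsto w atTop (𝓝 (limUnder atTop w)) :=
    tendsto_limUnder_of_hasDerivAt_of_integrableOn_Ioi (a := 0) (fun x _ ↦ hw x) hfi.integrableOn
  refine ⟨limUnder atTop w, fun N ↦ ⟨∫ t, ‖t‖ ^ N * ‖g t‖, fun x hx ↦ ?_⟩⟩
  have hI : ∫ t in Ioi x, f t = limUnder atTop w - w x :=
    integral_Ioi_of_hasDerivAt_of_tendsto' (fun t _ ↦ hw t) hfi.integrableOn hlim
  have hgi : Integrable fun t ↦ ‖t‖ ^ N * ‖g t‖ := g.integrable_pow_mul volume N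
  rw [norm_sub_rev, ← hI, le_div_iff₀ (by positivity)]
  calc ‖∫ t in Ioi x, f t‖ * x ^ N
      ≤ (∫ t in Ioi x, ‖f t‖) * x ^ N := by gcongr; exact norm_integral_le_integral_norm _
    _ = ∫ t in Ioi x, ‖f t‖ * x ^ N := (integral_mul_const _ _).symm
    _ ≤ ∫ t in Ioi x, ‖t‖ ^ N * ‖g t‖ := by
        refine setIntegral_mono_on (hfi.norm.mul_const _).integrableOn hgi.integrableOn
          measurableSet_Ioi fun t ht ↦ ?_
        rw [mul_comm]
        gcongr
        · exact (le_of_lt ht).trans (Real.le_norm_self t)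
        · exact hfg t
    _ ≤ ∫ t, ‖t‖ ^ N * ‖g t‖ :=
        setIntegral_le_integral hgi (Eventually.of_forall fun t ↦ by positivity)

/-- Factoring `u'' + λ² u = g` as a first-order equation for `u' + iσu` with `σ² = λ²`:
`u' + iσu` is asymptotic to a multiple of `e^{iσx}`. -/
theorem exists_deriv_add_mul_asymptotic (lam s : ℝ) (hs : s ^ 2 = lam ^ 2)
    (g : SchwartzMap ℝ ℂ) (u : ℝ → ℂ) (hu : ContDiff ℝ 2 u)
    (hode : ∀ x : ℝ, deriv (deriv u) x + (lam : ℂ) ^ 2 * u x = g x) :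
    ∃ A : ℂ, ∀ N : ℕ, ∃ C : ℝ, ∀ x : ℝ, 0 < x →
      ‖deriv u x + Complex.I * s * u x - A * Complex.exp (Complex.I * s * x)‖ ≤ C / x ^ N := by
  have hu1 (x : ℝ) : HasDerivAt u (deriv u x) x :=
    (hu.differentiable (by norm_num) x).hasDerivAt
  have hu2 (x : ℝ) : HasDerivAt (deriv u) (deriv (deriv u) x) x :=
    (((contDiff_succ_iff_deriv (n := 1)).1 hu).2.2.differentiable one_ne_zero x).hasDerivAt
  have hnorm (r : ℝ) (x : ℝ) : ‖Complex.exp (Complex.I * r * x)‖ = 1 := by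
    rw [mul_assoc, ← Complex.ofReal_mul, mul_comm, Complex.norm_exp_ofReal_mul_I]
  have he (x : ℝ) : HasDerivAt (fun y : ℝ ↦ Complex.exp (Complex.I * (-s : ℝ) * y))
      (Complex.exp (Complex.I * (-s : ℝ) * x) * (Complex.I * (-s : ℝ))) x := by
    simpa using ((Complex.ofRealCLM.hasDerivAt (x := x)).const_mul
      (Complex.I * (-s : ℝ))).cexp
  have hsc : (s : ℂ) ^ 2 = (lam : ℂ) ^ 2 := by exact_mod_cast hs
  have hw (x : ℝ) : HasDerivAt
      (fun y : ℝ ↦ Complex.exp (Complex.I * (-s : ℝ) * y) * (deriv u y + Complex.I * s * u y))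
      (Complex.exp (Complex.I * (-s : ℝ) * x) * g x) x := by
    refine ((he x).mul ((hu2 x).add ((hu1 x).const_mul (Complex.I * s)))).congr_deriv ?_
    rw [← hode x, ← hsc, Pi.add_apply]
    push_cast
    linear_combination
      -(Complex.exp (Complex.I * -(s : ℂ) * x) * (s : ℂ) ^ 2 * u x) * Complex.I_sq
  obtain ⟨A, hA⟩ := exists_limit_rapidly_of_hasDerivAt_of_norm_le_schwartz g hw
    (by fun_prop) (fun x ↦ by rw [norm_mul, hnorm, one_mul])
  refine ⟨A, fun N ↦ (hA N).imp fun C hC x hx ↦ (le_of_eq ?_).trans (hC x hx)⟩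
  rw [← one_mul ‖_ - A‖, ← hnorm s x, ← norm_mul, mul_sub, ← mul_assoc, ← Complex.exp_add]
  congr 1
  push_cast
  ring_nf
  simp

/-- **Asymptotics of forced one-dimensional Helmholtz solutions vanishing on a half line.**
Let `λ > 0`, `R ∈ ℝ`, `g` Schwartz, and let `u : ℝ → ℂ` be twice continuously differentiable
with `u″ + λ²u = g` on `ℝ` and `u = 0` on `(−∞, R]`.  Then there are constants `a, b ∈ ℂ`
such that for every `N ∈ ℕ` there is `C_N` with
`|u(x) − a e^{iλx} − b e^{−iλx}| ≤ C_N x^{−N}` for all `x ≥ max(R, 1)`. -/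
theorem one_dim_helmholtz_asymptotics
    (lam : ℝ) (hlam : 0 < lam) (R : ℝ) (g : SchwartzMap ℝ ℂ)
    (u : ℝ → ℂ) (hu : ContDiff ℝ 2 u)
    (hode : ∀ x : ℝ, deriv (deriv u) x + (lam : ℂ) ^ 2 * u x = g x)
    (hvan : ∀ x : ℝ, x ≤ R → u x = 0) :
    ∃ a b : ℂ, ∀ N : ℕ, ∃ C : ℝ, ∀ x : ℝ, max R 1 ≤ x →
      ‖u x - a * Complex.exp (Complex.I * lam * x) -
          b * Complex.exp (-Complex.I * lam * x)‖ ≤ C / x ^ N := by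
  obtain ⟨A, hA⟩ := exists_deriv_add_mul_asymptotic lam lam rfl g u hu hode
  obtain ⟨B, hB⟩ := exists_deriv_add_mul_asymptotic lam (-lam) (neg_sq lam) g u hu hode
  have hl : (lam : ℂ) ≠ 0 := by exact_mod_cast hlam.ne'
  have hk : 2 * Complex.I * (lam : ℂ) ≠ 0 := by simp [hl]
  refine ⟨A / (2 * Complex.I * lam), -B / (2 * Complex.I * lam), fun N ↦ ?_⟩
  obtain ⟨C, hC⟩ := hA N
  obtain ⟨D, hD⟩ := hB N
  refine ⟨(C + D) / ‖2 * Complex.I * (lam : ℂ)‖, fun x hx ↦ ?_⟩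
  have hx0 : 0 < x := zero_lt_one.trans_le ((le_max_right R 1).trans hx)
  have hCD := (norm_sub_le _ _).trans (add_le_add (hC x hx0) (hD x hx0))
  rw [div_right_comm, add_div, le_div_iff₀ (norm_pos_iff.2 hk), ← norm_mul]
  refine (congrArg norm ?_).trans_le hCD
  push_cast
  rw [mul_neg, ← neg_mul]
  field_simp
  ring
end
end
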